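/- arXiv:1701.07721 — 2 statements merged into one kernel-verified Lean document; each statement's English description precedes it below -/
import Mathlib

section
/- Let R be a commutative noetherian ring with unity, let a be an ideal of R, and let M be an R-module with Supp_R(M) ⊆ V(a). Then M is a-cofinite if and only if Tor^R_i(R/a, M) is a finitely generated R-module for every i ≥ 0. -/
open CategoryTheory

/-- A bounded complex of finite direct sums of copies of `M`, with a single copy of `M` at both
ends and with differentials in `a • Hom`, as for the Koszul complex of generators of `a`
with coefficients in `M`. -/
structure KoszulData {R : Type u} [CommRing R] (a : Ideal R)
    (M : Type u) [AddCommGroup M] [Module R M] where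
  X : ℤ → ModuleCat.{u} R
  d : ∀ i, X i →ₗ[R] X (i + 1)
  d_comp_d : ∀ i, d (i + 1) ∘ₗ d i = 0
  d_mem : ∀ i, d i ∈ a • (⊤ : Submodule R (X i →ₗ[R] X (i + 1)))
  copies : ∀ i, ∃ n, Nonempty (X i ≃ₗ[R] (Fin n → M))
  bot : ℤ
  top : ℤ
  subsingleton_bot : ∀ i ≤ bot, Subsingleton (X i)
  subsingleton_top : ∀ i, top + 1 < i → Subsingleton (X i)
  botEquiv : X (bot + 1) ≃ₗ[R] M
  topEquiv : X (top + 1) ≃ₗ[R] M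

namespace KoszulData

variable {R : Type u} [CommRing R] {a : Ideal R} {M : Type u} [AddCommGroup M] [Module R M]

/-- Multiplication by `y` on the complex is null-homotopic. -/
def NullHomotopic (K : KoszulData a M) (y : R) : Prop :=
  ∃ s : ∀ i, K.X (i + 1) →ₗ[R] K.X i, ∀ i z,
    K.d i (s i z) + s (i + 1) (K.d (i + 1) z) = y • z

/-- The complex with `M` in a single degree. -/
def single (a : Ideal R) (M : Type u) [AddCommGroup M] [Module R M] : KoszulData a M where
  X i := ModuleCat.of R (PLift (i = 0) → M)
  d _ := 0
  d_comp_d _ := rfl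
  d_mem _ := zero_mem _
  copies i := by
    obtain ⟨n, ⟨e⟩⟩ := Finite.exists_equiv_fin (PLift (i = 0))
    exact ⟨n, ⟨LinearEquiv.funCongrLeft R M e.symm⟩⟩
  bot := -1
  top := -1
  subsingleton_bot i hi := by
    have : IsEmpty (PLift (i = 0)) := ⟨fun h => by have := h.down; lia⟩
    change Subsingleton (PLift (i = 0) → M)
    infer_instance
  subsingleton_top i hi := by
    have : IsEmpty (PLift (i = 0)) := ⟨fun h => by have := h.down; lia⟩
    change Subsingleton (PLift (i = 0) → M)
    infer_instance
  botEquiv :=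
    haveI : Unique (PLift ((-1 : ℤ) + 1 = 0)) := ⟨⟨⟨by simp⟩⟩, fun _ => rfl⟩
    LinearEquiv.funUnique (PLift ((-1 : ℤ) + 1 = 0)) R M
  topEquiv :=
    haveI : Unique (PLift ((-1 : ℤ) + 1 = 0)) := ⟨⟨⟨by simp⟩⟩, fun _ => rfl⟩
    LinearEquiv.funUnique (PLift ((-1 : ℤ) + 1 = 0)) R M

lemma comp_mem_smul_top {A B C D : Type*} [AddCommGroup A] [AddCommGroup B] [AddCommGroup C]
    [AddCommGroup D] [Module R A] [Module R B] [Module R C] [Module R D]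
    (g : C →ₗ[R] D) {f : B →ₗ[R] C} (hf : f ∈ a • (⊤ : Submodule R (B →ₗ[R] C)))
    (h : A →ₗ[R] B) : g ∘ₗ f ∘ₗ h ∈ a • (⊤ : Submodule R (A →ₗ[R] D)) := by
  induction hf using Submodule.smul_induction_on' with
  | smul x hx f _ =>
    rw [LinearMap.smul_comp, LinearMap.comp_smul]
    exact Submodule.smul_mem_smul hx trivial
  | add f _ f' _ h1 h2 =>
    rw [LinearMap.add_comp, LinearMap.comp_add]
    exact add_mem h1 h2

/-- The mapping cone of multiplication by `x`. -/
def cone (K : KoszulData a M) (x : R) (hx : x ∈ a) : KoszulData a M where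
  X i := ModuleCat.of R (K.X i × K.X (i + 1))
  d i := LinearMap.prod (K.d i ∘ₗ LinearMap.fst R _ _ + x • LinearMap.snd R _ _)
    (-(K.d (i + 1) ∘ₗ LinearMap.snd R _ _))
  d_comp_d i := by
    have h1 := LinearMap.congr_fun (K.d_comp_d i)
    have h2 := LinearMap.congr_fun (K.d_comp_d (i + 1))
    simp only [LinearMap.comp_apply, LinearMap.zero_apply] at h1 h2
    apply LinearMap.ext
    rintro ⟨u, v⟩
    simp [h1, h2]
  d_mem i := by
    have h1 := comp_mem_smul_top (LinearMap.inl R (K.X (i + 1)) (K.X (i + 1 + 1))) (K.d_mem i)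
      (LinearMap.fst R (K.X i) (K.X (i + 1)))
    have h2 := comp_mem_smul_top (LinearMap.inr R (K.X (i + 1)) (K.X (i + 1 + 1)))
      (K.d_mem (i + 1)) (LinearMap.snd R (K.X i) (K.X (i + 1)))
    have h3 : x • (LinearMap.inl R (K.X (i + 1)) (K.X (i + 1 + 1)) ∘ₗ
      (LinearMap.snd R (K.X i) (K.X (i + 1)))) ∈ a • (⊤ : Submodule R _) :=
      Submodule.smul_mem_smul hx trivial
    convert sub_mem (add_mem h1 h3) h2 using 1
    apply LinearMap.ext
    rintro ⟨u, v⟩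
    simp
  copies i := by
    obtain ⟨n, ⟨e⟩⟩ := K.copies i
    obtain ⟨m, ⟨f⟩⟩ := K.copies (i + 1)
    exact ⟨n + m, ⟨(e.prodCongr f) ≪≫ₗ (LinearEquiv.sumArrowLequivProdArrow _ _ R M).symm ≪≫ₗ
      LinearEquiv.funCongrLeft R M finSumFinEquiv.symm⟩⟩
  bot := K.bot - 1
  top := K.top
  subsingleton_bot i hi := by
    have := K.subsingleton_bot i (by lia)
    have := K.subsingleton_bot (i + 1) (by lia)
    change Subsingleton (K.X i × K.X (i + 1))
    infer_instance
  subsingleton_top i hi := by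
    have := K.subsingleton_top i (by lia)
    have := K.subsingleton_top (i + 1) (by lia)
    change Subsingleton (K.X i × K.X (i + 1))
    infer_instance
  botEquiv :=
    haveI := K.subsingleton_bot (K.bot - 1 + 1) (by lia)
    haveI : Unique (K.X (K.bot - 1 + 1)) := uniqueOfSubsingleton 0
    (LinearEquiv.uniqueProd (R := R) (M₂ := K.X (K.bot - 1 + 1))) ≪≫ₗ
      ((LinearEquiv.cast (R := R) (M := fun i => K.X i)
        (show K.bot - 1 + 1 + 1 = K.bot + 1 by lia))) ≪≫ₗ K.botEquiv
  topEquiv :=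
    haveI := K.subsingleton_top (K.top + 1 + 1) (by lia)
    haveI : Unique (K.X (K.top + 1 + 1)) := uniqueOfSubsingleton 0
    (LinearEquiv.prodUnique (R := R) (M₂ := K.X (K.top + 1 + 1))) ≪≫ₗ K.topEquiv

lemma NullHomotopic.cone {K : KoszulData a M} {y : R} (h : K.NullHomotopic y)
    (x : R) (hx : x ∈ a) : (K.cone x hx).NullHomotopic y := by
  obtain ⟨s, hs⟩ := h
  refine ⟨fun i => (s i).prodMap (-(s (i + 1))), ?_⟩
  rintro i ⟨u, v⟩
  have h1 := hs i u
  have h2 := hs (i + 1) v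
  apply Prod.ext
  · change K.d i (s i u) + x • (-(s (i + 1) v)) + s (i + 1) (K.d (i + 1) u + x • v) = y • u
    rw [← h1, map_add, map_smul, smul_neg]
    abel
  · change -(K.d (i + 1) (-(s (i + 1) v))) + -(s (i + 1 + 1) (-(K.d (i + 1 + 1) v))) = y • v
    rw [← h2, map_neg, map_neg, neg_neg, neg_neg]

lemma nullHomotopic_cone (K : KoszulData a M) (x : R) (hx : x ∈ a) :
    (K.cone x hx).NullHomotopic x := by
  refine ⟨fun i => LinearMap.inr R (K.X i) (K.X (i + 1)) ∘ₗ LinearMap.fst R _ _, ?_⟩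
  rintro i ⟨u, v⟩
  apply Prod.ext
  · change K.d i 0 + x • u + 0 = x • u
    simp
  · change -(K.d (i + 1) u) + (K.d (i + 1) u + x • v) = x • v
    simp

/-- The scalars acting null-homotopically form an ideal. -/
def nullIdeal (K : KoszulData a M) : Ideal R where
  carrier := {y | K.NullHomotopic y}
  zero_mem' := ⟨fun _ => 0, by simp⟩
  add_mem' := by
    rintro y y' ⟨s, hs⟩ ⟨s', hs'⟩
    refine ⟨fun i => s i + s' i, fun i z => ?_⟩
    rw [add_smul, ← hs, ← hs']
    simp only [LinearMap.add_apply, map_add]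
    abel
  smul_mem' := by
    rintro c y ⟨s, hs⟩
    refine ⟨fun i => c • s i, fun i z => ?_⟩
    rw [smul_assoc, ← hs]
    simp

lemma exists_nullHomotopic (a : Ideal R) (ha : a.FG) (M : Type u) [AddCommGroup M] [Module R M] :
    ∃ K : KoszulData a M, ∀ y ∈ a, K.NullHomotopic y := by
  classical
  obtain ⟨S, hS⟩ := ha
  have key : ∀ T : Finset R, (T : Set R) ⊆ a →
      ∃ K : KoszulData a M, ∀ y ∈ T, K.NullHomotopic y := by
    intro T
    induction T using Finset.induction_on with
    | empty => exact fun _ => ⟨single a M, by simp⟩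
    | insert x T _ ih =>
      intro hT
      rw [Finset.coe_insert, Set.insert_subset_iff] at hT
      obtain ⟨K, hK⟩ := ih hT.2
      refine ⟨K.cone x hT.1, fun y hy => ?_⟩
      rcases Finset.mem_insert.1 hy with rfl | hy
      · exact K.nullHomotopic_cone y hT.1
      · exact (hK y hy).cone x hT.1
  obtain ⟨K, hK⟩ := key S (hS ▸ Submodule.subset_span)
  refine ⟨K, fun y hy => ?_⟩
  have : a ≤ K.nullIdeal := by
    exact hS.symm.trans_le (Submodule.span_le.2 hK)
  exact this hy

/-- The cohomology in degree `i + 1`. -/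
def H (K : KoszulData a M) (i : ℤ) : Submodule R (K.X (i + 1) ⧸ LinearMap.range (K.d i)) :=
  (LinearMap.ker (K.d (i + 1))).map (LinearMap.range (K.d i)).mkQ

lemma smul_H_eq_zero (K : KoszulData a M) {y : R} (hy : K.NullHomotopic y) (i : ℤ) (z : K.H i) :
    y • z = 0 := by
  obtain ⟨s, hs⟩ := hy
  obtain ⟨_, z, hz, rfl⟩ := z
  ext
  rw [Submodule.coe_smul, ← map_smul, ← hs, show K.d (i + 1) z = 0 from hz]
  simp

end KoszulData

/-- The finiteness properties of a family `P j` of classes of modules that make it behave like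
`Ext^j(R/a, -)` being finitely generated. -/
structure IsExtLike {R : Type u} [CommRing R] (a : Ideal R) (P : ℕ → ModuleCat.{u} R → Prop) :
    Prop where
  of_finite : ∀ (j : ℕ) (A : ModuleCat.{u} R), Module.Finite R A → P j A
  middle : ∀ {A B C : ModuleCat.{u} R} (f : A →ₗ[R] B) (g : B →ₗ[R] C), Function.Injective f →
    Function.Exact f g → Function.Surjective g → ∀ j, P j A → P j C → P j B
  right : ∀ {A B C : ModuleCat.{u} R} (f : A →ₗ[R] B) (g : B →ₗ[R] C), Function.Injective f →
    Function.Exact f g → Function.Surjective g → ∀ j, P j B → P (j + 1) A → P j C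
  left_zero : ∀ {A B C : ModuleCat.{u} R} (f : A →ₗ[R] B) (g : B →ₗ[R] C), Function.Injective f →
    Function.Exact f g → Function.Surjective g → P 0 B → P 0 A
  left_succ : ∀ {A B C : ModuleCat.{u} R} (f : A →ₗ[R] B) (g : B →ₗ[R] C), Function.Injective f →
    Function.Exact f g → Function.Surjective g → ∀ j, P j C → P (j + 1) B → P (j + 1) A
  finite_of_smul_eq_zero : ∀ A : ModuleCat.{u} R, (∀ y ∈ a, ∀ z : A, y • z = 0) → P 0 A →
    Module.Finite R A
  of_mem_smul : ∀ {A B : ModuleCat.{u} R} (f : A →ₗ[R] B),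
    f ∈ a • (⊤ : Submodule R (A →ₗ[R] B)) → ∀ j, P j (ModuleCat.of R (LinearMap.ker f)) →
    (∀ l, j = l + 1 → P l (ModuleCat.of R (B ⧸ LinearMap.range f))) → P j A

/-- The finiteness properties of a family `P j` of classes of modules that make it behave like
`Tor_j(R/a, -)` being finitely generated. -/
structure IsTorLike {R : Type u} [CommRing R] (a : Ideal R) (P : ℕ → ModuleCat.{u} R → Prop) :
    Prop where
  of_finite : ∀ (j : ℕ) (A : ModuleCat.{u} R), Module.Finite R A → P j A
  middle : ∀ {A B C : ModuleCat.{u} R} (f : A →ₗ[R] B) (g : B →ₗ[R] C), Function.Injective f →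
    Function.Exact f g → Function.Surjective g → ∀ j, P j A → P j C → P j B
  left : ∀ {A B C : ModuleCat.{u} R} (f : A →ₗ[R] B) (g : B →ₗ[R] C), Function.Injective f →
    Function.Exact f g → Function.Surjective g → ∀ j, P j B → P (j + 1) C → P j A
  right_zero : ∀ {A B C : ModuleCat.{u} R} (f : A →ₗ[R] B) (g : B →ₗ[R] C), Function.Injective f →
    Function.Exact f g → Function.Surjective g → P 0 B → P 0 C
  right_succ : ∀ {A B C : ModuleCat.{u} R} (f : A →ₗ[R] B) (g : B →ₗ[R] C), Function.Injective f →
    Function.Exact f g → Function.Surjective g → ∀ j, P j A → P (j + 1) B → P (j + 1) C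
  finite_of_smul_eq_zero : ∀ A : ModuleCat.{u} R, (∀ y ∈ a, ∀ z : A, y • z = 0) → P 0 A →
    Module.Finite R A
  of_mem_smul : ∀ {A B : ModuleCat.{u} R} (f : A →ₗ[R] B),
    f ∈ a • (⊤ : Submodule R (A →ₗ[R] B)) → ∀ j,
    P j (ModuleCat.of R (B ⧸ LinearMap.range f)) →
    (∀ l, j = l + 1 → P l (ModuleCat.of R (LinearMap.ker f))) → P j B

namespace KoszulData

variable {R : Type u} [CommRing R] {a : Ideal R} {M : Type u} [AddCommGroup M] [Module R M]

/-- The map `X (i + 1) ⧸ range (d i) → range (d (i + 1))` induced by `d (i + 1)`. -/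
def toRange (K : KoszulData a M) (i : ℤ) :
    (K.X (i + 1) ⧸ LinearMap.range (K.d i)) →ₗ[R] LinearMap.range (K.d (i + 1)) :=
  (LinearMap.range (K.d i)).liftQ (K.d (i + 1)).rangeRestrict (by
    rintro _ ⟨z, rfl⟩
    exact Subtype.ext (LinearMap.congr_fun (K.d_comp_d i) z))

lemma toRange_surjective (K : KoszulData a M) (i : ℤ) : Function.Surjective (K.toRange i) := by
  rintro ⟨_, z, rfl⟩
  exact ⟨Submodule.Quotient.mk z, rfl⟩

lemma exact_H_toRange (K : KoszulData a M) (i : ℤ) :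
    Function.Exact (K.H i).subtype (K.toRange i) := by
  intro z
  obtain ⟨z, rfl⟩ := Submodule.Quotient.mk_surjective _ z
  constructor
  · intro hz
    exact ⟨⟨_, z, congrArg Subtype.val hz, rfl⟩, rfl⟩
  · rintro ⟨⟨_, w, hw, rfl⟩, hz⟩
    rw [← hz]
    exact Subtype.ext hw

/-- The projection from cocycles to cohomology. -/
def kerToH (K : KoszulData a M) (i : ℤ) : LinearMap.ker (K.d (i + 1)) →ₗ[R] K.H i :=
  LinearMap.submoduleMap _ _

/-- The inclusion of coboundaries into cocycles. -/
def rangeToKer (K : KoszulData a M) (i : ℤ) :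
    LinearMap.range (K.d i) →ₗ[R] LinearMap.ker (K.d (i + 1)) :=
  Submodule.inclusion (LinearMap.range_le_ker_iff.2 (K.d_comp_d i))

lemma kerToH_surjective (K : KoszulData a M) (i : ℤ) : Function.Surjective (K.kerToH i) :=
  LinearMap.submoduleMap_surjective _ _

lemma rangeToKer_injective (K : KoszulData a M) (i : ℤ) : Function.Injective (K.rangeToKer i) :=
  Submodule.inclusion_injective _

lemma exact_rangeToKer_kerToH (K : KoszulData a M) (i : ℤ) :
    Function.Exact (K.rangeToKer i) (K.kerToH i) := by
  rintro ⟨z, hz⟩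
  constructor
  · intro h
    exact ⟨⟨z, (Submodule.Quotient.mk_eq_zero _).1 (congrArg Subtype.val h)⟩, rfl⟩
  · rintro ⟨⟨w, hw⟩, h⟩
    obtain rfl : w = z := congrArg Subtype.val h
    exact Subtype.ext ((Submodule.Quotient.mk_eq_zero _).2 hw)

lemma finite_of_copies {P : ModuleCat.{u} R → Prop}
    (h_finite : ∀ A : ModuleCat.{u} R, Module.Finite R A → P A)
    (h_middle : ∀ {A B C : ModuleCat.{u} R} (f : A →ₗ[R] B) (g : B →ₗ[R] C),
      Function.Injective f → Function.Exact f g → Function.Surjective g → P A → P C → P B)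
    (hM : P (ModuleCat.of R M)) (K : KoszulData a M) (i : ℤ) : P (K.X i) := by
  have h_equiv : ∀ {A B : ModuleCat.{u} R} (_ : A ≃ₗ[R] B), P A → P B := fun {A B} e hA =>
    h_middle (C := ModuleCat.of R PUnit.{u + 1}) e.toLinearMap 0 e.injective
      (fun z => ⟨fun _ => e.surjective z, fun _ => rfl⟩) (fun _ => ⟨0, rfl⟩) hA
      (h_finite _ (inferInstanceAs (Module.Finite R PUnit.{u + 1})))
  have h_pi : ∀ n : ℕ, P (ModuleCat.of R (Fin n → M)) := by
    intro n
    induction n with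
    | zero => exact h_finite _ (inferInstanceAs (Module.Finite R (Fin 0 → M)))
    | succ n ih =>
      have h := h_middle (A := ModuleCat.of R M) (B := ModuleCat.of R (M × (Fin n → M)))
        (C := ModuleCat.of R (Fin n → M)) (LinearMap.inl R M (Fin n → M)) (LinearMap.snd R M _)
        LinearMap.inl_injective .inl_snd LinearMap.snd_surjective hM ih
      exact h_equiv (A := ModuleCat.of R (M × (Fin n → M)))
        (B := ModuleCat.of R (Fin (n + 1) → M)) (Fin.consLinearEquiv R fun _ => M) h
  obtain ⟨n, ⟨e⟩⟩ := K.copies i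
  exact h_equiv (A := ModuleCat.of R (Fin n → M)) e.symm (h_pi n)

lemma range_finite_of_subsingleton (K : KoszulData a M) (i : ℤ) [Subsingleton (K.X i)] :
    Module.Finite R (LinearMap.range (K.d i)) := by
  have : Subsingleton (LinearMap.range (K.d i)) :=
    (LinearMap.surjective_rangeRestrict (K.d i)).subsingleton
  infer_instance

end KoszulData

namespace IsExtLike

variable {R : Type u} [CommRing R] {a : Ideal R} {M : Type u} [AddCommGroup M] [Module R M]
  {P : ℕ → ModuleCat.{u} R → Prop}

lemma finite_H (h : IsExtLike a P) (hM : ∀ j, P j (ModuleCat.of R M)) (K : KoszulData a M)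
    (hK : ∀ y ∈ a, K.NullHomotopic y) (i : ℤ) : Module.Finite R (K.H i) := by
  have hX : ∀ i j, P j (K.X i) := fun i j =>
    KoszulData.finite_of_copies (h.of_finite j) (fun f g h1 h2 h3 => h.middle f g h1 h2 h3 j)
      (hM j) K i
  have hC : ∀ i, (∀ j, P j (ModuleCat.of R (LinearMap.range (K.d i)))) →
      ∀ j, P j (ModuleCat.of R (K.X (i + 1) ⧸ LinearMap.range (K.d i))) := fun i hi j =>
    h.right (A := ModuleCat.of R (LinearMap.range (K.d i)))
      (C := ModuleCat.of R (K.X (i + 1) ⧸ LinearMap.range (K.d i)))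
      (LinearMap.range (K.d i)).subtype (LinearMap.range (K.d i)).mkQ
      (Submodule.subtype_injective _) (LinearMap.exact_subtype_mkQ _)
      (Submodule.mkQ_surjective _) j (hX _ _) (hi _)
  have hH : ∀ i, (∀ j, P j (ModuleCat.of R (LinearMap.range (K.d i)))) →
      Module.Finite R (K.H i) := fun i hi =>
    h.finite_of_smul_eq_zero (ModuleCat.of R (K.H i))
      (fun y hy => K.smul_H_eq_zero (hK y hy) i)
      (h.left_zero (A := ModuleCat.of R (K.H i))
        (B := ModuleCat.of R (K.X (i + 1) ⧸ LinearMap.range (K.d i)))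
        (C := ModuleCat.of R (LinearMap.range (K.d (i + 1)))) (K.H i).subtype (K.toRange i)
        (Submodule.subtype_injective _) (K.exact_H_toRange i) (K.toRange_surjective i)
        (hC i hi 0))
  have hbot : ∀ i ≤ K.bot, ∀ j, P j (ModuleCat.of R (LinearMap.range (K.d i))) := fun i hi j =>
    haveI := K.subsingleton_bot i hi
    h.of_finite j _ (K.range_finite_of_subsingleton i)
  refine hH i ?_
  rcases le_total i K.bot with hi | hi
  · exact hbot i hi
  induction i, hi using Int.leInduction with
  | base => exact hbot _ le_rfl
  | succ i _ ih =>
    exact fun j => h.right (A := ModuleCat.of R (K.H i))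
      (B := ModuleCat.of R (K.X (i + 1) ⧸ LinearMap.range (K.d i)))
      (C := ModuleCat.of R (LinearMap.range (K.d (i + 1)))) (K.H i).subtype (K.toRange i)
      (Submodule.subtype_injective _) (K.exact_H_toRange i) (K.toRange_surjective i) j
      (hC i ih j) (h.of_finite _ _ (hH i ih))

lemma of_finite_H [IsNoetherianRing R] (h : IsExtLike a P) (K : KoszulData a M)
    (hH : ∀ i, Module.Finite R (K.H i)) (j : ℕ) : P j (ModuleCat.of R M) := by
  have h_equiv : ∀ {j} {A B : ModuleCat.{u} R} (_ : A ≃ₗ[R] B), P j A → P j B :=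
    fun {j A B} e hA => h.middle (C := ModuleCat.of R PUnit.{u + 1}) e.toLinearMap 0 e.injective
      (fun z => ⟨fun _ => e.surjective z, fun _ => rfl⟩) (fun _ => ⟨0, rfl⟩) j hA
      (h.of_finite _ _ (inferInstanceAs (Module.Finite R PUnit.{u + 1})))
  induction j using Nat.strong_induction_on with
  | _ j ih =>
    have hX : ∀ l < j, ∀ i, P l (K.X i) := fun l hl i =>
      KoszulData.finite_of_copies (h.of_finite l) (fun f g h1 h2 h3 => h.middle f g h1 h2 h3 l)
        (ih l hl) K i
    have hC : ∀ l < j, ∀ i, P l (ModuleCat.of R (K.X (i + 1) ⧸ LinearMap.range (K.d i))) := by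
      intro l
      induction l with
      | zero =>
        intro hl i
        refine h.middle (A := ModuleCat.of R (K.H i))
          (B := ModuleCat.of R (K.X (i + 1) ⧸ LinearMap.range (K.d i)))
          (C := ModuleCat.of R (LinearMap.range (K.d (i + 1)))) (K.H i).subtype (K.toRange i)
          (Submodule.subtype_injective _) (K.exact_H_toRange i) (K.toRange_surjective i) 0
          (h.of_finite _ _ (hH i)) ?_
        exact h.left_zero (A := ModuleCat.of R (LinearMap.range (K.d (i + 1))))
          (C := ModuleCat.of R (K.X (i + 1 + 1) ⧸ LinearMap.range (K.d (i + 1))))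
          (LinearMap.range (K.d (i + 1))).subtype (LinearMap.range (K.d (i + 1))).mkQ
          (Submodule.subtype_injective _) (LinearMap.exact_subtype_mkQ _)
          (Submodule.mkQ_surjective _) (hX 0 hl _)
      | succ l ihl =>
        intro hl i
        refine h.middle (A := ModuleCat.of R (K.H i))
          (B := ModuleCat.of R (K.X (i + 1) ⧸ LinearMap.range (K.d i)))
          (C := ModuleCat.of R (LinearMap.range (K.d (i + 1)))) (K.H i).subtype (K.toRange i)
          (Submodule.subtype_injective _) (K.exact_H_toRange i) (K.toRange_surjective i) _
          (h.of_finite _ _ (hH i)) ?_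
        exact h.left_succ (A := ModuleCat.of R (LinearMap.range (K.d (i + 1))))
          (C := ModuleCat.of R (K.X (i + 1 + 1) ⧸ LinearMap.range (K.d (i + 1))))
          (LinearMap.range (K.d (i + 1))).subtype (LinearMap.range (K.d (i + 1))).mkQ
          (Submodule.subtype_injective _) (LinearMap.exact_subtype_mkQ _)
          (Submodule.mkQ_surjective _) l (ihl (by lia) _) (hX _ hl _)
    refine h_equiv (A := K.X (K.bot + 1)) (B := ModuleCat.of R M) K.botEquiv
      (h.of_mem_smul (K.d (K.bot + 1)) (K.d_mem _) j (h.of_finite _ _ ?_)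
        fun l hl => hC l (by lia) _)
    have := hH K.bot
    have := K.subsingleton_bot K.bot le_rfl
    refine Module.Finite.of_injective (K.kerToH K.bot) ?_
    rw [← LinearMap.ker_eq_bot, (K.exact_rangeToKer_kerToH K.bot).linearMap_ker_eq,
      LinearMap.range_eq_bot]
    ext ⟨_, z, rfl⟩
    obtain rfl : z = 0 := Subsingleton.elim _ _
    exact congrArg Subtype.val (Subtype.ext (map_zero (K.d K.bot)) :
      K.rangeToKer K.bot ⟨K.d K.bot 0, ⟨0, rfl⟩⟩ = 0)

end IsExtLike

namespace IsTorLike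

variable {R : Type u} [CommRing R] {a : Ideal R} {M : Type u} [AddCommGroup M] [Module R M]
  {P : ℕ → ModuleCat.{u} R → Prop}

lemma finite_H (h : IsTorLike a P) (hM : ∀ j, P j (ModuleCat.of R M)) (K : KoszulData a M)
    (hK : ∀ y ∈ a, K.NullHomotopic y) (i : ℤ) : Module.Finite R (K.H i) := by
  have hX : ∀ i j, P j (K.X i) := fun i j =>
    KoszulData.finite_of_copies (h.of_finite j) (fun f g h1 h2 h3 => h.middle f g h1 h2 h3 j)
      (hM j) K i
  have hZ : ∀ i, (∀ j, P j (ModuleCat.of R (LinearMap.range (K.d i)))) →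
      ∀ j, P j (ModuleCat.of R (LinearMap.ker (K.d i))) := fun i hi j =>
    h.left (A := ModuleCat.of R (LinearMap.ker (K.d i)))
      (C := ModuleCat.of R (LinearMap.range (K.d i)))
      (LinearMap.ker (K.d i)).subtype (K.d i).rangeRestrict
      (Submodule.subtype_injective _)
      (LinearMap.exact_iff.2 (by rw [LinearMap.ker_rangeRestrict, Submodule.range_subtype]))
      (LinearMap.surjective_rangeRestrict _) j (hX _ _) (hi _)
  have hH : ∀ i, (∀ j, P j (ModuleCat.of R (LinearMap.range (K.d (i + 1))))) →
      Module.Finite R (K.H i) := fun i hi =>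
    h.finite_of_smul_eq_zero (ModuleCat.of R (K.H i))
      (fun y hy => K.smul_H_eq_zero (hK y hy) i)
      (h.right_zero (A := ModuleCat.of R (LinearMap.range (K.d i)))
        (B := ModuleCat.of R (LinearMap.ker (K.d (i + 1))))
        (C := ModuleCat.of R (K.H i)) (K.rangeToKer i) (K.kerToH i)
        (K.rangeToKer_injective i) (K.exact_rangeToKer_kerToH i) (K.kerToH_surjective i)
        (hZ _ hi 0))
  have htop : ∀ i, K.top + 1 < i → ∀ j, P j (ModuleCat.of R (LinearMap.range (K.d i))) :=
    fun i hi j =>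
      haveI := K.subsingleton_top i hi
      h.of_finite j _ (K.range_finite_of_subsingleton i)
  have hB : ∀ (n : ℕ) (i : ℤ), K.top + 1 < i + n →
      ∀ j, P j (ModuleCat.of R (LinearMap.range (K.d i))) := by
    intro n
    induction n with
    | zero => exact fun i hi => htop i (by simpa using hi)
    | succ n ih =>
      intro i hi j
      have hi' := ih (i + 1) (by push_cast at hi; lia)
      exact h.left (A := ModuleCat.of R (LinearMap.range (K.d i)))
        (B := ModuleCat.of R (LinearMap.ker (K.d (i + 1))))
        (C := ModuleCat.of R (K.H i)) (K.rangeToKer i) (K.kerToH i)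
        (K.rangeToKer_injective i) (K.exact_rangeToKer_kerToH i) (K.kerToH_surjective i) j
        (hZ _ hi' j) (h.of_finite _ _ (hH i hi'))
  exact hH i (hB (K.top + 1 - i).toNat (i + 1) (by have := Int.self_le_toNat (K.top + 1 - i); lia))

lemma of_finite_H (h : IsTorLike a P) (K : KoszulData a M) (hH : ∀ i, Module.Finite R (K.H i))
    (j : ℕ) : P j (ModuleCat.of R M) := by
  have h_equiv : ∀ {j} {A B : ModuleCat.{u} R} (_ : A ≃ₗ[R] B), P j A → P j B :=
    fun {j A B} e hA => h.middle (C := ModuleCat.of R PUnit.{u + 1}) e.toLinearMap 0 e.injective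
      (fun z => ⟨fun _ => e.surjective z, fun _ => rfl⟩) (fun _ => ⟨0, rfl⟩) j hA
      (h.of_finite _ _ (inferInstanceAs (Module.Finite R PUnit.{u + 1})))
  induction j using Nat.strong_induction_on with
  | _ j ih =>
    have hX : ∀ l < j, ∀ i, P l (K.X i) := fun l hl i =>
      KoszulData.finite_of_copies (h.of_finite l) (fun f g h1 h2 h3 => h.middle f g h1 h2 h3 l)
        (ih l hl) K i
    have hZ : ∀ l < j, ∀ i, P l (ModuleCat.of R (LinearMap.ker (K.d i))) := by
      intro l
      have h_ses : ∀ i, Function.Exact (LinearMap.ker (K.d i)).subtype (K.d i).rangeRestrict :=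
        fun i => LinearMap.exact_iff.2
          (by rw [LinearMap.ker_rangeRestrict, Submodule.range_subtype])
      induction l with
      | zero =>
        intro hl i
        obtain ⟨i, rfl⟩ : ∃ k, i = k + 1 := ⟨i - 1, by lia⟩
        refine h.middle (A := ModuleCat.of R (LinearMap.range (K.d i)))
          (B := ModuleCat.of R (LinearMap.ker (K.d (i + 1))))
          (C := ModuleCat.of R (K.H i)) (K.rangeToKer i) (K.kerToH i)
          (K.rangeToKer_injective i) (K.exact_rangeToKer_kerToH i) (K.kerToH_surjective i) 0
          ?_ (h.of_finite _ _ (hH i))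
        exact h.right_zero (A := ModuleCat.of R (LinearMap.ker (K.d i)))
          (C := ModuleCat.of R (LinearMap.range (K.d i)))
          (LinearMap.ker (K.d i)).subtype (K.d i).rangeRestrict
          (Submodule.subtype_injective _) (h_ses i)
          (LinearMap.surjective_rangeRestrict _) (hX 0 hl i)
      | succ l ihl =>
        intro hl i
        obtain ⟨i, rfl⟩ : ∃ k, i = k + 1 := ⟨i - 1, by lia⟩
        refine h.middle (A := ModuleCat.of R (LinearMap.range (K.d i)))
          (B := ModuleCat.of R (LinearMap.ker (K.d (i + 1))))
          (C := ModuleCat.of R (K.H i)) (K.rangeToKer i) (K.kerToH i)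
          (K.rangeToKer_injective i) (K.exact_rangeToKer_kerToH i) (K.kerToH_surjective i) _
          ?_ (h.of_finite _ _ (hH i))
        exact h.right_succ (A := ModuleCat.of R (LinearMap.ker (K.d i)))
          (C := ModuleCat.of R (LinearMap.range (K.d i)))
          (LinearMap.ker (K.d i)).subtype (K.d i).rangeRestrict
          (Submodule.subtype_injective _) (h_ses i)
          (LinearMap.surjective_rangeRestrict _) l (ihl (by lia) i) (hX _ hl i)
    refine h_equiv (A := K.X (K.top + 1)) (B := ModuleCat.of R M) K.topEquiv
      (h.of_mem_smul (K.d K.top) (K.d_mem _) j (h.of_finite _ _ ?_)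
        fun l hl => hZ l (by lia) _)
    have := hH K.top
    have := K.subsingleton_top (K.top + 1 + 1) (by lia)
    refine Module.Finite.of_surjective (K.H K.top).subtype ?_
    rintro z
    obtain ⟨z, rfl⟩ := Submodule.Quotient.mk_surjective _ z
    exact ⟨⟨_, z, Subsingleton.elim (α := K.X (K.top + 1 + 1)) _ _, rfl⟩, rfl⟩

end IsTorLike

theorem forall_iff_of_isExtLike_of_isTorLike {R : Type u} [CommRing R]
    [IsNoetherianRing R] {a : Ideal R}
    {P Q : ℕ → ModuleCat.{u} R → Prop} (hP : IsExtLike a P) (hQ : IsTorLike a Q)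
    (M : Type u) [AddCommGroup M] [Module R M] :
    (∀ j, P j (ModuleCat.of R M)) ↔ ∀ j, Q j (ModuleCat.of R M) := by
  obtain ⟨K, hK⟩ := KoszulData.exists_nullHomotopic a (IsNoetherian.noetherian a) M
  exact ⟨fun h => hQ.of_finite_H K (hP.finite_H h K hK),
    fun h => hP.of_finite_H K (hQ.finite_H h K hK)⟩

lemma Module.Finite.of_exact_of_isNoetherianRing {R A B C : Type*} [CommRing R]
    [IsNoetherianRing R] [AddCommGroup A] [AddCommGroup B] [AddCommGroup C] [Module R A]
    [Module R B] [Module R C] {f : A →ₗ[R] B} {g : B →ₗ[R] C} (h : Function.Exact f g)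
    (hA : Module.Finite R A) (hC : Module.Finite R C) : Module.Finite R B := by
  have := isNoetherian_of_isNoetherianRing_of_finite R A
  have := isNoetherian_of_isNoetherianRing_of_finite R C
  have := isNoetherian_of_range_eq_ker f g h.linearMap_ker_eq.symm
  infer_instance

lemma Module.Finite.of_comp_eq_zero {R A B C : Type*} [CommRing R]
    [IsNoetherianRing R] [AddCommGroup A] [AddCommGroup B] [AddCommGroup C] [Module R A]
    [Module R B] [Module R C] {f : A →ₗ[R] B} {g : B →ₗ[R] C} (h : g ∘ₗ f = 0)
    (hf : Module.Finite R (LinearMap.ker f)) (hg : Module.Finite R (LinearMap.ker g)) :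
    Module.Finite R A := by
  refine of_exact_of_isNoetherianRing
    (f := (LinearMap.ker f).subtype) (g := f.codRestrict (LinearMap.ker g) fun z =>
      LinearMap.mem_ker.2 (LinearMap.congr_fun h z)) ?_ hf hg
  rw [LinearMap.exact_iff, LinearMap.ker_codRestrict, Submodule.range_subtype]

lemma Module.Finite.ker_of_exact {R A B C : Type*} [CommRing R]
    [AddCommGroup A] [AddCommGroup B] [AddCommGroup C] [Module R A]
    [Module R B] [Module R C] {f : A →ₗ[R] B} {g : B →ₗ[R] C} (h : Function.Exact f g)
    (hA : Module.Finite R A) : Module.Finite R (LinearMap.ker g) := by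
  rw [h.linearMap_ker_eq]
  infer_instance

namespace ModuleCat

variable {R : Type u} [CommRing R] (X : ModuleCat.{u} R) {A B C : ModuleCat.{u} R}

/-- The map induced on `Ext^j(X, -)` by a linear map. -/
noncomputable def extMap (f : A →ₗ[R] B) (j : ℕ) : Abelian.Ext X A j →ₗ[R] Abelian.Ext X B j :=
  (Abelian.Ext.mk₀ (ModuleCat.ofHom f)).postcompOfLinear R X (add_zero j)

lemma extMap_apply (f : A →ₗ[R] B) (j : ℕ) (z : Abelian.Ext X A j) :
    extMap X f j z = z.comp (Abelian.Ext.mk₀ (ModuleCat.ofHom f)) (add_zero j) := rfl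

lemma extMap_comp (g : B →ₗ[R] C) (f : A →ₗ[R] B) (j : ℕ) :
    extMap X (g ∘ₗ f) j = extMap X g j ∘ₗ extMap X f j := by
  ext z
  rw [LinearMap.comp_apply, extMap_apply, extMap_apply, extMap_apply,
    Abelian.Ext.comp_assoc_of_third_deg_zero, Abelian.Ext.mk₀_comp_mk₀]
  rfl

lemma extMap_add (f g : A →ₗ[R] B) (j : ℕ) :
    extMap X (f + g) j = extMap X f j + extMap X g j := by
  ext z
  rw [LinearMap.add_apply, extMap_apply, extMap_apply, extMap_apply, ← Abelian.Ext.comp_add,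
    ← Abelian.Ext.mk₀_add]
  rfl

lemma extMap_smul (r : R) (f : A →ₗ[R] B) (j : ℕ) :
    extMap X (r • f) j = r • extMap X f j := by
  ext z
  rw [LinearMap.smul_apply, extMap_apply, extMap_apply, ← Abelian.Ext.comp_smul,
    ← Abelian.Ext.mk₀_smul]
  rfl

lemma ext_smul_eq_zero {r : R} (hr : ∀ z : X, r • z = 0) (j : ℕ) (z : Abelian.Ext X A j) :
    r • z = 0 := by
  have h : r • 𝟙 X = 0 := by
    ext z
    exact hr z
  rw [← Abelian.Ext.mk₀_id_comp z, ← Abelian.Ext.smul_comp, ← Abelian.Ext.mk₀_smul, h,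
    Abelian.Ext.mk₀_zero, Abelian.Ext.zero_comp]

lemma extMap_eq_zero {a : Ideal R} (ha : ∀ r ∈ a, ∀ z : X, r • z = 0) {f : A →ₗ[R] B}
    (hf : f ∈ a • (⊤ : Submodule R (A →ₗ[R] B))) (j : ℕ) : extMap X f j = 0 := by
  induction hf using Submodule.smul_induction_on' with
  | smul r hr f _ =>
    ext z
    rw [extMap_smul, LinearMap.smul_apply, ext_smul_eq_zero X (ha r hr), LinearMap.zero_apply]
  | add f _ g _ h1 h2 => rw [extMap_add, h1, h2, add_zero]

lemma extMap_injective_zero {f : A →ₗ[R] B} (hf : Function.Injective f) :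
    Function.Injective (extMap X f 0) :=
  have := (ModuleCat.mono_iff_injective (ModuleCat.ofHom f)).2 hf
  Abelian.Ext.postcomp_mk₀_injective_of_mono X (ModuleCat.ofHom f)

variable {f : A →ₗ[R] B} {g : B →ₗ[R] C}

lemma shortExact_ofHom (hf : Function.Injective f) (hfg : Function.Exact f g)
  (hg : Function.Surjective g) :
    (ShortComplex.mk (ModuleCat.ofHom f) (ModuleCat.ofHom g)
    (by rw [← ModuleCat.ofHom_comp, hfg.linearMap_comp_eq_zero]; rfl)).ShortExact :=
  ModuleCat.shortComplex_shortExact _ hfg hf hg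

/-- The connecting map for `Ext^j(X, -)`. -/
noncomputable def extδ (hf : Function.Injective f) (hfg : Function.Exact f g)
  (hg : Function.Surjective g)
    (j : ℕ) : Abelian.Ext X C j →ₗ[R] Abelian.Ext X A (j + 1) :=
  (shortExact_ofHom hf hfg hg).extClass.postcompOfLinear R X rfl

lemma extMap_exact (hf : Function.Injective f) (hfg : Function.Exact f g)
  (hg : Function.Surjective g)
    (j : ℕ) : Function.Exact (extMap X f j) (extMap X g j) := by
  intro z
  constructor
  · exact Abelian.Ext.covariant_sequence_exact₂ X (shortExact_ofHom hf hfg hg) z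
  · rintro ⟨z, rfl⟩
    rw [← LinearMap.comp_apply, ← extMap_comp, hfg.linearMap_comp_eq_zero,
      extMap_eq_zero X (a := ⊥)
        (fun r hr z => by rw [(Submodule.mem_bot R).1 hr, zero_smul]) (zero_mem _),
          LinearMap.zero_apply]

lemma extMap_extδ_exact (hf : Function.Injective f) (hfg : Function.Exact f g)
  (hg : Function.Surjective g)
    (j : ℕ) : Function.Exact (extMap X g j) (extδ X hf hfg hg j) := by
  intro z
  constructor
  · exact Abelian.Ext.covariant_sequence_exact₃ X (shortExact_ofHom hf hfg hg) z rfl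
  · rintro ⟨z, rfl⟩
    refine (Abelian.Ext.comp_assoc_of_second_deg_zero z _ _ rfl).trans ?_
    refine (congrArg (fun t => z.comp t rfl)
      (shortExact_ofHom hf hfg hg).comp_extClass).trans ?_
    exact Abelian.Ext.comp_zero _ _ _ _ _

lemma extδ_extMap_exact (hf : Function.Injective f) (hfg : Function.Exact f g)
  (hg : Function.Surjective g)
    (j : ℕ) :
    Function.Exact (extδ X hf hfg hg j) (extMap X f (j + 1)) := by
  intro z
  constructor
  · exact fun h => Abelian.Ext.covariant_sequence_exact₁ X (shortExact_ofHom hf hfg hg) z h rfl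
  · rintro ⟨z, rfl⟩
    refine (Abelian.Ext.comp_assoc_of_third_deg_zero z _ _ rfl).trans ?_
    refine (congrArg (fun t => z.comp t rfl)
      (shortExact_ofHom hf hfg hg).extClass_comp).trans ?_
    exact Abelian.Ext.comp_zero _ _ _ _ _

end ModuleCat

theorem isExtLike_finite_ext {R : Type u} [CommRing R] [IsNoetherianRing R] (a : Ideal R) :
    IsExtLike a fun j A => Module.Finite R (Abelian.Ext (ModuleCat.of R (R ⧸ a)) A j) where
  of_finite j A hA := ModuleCat.finite_ext R (ModuleCat.of R (R ⧸ a)) A j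
  middle f g h1 h2 h3 j hA hC :=
    .of_exact_of_isNoetherianRing (ModuleCat.extMap_exact _ h1 h2 h3 j) hA hC
  right f g h1 h2 h3 j hB hA :=
    .of_exact_of_isNoetherianRing (ModuleCat.extMap_extδ_exact _ h1 h2 h3 j) hB hA
  left_zero f g h1 h2 h3 hB :=
    Module.Finite.of_injective _ (ModuleCat.extMap_injective_zero _ h1)
  left_succ f g h1 h2 h3 j hC hB :=
    .of_exact_of_isNoetherianRing (ModuleCat.extδ_extMap_exact _ h1 h2 h3 j) hC hB
  finite_of_smul_eq_zero A hA h := by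
    have e : Abelian.Ext (ModuleCat.of R (R ⧸ a)) A 0 ≃ₗ[R] ((R ⧸ a) →ₗ[R] A) :=
      Abelian.Ext.linearEquiv₀ ≪≫ₗ ModuleCat.homLinearEquiv
    have := Module.Finite.equiv e
    refine Module.Finite.of_surjective
      (LinearMap.applyₗ (R := R) (1 : R ⧸ a) : ((R ⧸ a) →ₗ[R] A) →ₗ[R] A) fun z => ?_
    refine ⟨Submodule.liftQ a (LinearMap.toSpanSingleton R A z) fun y hy => hA y hy z, ?_⟩
    exact one_smul R z
  of_mem_smul {A B} f hf j hK hC := by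
    have ha : ∀ r ∈ a, ∀ z : R ⧸ a, r • z = 0 := fun r hr z => by
      obtain ⟨z, rfl⟩ := Ideal.Quotient.mk_surjective z
      exact (Ideal.Quotient.eq_zero_iff_mem).2 (a.mul_mem_right z hr)
    have h0 := ModuleCat.extMap_eq_zero (ModuleCat.of R (R ⧸ a)) ha hf j
    have h1 : f = (LinearMap.range f).subtype ∘ₗ f.rangeRestrict := rfl
    have h2 := ModuleCat.extMap_comp (ModuleCat.of R (R ⧸ a)) (A := A)
      (B := ModuleCat.of R (LinearMap.range f)) (C := B) (LinearMap.range f).subtype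
      f.rangeRestrict j
    refine Module.Finite.of_comp_eq_zero (h2.symm.trans h0) ?_ ?_
    · refine Module.Finite.ker_of_exact (ModuleCat.extMap_exact _
        (A := ModuleCat.of R (LinearMap.ker f)) (LinearMap.ker f).injective_subtype
        ?_ f.surjective_rangeRestrict j) hK
      exact LinearMap.exact_iff.2
        (by rw [LinearMap.ker_rangeRestrict]; exact (Submodule.range_subtype _).symm)
    · cases j with
      | zero =>
        have := LinearMap.ker_eq_bot.2 (ModuleCat.extMap_injective_zero
          (ModuleCat.of R (R ⧸ a)) (A := ModuleCat.of R (LinearMap.range f)) (B := B)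
          (LinearMap.range f).injective_subtype)
        rw [this]
        infer_instance
      | succ j =>
        exact Module.Finite.ker_of_exact (ModuleCat.extδ_extMap_exact _
          (A := ModuleCat.of R (LinearMap.range f)) (LinearMap.range f).injective_subtype
          (C := ModuleCat.of R (B ⧸ LinearMap.range f)) (LinearMap.exact_subtype_mkQ _)
          (Submodule.mkQ_surjective _) j) (hC j rfl)

lemma ModuleCat.finite_congr {R : Type*} [CommRing R] {A B : ModuleCat R} (e : A ≅ B) :
    Module.Finite R A ↔ Module.Finite R B :=
  Module.Finite.equiv_iff e.toLinearEquiv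

namespace CategoryTheory.ShortComplex

variable {R : Type*} [CommRing R] (S : ShortComplex (ModuleCat R)) {E : Type*} [AddCommGroup E]
  [Module R E]

lemma finite_homology_iff_of_ker_eq (φ : LinearMap.ker S.g.hom →ₗ[R] E)
    (hφ : Function.Surjective φ) (h : LinearMap.ker φ = LinearMap.range S.moduleCatToCycles) :
    Module.Finite R S.homology ↔ Module.Finite R E := by
  rw [ModuleCat.finite_congr S.moduleCatHomologyIso]
  exact Module.Finite.equiv_iff ((Submodule.quotEquivOfEq _ _ h.symm).trans
      (LinearMap.quotKerEquivOfSurjective φ hφ))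

end CategoryTheory.ShortComplex

namespace CategoryTheory.ProjectiveResolution

variable {R : Type u} [CommRing R] {X Y : ModuleCat.{u} R} (P : ProjectiveResolution X)

/-- The linear map sending a cocycle to its class in `Ext`. -/
noncomputable def cocycleToExt (n m : ℕ) (hm : n + 1 = m) :
    LinearMap.ker ((P.complex.linearYonedaObj R Y).d n m).hom →ₗ[R] Abelian.Ext X Y n where
  toFun f := P.extMk f.1 m hm f.2
  map_add' f g := (P.add_extMk _ _ m hm f.2 g.2).symm
  map_smul' r f := by
    refine Eq.trans ?_ ((P.extMk_comp_mk₀ f.1 m hm f.2 (r • 𝟙 Y)).symm.trans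
      (Abelian.Ext.smul_eq_comp_mk₀ _ r).symm)
    congr 1

lemma cocycleToExt_surjective (n m : ℕ) (hm : n + 1 = m) :
    Function.Surjective (P.cocycleToExt (Y := Y) n m hm) := fun z => by
  obtain ⟨f, hf, rfl⟩ := P.extMk_surjective z m hm
  exact ⟨⟨f, hf⟩, rfl⟩

lemma ker_cocycleToExt (n p : ℕ) (hp : p + 1 = n) :
    LinearMap.ker (P.cocycleToExt (Y := Y) n ((ComplexShape.up ℕ).next n)
      (CochainComplex.next ℕ n).symm) =
    LinearMap.range ((P.complex.linearYonedaObj R Y).sc n).moduleCatToCycles := by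
  obtain rfl : p = (ComplexShape.up ℕ).prev n := by
    subst hp
    simp
  ext ⟨f, hf⟩
  refine (P.extMk_eq_zero_iff f _ (CochainComplex.next ℕ n).symm hf _ hp).trans ?_
  exact exists_congr fun g => ⟨fun h => Subtype.ext h, fun h => congrArg Subtype.val h⟩

lemma exists_cocycle_equiv_hom : ∃ φ : LinearMap.ker
    ((P.complex.linearYonedaObj R Y).sc 0).g.hom →ₗ[R] (X ⟶ Y), Function.Bijective φ := by
  have hd : P.complex.d ((ComplexShape.up ℕ).next 0) 0 ≫ P.π.f 0 = 0 := by
    rw [CochainComplex.next]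
    exact P.complex_d_comp_π_f_zero
  let ψ : (X ⟶ Y) →ₗ[R] LinearMap.ker ((P.complex.linearYonedaObj R Y).sc 0).g.hom :=
    (Linear.leftComp R Y (P.π.f 0)).codRestrict
      (LinearMap.ker ((P.complex.linearYonedaObj R Y).sc 0).g.hom) fun f =>
        (Category.assoc _ _ _).symm.trans ((congrArg (· ≫ f) hd).trans Limits.zero_comp)
  have hψ : Function.Bijective ψ := by
    constructor
    · intro f g h
      exact (cancel_epi (P.π.f 0)).1 (congrArg Subtype.val h)
    · rintro ⟨f, hf⟩
      have hf' : P.complex.d 1 0 ≫ (show P.complex.X 0 ⟶ Y from f) = 0 := by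
        have : P.complex.d ((ComplexShape.up ℕ).next 0) 0 ≫
          (show P.complex.X 0 ⟶ Y from f) = 0 := hf
        rwa [CochainComplex.next] at this
      exact ⟨P.exact₀.desc f hf', Subtype.ext (P.exact₀.g_desc f hf')⟩
  exact ⟨(LinearEquiv.ofBijective ψ hψ).symm, (LinearEquiv.ofBijective ψ hψ).symm.bijective⟩

theorem finite_ext_iff {R : Type u} [CommRing R] {X Y : ModuleCat.{u} R} (n : ℕ) :
    Module.Finite R (((Ext R (ModuleCat.{u} R) n).obj (Opposite.op X)).obj Y) ↔
      Module.Finite R (Abelian.Ext X Y n) := by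
  let P := projectiveResolution X
  refine (ModuleCat.finite_congr (P.isoExt n Y)).trans ?_
  cases n with
  | succ n =>
    exact ShortComplex.finite_homology_iff_of_ker_eq _ _ (P.cocycleToExt_surjective _ _ _)
      (P.ker_cocycleToExt (n + 1) n rfl)
  | zero =>
    obtain ⟨φ, hφ⟩ := P.exists_cocycle_equiv_hom (Y := Y)
    refine (ShortComplex.finite_homology_iff_of_ker_eq _ φ hφ.2 ?_).trans
      (Module.Finite.equiv_iff (Abelian.Ext.linearEquiv₀ (R := R) (X := X) (Y := Y))).symm
    have h : ((P.complex.linearYonedaObj R Y).sc 0).f = 0 :=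
      (P.complex.linearYonedaObj R Y).shape _ _ (by simp)
    rw [LinearMap.ker_eq_bot.2 hφ.1, eq_comm, LinearMap.range_eq_bot]
    ext z
    exact congrArg (fun t => t.hom z) h

end CategoryTheory.ProjectiveResolution

open MonoidalCategory in
/-- The functor `M ↦ K ⊗ M` for a complex of modules `K`. -/
@[simps]
noncomputable def ChainComplex.tensorFunctor {R : Type u} [CommRing R]
    (K : ChainComplex (ModuleCat.{u} R) ℕ) :
    ModuleCat.{u} R ⥤ ChainComplex (ModuleCat.{u} R) ℕ where
  obj M :=
    { X := fun i => K.X i ⊗ M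
      d := fun i j => K.d i j ▷ M
      shape := fun i j h => by rw [K.shape i j h, MonoidalPreadditive.zero_whiskerRight]
      d_comp_d' := fun i j k _ _ => by
        rw [← comp_whiskerRight, K.d_comp_d, MonoidalPreadditive.zero_whiskerRight] }
  map f :=
    { f := fun i => K.X i ◁ f
      comm' := fun i j _ => whisker_exchange _ _ }
  map_id M := by ext i : 1; exact whiskerLeft_id _ _
  map_comp f g := by ext i : 1; exact whiskerLeft_comp _ _ _

namespace ChainComplex

variable {R : Type u} [CommRing R] (K : ChainComplex (ModuleCat.{u} R) ℕ)

instance : K.tensorFunctor.Additive where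
  map_add {_ _ f g} := by ext i : 1; exact MonoidalPreadditive.whiskerLeft_add _ _

instance : K.tensorFunctor.Linear R where
  map_smul f r := by ext i : 1; exact MonoidalLinear.whiskerLeft_smul _ _ _

lemma shortExact_tensorFunctor [∀ i, Module.Flat R (K.X i)] {S : ShortComplex (ModuleCat.{u} R)}
    (hS : S.ShortExact) : (S.map K.tensorFunctor).ShortExact := by
  refine HomologicalComplex.shortExact_of_degreewise_shortExact _ fun i => ?_
  refine ModuleCat.shortComplex_shortExact _ ?_ ?_ ?_
  · exact lTensor_exact (K.X i) ((ShortComplex.ShortExact.moduleCat_exact_iff_function_exact _).1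
      hS.exact) hS.moduleCat_surjective_g
  · exact Module.Flat.lTensor_preserves_injective_linearMap _ hS.moduleCat_injective_f
  · exact LinearMap.lTensor_surjective _ hS.moduleCat_surjective_g

variable {A B C : ModuleCat.{u} R}

/-- The homology of `K ⊗ A`. -/
noncomputable abbrev torObj (j : ℕ) (A : ModuleCat.{u} R) : ModuleCat.{u} R :=
  (K.tensorFunctor.obj A).homology j

/-- The map induced on the homology of `K ⊗ A` by a linear map. -/
noncomputable def torMap (f : A →ₗ[R] B) (j : ℕ) : K.torObj j A →ₗ[R] K.torObj j B :=
  (HomologicalComplex.homologyMap (K.tensorFunctor.map (ModuleCat.ofHom f)) j).hom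

lemma torMap_comp (g : B →ₗ[R] C) (f : A →ₗ[R] B) (j : ℕ) :
    K.torMap (g ∘ₗ f) j = K.torMap g j ∘ₗ K.torMap f j := by
  rw [torMap, torMap, torMap, ← ModuleCat.hom_comp, ← HomologicalComplex.homologyMap_comp,
    ← K.tensorFunctor.map_comp]
  rfl

lemma torMap_add (f g : A →ₗ[R] B) (j : ℕ) :
    K.torMap (f + g) j = K.torMap f j + K.torMap g j := by
  rw [torMap, torMap, torMap, ← ModuleCat.hom_add, ← HomologicalComplex.homologyMap_add,
    ← K.tensorFunctor.map_add]
  rfl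

lemma torMap_smul (r : R) (f : A →ₗ[R] B) (j : ℕ) :
    K.torMap (r • f) j = r • K.torMap f j := by
  have h1 := Functor.map_smul K.tensorFunctor r (ModuleCat.ofHom f)
  have h2 : HomologicalComplex.homologyMap (r • K.tensorFunctor.map (ModuleCat.ofHom f)) j =
      r • HomologicalComplex.homologyMap (K.tensorFunctor.map (ModuleCat.ofHom f)) j :=
    ShortComplex.homologyMap_smul ((HomologicalComplex.shortComplexFunctor (ModuleCat.{u} R)
      (ComplexShape.down ℕ) j).map (K.tensorFunctor.map (ModuleCat.ofHom f))) r
  have h3 := (congrArg (fun t => HomologicalComplex.homologyMap t j) h1).trans h2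
  exact congrArg ModuleCat.Hom.hom h3

variable [∀ i, Module.Flat R (K.X i)] {f : A →ₗ[R] B} {g : B →ₗ[R] C}

/-- The connecting map for the homology of `K ⊗ A`. -/
noncomputable def torδ (hf : Function.Injective f) (hfg : Function.Exact f g)
    (hg : Function.Surjective g) (j : ℕ) : K.torObj (j + 1) C →ₗ[R] K.torObj j A :=
  ((K.shortExact_tensorFunctor (ModuleCat.shortExact_ofHom hf hfg hg)).δ (j + 1) j rfl).hom

lemma torMap_exact (hf : Function.Injective f) (hfg : Function.Exact f g)
    (hg : Function.Surjective g) (j : ℕ) : Function.Exact (K.torMap f j) (K.torMap g j) :=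
  (ShortComplex.ShortExact.moduleCat_exact_iff_function_exact _).1
    ((K.shortExact_tensorFunctor (ModuleCat.shortExact_ofHom hf hfg hg)).homology_exact₂ j)

lemma torMap_torδ_exact (hf : Function.Injective f) (hfg : Function.Exact f g)
    (hg : Function.Surjective g) (j : ℕ) :
    Function.Exact (K.torMap g (j + 1)) (K.torδ hf hfg hg j) :=
  (ShortComplex.ShortExact.moduleCat_exact_iff_function_exact _).1
    ((K.shortExact_tensorFunctor (ModuleCat.shortExact_ofHom hf hfg hg)).homology_exact₃
      (j + 1) j rfl)

lemma torδ_torMap_exact (hf : Function.Injective f) (hfg : Function.Exact f g)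
    (hg : Function.Surjective g) (j : ℕ) :
    Function.Exact (K.torδ hf hfg hg j) (K.torMap f j) :=
  (ShortComplex.ShortExact.moduleCat_exact_iff_function_exact _).1
    ((K.shortExact_tensorFunctor (ModuleCat.shortExact_ofHom hf hfg hg)).homology_exact₁
      (j + 1) j rfl)

end ChainComplex

namespace CategoryTheory.ProjectiveResolution

variable {R : Type u} [CommRing R] {X : ModuleCat.{u} R} (P : ProjectiveResolution X)
  {A B C : ModuleCat.{u} R}

instance flat_complex_X (i : ℕ) : Module.Flat R (P.complex.X i) :=
  have : Projective (ModuleCat.of R (P.complex.X i)) := P.projective i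
  have := (IsProjective.iff_projective (P.complex.X i)).2 this
  inferInstance

/-- The augmentation of a projective resolution of `X`. -/
noncomputable def aug : P.complex.X 0 →ₗ[R] X := (P.π.f 0).hom

lemma aug_surjective : Function.Surjective P.aug :=
  (ModuleCat.epi_iff_surjective (P.π.f 0)).1 inferInstance

lemma exact_d_aug : Function.Exact (P.complex.d 1 0).hom P.aug :=
  (ShortComplex.ShortExact.moduleCat_exact_iff_function_exact _).1 P.exact₀

lemma exact_d_d (n : ℕ) :
    Function.Exact (P.complex.d (n + 2) (n + 1)).hom (P.complex.d (n + 1) n).hom :=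
  (ShortComplex.ShortExact.moduleCat_exact_iff_function_exact _).1 (P.exact_succ n)

/-- The augmentation `P₀ ⊗ A → X ⊗ A`. -/
noncomputable def tensorAug (A : ModuleCat.{u} R) :
    (P.complex.tensorFunctor.obj A).X 0 ⟶ ModuleCat.of R (TensorProduct R X A) :=
  ModuleCat.ofHom (LinearMap.rTensor A P.aug)

lemma tensorAug_naturality (f : A ⟶ B) :
    (P.complex.tensorFunctor.map f).f 0 ≫ P.tensorAug B =
      P.tensorAug A ≫ ModuleCat.ofHom (LinearMap.lTensor X f.hom) := by
  have h : LinearMap.rTensor B P.aug ∘ₗ LinearMap.lTensor (P.complex.X 0) f.hom =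
      LinearMap.lTensor X f.hom ∘ₗ LinearMap.rTensor A P.aug := by
    rw [LinearMap.rTensor_comp_lTensor, LinearMap.lTensor_comp_rTensor]
  exact ModuleCat.hom_ext h

lemma d_tensorAug (A : ModuleCat.{u} R) :
    (P.complex.tensorFunctor.obj A).d 1 0 ≫ P.tensorAug A = 0 := by
  refine ModuleCat.hom_ext ?_
  have h := (rTensor_exact A P.exact_d_aug P.aug_surjective).linearMap_comp_eq_zero
  exact h

/-- The augmentation `P ⊗ A → X ⊗ A` on the cokernel of the last differential. -/
noncomputable def opcyclesAug (A : ModuleCat.{u} R) :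
    (P.complex.tensorFunctor.obj A).opcycles 0 ⟶ ModuleCat.of R (TensorProduct R X A) :=
  (P.complex.tensorFunctor.obj A).descOpcycles (P.tensorAug A) 1 (by simp) (P.d_tensorAug A)

lemma pOpcycles_opcyclesAug (A : ModuleCat.{u} R) :
    (P.complex.tensorFunctor.obj A).pOpcycles 0 ≫ P.opcyclesAug A = P.tensorAug A :=
  HomologicalComplex.p_descOpcycles ..

/-- The augmentation `P ⊗ A → X ⊗ A` on degree zero homology. -/
noncomputable def torAug (A : ModuleCat.{u} R) :
    P.complex.torObj 0 A ⟶ ModuleCat.of R (TensorProduct R X A) :=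
  (P.complex.tensorFunctor.obj A).homologyι 0 ≫ P.opcyclesAug A

lemma homologyMap_torAug (f : A ⟶ B) :
    HomologicalComplex.homologyMap (P.complex.tensorFunctor.map f) 0 ≫ P.torAug B =
      P.torAug A ≫ ModuleCat.ofHom (LinearMap.lTensor X f.hom) := by
  rw [torAug, torAug, HomologicalComplex.homologyι_naturality_assoc, Category.assoc]
  congr 1
  rw [← cancel_epi (HomologicalComplex.pOpcycles _ _), HomologicalComplex.p_opcyclesMap_assoc,
    pOpcycles_opcyclesAug, ← Category.assoc, pOpcycles_opcyclesAug, tensorAug_naturality]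

lemma torAug_torMap (f : A →ₗ[R] B) (z : P.complex.torObj 0 A) :
    (P.torAug B).hom (P.complex.torMap f 0 z) =
      LinearMap.lTensor X f ((P.torAug A).hom z) :=
  congrArg (fun t => t.hom z) (P.homologyMap_torAug (ModuleCat.ofHom f))

lemma torAug_bijective (A : ModuleCat.{u} R) : Function.Bijective (P.torAug A).hom := by
  have hι : Function.Bijective ((P.complex.tensorFunctor.obj A).homologyι 0).hom :=
    ConcreteCategory.bijective_of_isIso (P.complex.tensorFunctor.obj A).isoHomologyι₀.hom
  refine Function.Bijective.comp (g := (P.opcyclesAug A).hom) ?_ hι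
  have hp : ∀ z, (P.opcyclesAug A).hom (((P.complex.tensorFunctor.obj A).pOpcycles 0).hom z) =
      LinearMap.rTensor A P.aug z :=
    fun z => congrArg (fun t => t.hom z) (P.pOpcycles_opcyclesAug A)
  constructor
  · rw [injective_iff_map_eq_zero]
    intro z hz
    obtain ⟨z, rfl⟩ := (ModuleCat.epi_iff_surjective
      ((P.complex.tensorFunctor.obj A).pOpcycles 0)).1 inferInstance z
    obtain ⟨w, rfl⟩ := (rTensor_exact A P.exact_d_aug P.aug_surjective z).1
      ((hp z).symm.trans hz)
    exact congrArg (fun t => t.hom w) ((P.complex.tensorFunctor.obj A).d_pOpcycles 1 0)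
  · intro z
    obtain ⟨z, rfl⟩ := LinearMap.rTensor_surjective A P.aug_surjective z
    exact ⟨_, hp z⟩

lemma torMap_zero_surjective {g : B →ₗ[R] C} (hg : Function.Surjective g) :
    Function.Surjective (P.complex.torMap g 0) := by
  intro z
  obtain ⟨w, hw⟩ := LinearMap.lTensor_surjective X hg ((P.torAug C).hom z)
  obtain ⟨w, rfl⟩ := (P.torAug_bijective B).2 w
  exact ⟨w, (P.torAug_bijective C).1 ((P.torAug_torMap g w).trans hw)⟩

lemma subsingleton_torObj_succ [Module.Flat R A] (j : ℕ) :
    Subsingleton (P.complex.torObj (j + 1) A) := by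
  refine ModuleCat.subsingleton_of_isZero (HomologicalComplex.ExactAt.isZero_homology ?_)
  rw [HomologicalComplex.exactAt_iff' _ (j + 2) (j + 1) j (by simp) (by simp)]
  exact (ShortComplex.ShortExact.moduleCat_exact_iff_function_exact _).2
    (Module.Flat.rTensor_exact A (P.exact_d_d j))

lemma torδ_injective [Module.Flat R B] {f : A →ₗ[R] B} {g : B →ₗ[R] C}
    (hf : Function.Injective f) (hfg : Function.Exact f g) (hg : Function.Surjective g) (j : ℕ) :
    Function.Injective (P.complex.torδ hf hfg hg j) := by
  have := P.subsingleton_torObj_succ (A := B) j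
  rw [injective_iff_map_eq_zero]
  intro z hz
  obtain ⟨w, rfl⟩ := (P.complex.torMap_torδ_exact hf hfg hg j z).1 hz
  rw [Subsingleton.elim w 0, map_zero]

lemma torδ_surjective [Module.Flat R B] {f : A →ₗ[R] B} {g : B →ₗ[R] C}
    (hf : Function.Injective f) (hfg : Function.Exact f g) (hg : Function.Surjective g) (j : ℕ) :
    Function.Surjective (P.complex.torδ hf hfg hg (j + 1)) := by
  have := P.subsingleton_torObj_succ (A := B) j
  exact fun z => (P.complex.torδ_torMap_exact hf hfg hg (j + 1) z).1 (Subsingleton.elim _ _)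

lemma smul_torObj_eq_zero {r : R} (hr : ∀ z : X, r • z = 0) (j : ℕ) (A : ModuleCat.{u} R)
    (z : P.complex.torObj j A) : r • z = 0 := by
  induction j generalizing A with
  | zero =>
    refine (P.torAug_bijective A).1 ?_
    rw [map_smul, map_zero]
    generalize (P.torAug A).hom z = w
    change r • (show TensorProduct R X A from w) = 0
    induction (show TensorProduct R X A from w) with
    | zero => exact smul_zero r
    | tmul y z => rw [TensorProduct.smul_tmul', hr, TensorProduct.zero_tmul]
    | add y z hy hz => rw [smul_add, hy, hz, add_zero]
  | succ j ih =>
    let g : (A →₀ R) →ₗ[R] A := Finsupp.linearCombination R id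
    refine P.torδ_injective (A := ModuleCat.of R (LinearMap.ker g)) (B := ModuleCat.of R (A →₀ R))
      (g := g) (LinearMap.ker g).injective_subtype (LinearMap.exact_subtype_ker_map g)
      (Finsupp.linearCombination_id_surjective R A) j ?_
    rw [map_smul, map_zero]
    exact ih _ _

lemma finite_torObj [IsNoetherianRing R] [Module.Finite R X] (j : ℕ) (A : ModuleCat.{u} R)
    [Module.Finite R A] : Module.Finite R (P.complex.torObj j A) := by
  induction j generalizing A with
  | zero =>
    refine Module.Finite.of_injective (M := P.complex.torObj 0 A) (N := TensorProduct R X A)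
      (P.torAug A).hom (P.torAug_bijective A).1
  | succ j ih =>
    obtain ⟨n, g, hg⟩ := Module.Finite.exists_fin' R A
    have := ih (ModuleCat.of R (LinearMap.ker g))
    exact Module.Finite.of_injective _ (P.torδ_injective (A := ModuleCat.of R (LinearMap.ker g))
      (B := ModuleCat.of R (Fin n → R)) (g := g) (LinearMap.ker g).injective_subtype
      (LinearMap.exact_subtype_ker_map g) hg j)

lemma torMap_eq_zero {a : Ideal R} (ha : ∀ r ∈ a, ∀ z : X, r • z = 0) {f : A →ₗ[R] B}
    (hf : f ∈ a • (⊤ : Submodule R (A →ₗ[R] B))) (j : ℕ) : P.complex.torMap f j = 0 := by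
  induction hf using Submodule.smul_induction_on' with
  | smul r hr f _ =>
    ext z
    rw [ChainComplex.torMap_smul, LinearMap.smul_apply, P.smul_torObj_eq_zero (ha r hr),
      LinearMap.zero_apply]
  | add f _ g _ h1 h2 => rw [ChainComplex.torMap_add, h1, h2, add_zero]

end CategoryTheory.ProjectiveResolution

lemma Module.Finite.of_exact_of_exact_of_comp_eq_zero {R A B C D E : Type*} [CommRing R]
    [IsNoetherianRing R] [AddCommGroup A] [AddCommGroup B] [AddCommGroup C] [AddCommGroup D]
    [AddCommGroup E] [Module R A] [Module R B] [Module R C] [Module R D] [Module R E]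
    {s : A →ₗ[R] B} {δ : B →ₗ[R] C} {t : B →ₗ[R] D} {q : D →ₗ[R] E} (hs : Function.Exact s δ)
    (ht : Function.Exact t q) (h : t ∘ₗ s = 0) (hC : Module.Finite R C) (hE : Module.Finite R E) :
    Module.Finite R D := by
  have hle : LinearMap.ker δ ≤ LinearMap.ker t := by
    rw [hs.linearMap_ker_eq]
    exact LinearMap.range_le_ker_iff.2 h
  have hB : Module.Finite R (B ⧸ LinearMap.ker δ) :=
    .of_injective _ (LinearMap.ker_eq_bot.1 (Submodule.ker_liftQ_eq_bot _ δ le_rfl le_rfl))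
  refine .of_exact_of_isNoetherianRing (f := (LinearMap.ker δ).liftQ t hle) (g := q) ?_ hB hE
  rw [LinearMap.exact_iff, Submodule.range_liftQ, ht.linearMap_ker_eq]

theorem CategoryTheory.ProjectiveResolution.isTorLike_finite_torObj {R : Type u} [CommRing R]
    [IsNoetherianRing R] (a : Ideal R) (P : ProjectiveResolution (ModuleCat.of R (R ⧸ a))) :
    IsTorLike a fun j A => Module.Finite R (P.complex.torObj j A) where
  of_finite j A hA :=
    have : Module.Finite R (ModuleCat.of R (R ⧸ a)) := inferInstanceAs (Module.Finite R (R ⧸ a))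
    P.finite_torObj j A
  middle f g h1 h2 h3 j hA hC :=
    .of_exact_of_isNoetherianRing (P.complex.torMap_exact h1 h2 h3 j) hA hC
  left f g h1 h2 h3 j hB hC :=
    .of_exact_of_isNoetherianRing (P.complex.torδ_torMap_exact h1 h2 h3 j) hC hB
  right_zero f g h1 h2 h3 hB := .of_surjective _ (P.torMap_zero_surjective h3)
  right_succ f g h1 h2 h3 j hA hB :=
    .of_exact_of_isNoetherianRing (P.complex.torMap_torδ_exact h1 h2 h3 j) hB hA
  finite_of_smul_eq_zero A hA h := by
    have h1 : Module.Finite R (TensorProduct R (R ⧸ a) A) :=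
      .of_surjective (P.torAug A).hom (P.torAug_bijective A).2
    refine .of_surjective (M := TensorProduct R (R ⧸ a) A) (TensorProduct.lift
      (a.liftQ (LinearMap.lsmul R A) fun y hy => LinearMap.ext fun z => hA y hy z)) fun z =>
        ⟨TensorProduct.tmul R 1 z, ?_⟩
    exact (TensorProduct.lift.tmul _ _).trans (one_smul R z)
  of_mem_smul {A B} f hf j hC hK := by
    have ha : ∀ r ∈ a, ∀ z : R ⧸ a, r • z = 0 := fun r hr z => by
      obtain ⟨z, rfl⟩ := Ideal.Quotient.mk_surjective z
      exact (Ideal.Quotient.eq_zero_iff_mem).2 (a.mul_mem_right z hr)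
    have h0 := P.torMap_eq_zero ha hf j
    have h2 := P.complex.torMap_comp (A := A)
      (B := ModuleCat.of R (LinearMap.range f)) (C := B) (LinearMap.range f).subtype
      f.rangeRestrict j
    have h3 := P.complex.torMap_exact
      (A := ModuleCat.of R (LinearMap.range f)) (B := B) (LinearMap.range f).injective_subtype
      (C := ModuleCat.of R (B ⧸ LinearMap.range f)) (LinearMap.exact_subtype_mkQ _)
      (Submodule.mkQ_surjective _) j
    have h4 : P.complex.torMap (A := ModuleCat.of R (LinearMap.range f)) (B := B)
        (LinearMap.range f).subtype j ∘ₗ P.complex.torMap (A := A)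
          (B := ModuleCat.of R (LinearMap.range f)) f.rangeRestrict j = 0 := h2.symm.trans h0
    cases j with
    | zero =>
      refine .of_exact_of_exact_of_comp_eq_zero (C := PUnit.{u + 1}) (δ := 0)
        (fun z => ⟨fun _ => P.torMap_zero_surjective (B := A)
          (C := ModuleCat.of R (LinearMap.range f)) f.surjective_rangeRestrict z,
            fun _ => rfl⟩) h3 h4 inferInstance hC
    | succ l =>
      exact .of_exact_of_exact_of_comp_eq_zero (P.complex.torMap_torδ_exact
        (A := ModuleCat.of R (LinearMap.ker f)) (B := A)
        (C := ModuleCat.of R (LinearMap.range f)) (f := (LinearMap.ker f).subtype)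
        (g := f.rangeRestrict) (LinearMap.ker f).injective_subtype (LinearMap.exact_iff.2 (by
          rw [LinearMap.ker_rangeRestrict]; exact (Submodule.range_subtype _).symm))
        f.surjective_rangeRestrict l) h3 h4 (hK l rfl) hC

lemma CategoryTheory.ShortComplex.finite_homology_iff_of_exact {R : Type*} [CommRing R]
    (S : ShortComplex (ModuleCat R)) {E : Type*} [AddCommGroup E] [Module R E]
    {q : S.X₂ →ₗ[R] E} (h : Function.Exact S.f.hom q) :
    Module.Finite R S.homology ↔ Module.Finite R ((LinearMap.ker S.g.hom).map q) := by
  refine S.finite_homology_iff_of_ker_eq (q.submoduleMap _) (q.submoduleMap_surjective _) ?_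
  ext ⟨z, hz⟩
  rw [LinearMap.mem_ker, ← Submodule.coe_eq_zero, LinearMap.submoduleMap_coe_apply]
  exact (h z).trans (exists_congr fun y => ⟨fun h => Subtype.ext h, congrArg Subtype.val⟩)

namespace CategoryTheory.ProjectiveResolution

variable {R : Type u} [CommRing R] {X M : ModuleCat.{u} R} (P : ProjectiveResolution X)
  (Q : ProjectiveResolution M)

/-- The cokernels of the differentials of a projective resolution. -/
noncomputable abbrev syzygy (n : ℕ) : ModuleCat.{u} R :=
  ModuleCat.of R (Q.complex.X n ⧸ LinearMap.range (Q.complex.d (n + 1) n).hom)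

/-- The inclusion of a syzygy into the next term of a projective resolution. -/
noncomputable def syzygyι (n : ℕ) : Q.syzygy (n + 1) →ₗ[R] Q.complex.X n :=
  Submodule.liftQ _ (Q.complex.d (n + 1) n).hom (Q.exact_d_d n).linearMap_ker_eq.ge

lemma syzygyι_injective (n : ℕ) : Function.Injective (Q.syzygyι n) :=
  LinearMap.ker_eq_bot.1 (Submodule.ker_liftQ_eq_bot _ _ _ (Q.exact_d_d n).linearMap_ker_eq.le)

lemma syzygyι_exact (n : ℕ) : Function.Exact (Q.syzygyι n)
    (LinearMap.range (Q.complex.d (n + 1) n).hom).mkQ := by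
  rw [LinearMap.exact_iff, Submodule.ker_mkQ]
  exact (Submodule.range_liftQ _ _ _).symm

/-- The zeroth syzygy is the resolved module. -/
noncomputable def syzygyZeroEquiv : Q.syzygy 0 ≃ₗ[R] M :=
  (Submodule.quotEquivOfEq _ _ Q.exact_d_aug.linearMap_ker_eq.symm).trans
    (LinearMap.quotKerEquivOfSurjective Q.aug Q.aug_surjective)

lemma finite_torObj_congr {A B : ModuleCat.{u} R} (e : A ≃ₗ[R] B) (j : ℕ) :
    Module.Finite R (P.complex.torObj j A) ↔ Module.Finite R (P.complex.torObj j B) :=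
  ModuleCat.finite_congr ((HomologicalComplex.homologyFunctor _ _ j).mapIso
    (P.complex.tensorFunctor.mapIso e.toModuleIso))

lemma finite_torObj_syzygy (i n : ℕ) : Module.Finite R (P.complex.torObj (i + 1) (Q.syzygy n)) ↔
    Module.Finite R (P.complex.torObj 1 (Q.syzygy (n + i))) := by
  induction i generalizing n with
  | zero => rfl
  | succ i ih =>
    have h1 := P.torδ_injective (A := Q.syzygy (n + 1)) (C := Q.syzygy n)
      (Q.syzygyι_injective n) (Q.syzygyι_exact n) (Submodule.mkQ_surjective _) (i + 1)
    have h2 := P.torδ_surjective (A := Q.syzygy (n + 1)) (C := Q.syzygy n)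
      (Q.syzygyι_injective n) (Q.syzygyι_exact n) (Submodule.mkQ_surjective _) i
    refine (Module.Finite.equiv_iff (LinearEquiv.ofBijective _ ⟨h1, h2⟩)).trans ?_
    rw [ih (n + 1), Nat.add_right_comm n 1 i, Nat.add_assoc n i 1]

lemma finite_torObj_one_syzygy (n : ℕ) : Module.Finite R (P.complex.torObj 1 (Q.syzygy n)) ↔
    Module.Finite R (LinearMap.ker (LinearMap.lTensor X (Q.syzygyι n))) := by
  have h1 := P.torδ_injective (A := Q.syzygy (n + 1)) (C := Q.syzygy n)
    (Q.syzygyι_injective n) (Q.syzygyι_exact n) (Submodule.mkQ_surjective _) 0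
  have h2 := P.complex.torδ_torMap_exact (A := Q.syzygy (n + 1)) (C := Q.syzygy n)
    (Q.syzygyι_injective n) (Q.syzygyι_exact n) (Submodule.mkQ_surjective _) 0
  let e := LinearEquiv.ofBijective (P.torAug (Q.syzygy (n + 1))).hom (P.torAug_bijective _)
  have h3 : Submodule.map (e : _ →ₗ[R] _) (LinearMap.ker (P.complex.torMap (Q.syzygyι n) 0)) =
      LinearMap.ker (LinearMap.lTensor X (Q.syzygyι n)) := by
    ext z
    constructor
    · rintro ⟨w, hw, rfl⟩
      refine (P.torAug_torMap _ w).symm.trans ?_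
      rw [LinearMap.mem_ker.1 hw, map_zero]
    · intro hz
      obtain ⟨w, rfl⟩ := (P.torAug_bijective (Q.syzygy (n + 1))).2 z
      refine ⟨w, (P.torAug_bijective (Q.complex.X n)).1 ?_, rfl⟩
      rw [map_zero]
      exact (P.torAug_torMap _ w).trans hz
  refine (Module.Finite.equiv_iff (LinearEquiv.ofInjective _ h1)).trans ?_
  rw [← h2.linearMap_ker_eq]
  refine (Module.Finite.equiv_iff (e.submoduleMap _)).trans ?_
  rw [h3]

open MonoidalCategory in
theorem finite_tor_iff (n : ℕ) :
    Module.Finite R (((Tor (ModuleCat.{u} R) n).obj X).obj M) ↔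
      Module.Finite R (P.complex.torObj n M) := by
  let Q := projectiveResolution M
  refine (ModuleCat.finite_congr (Q.isoLeftDerivedObj
    ((tensoringLeft (ModuleCat.{u} R)).obj X) n)).trans ?_
  let K := (((tensoringLeft (ModuleCat.{u} R)).obj X).mapHomologicalComplex
    (ComplexShape.down ℕ)).obj Q.complex
  have hex : Function.Exact (K.d (n + 1) n).hom
      (LinearMap.lTensor X (LinearMap.range (Q.complex.d (n + 1) n).hom).mkQ) :=
    lTensor_exact X (LinearMap.exact_map_mkQ_range _) (Submodule.mkQ_surjective _)
  have hex' : Function.Exact (K.sc n).f.hom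
      (LinearMap.lTensor X (LinearMap.range (Q.complex.d (n + 1) n).hom).mkQ) := by
    obtain h : n + 1 = (ComplexShape.down ℕ).prev n := by simp
    have : ∀ m, n + 1 = m → Function.Exact (K.d m n).hom
      (LinearMap.lTensor X (LinearMap.range (Q.complex.d (n + 1) n).hom).mkQ) := by
      rintro _ rfl; exact hex
    exact this _ h
  refine ((K.sc n).finite_homology_iff_of_exact hex').trans ?_
  cases n with
  | zero =>
    have h : LinearMap.ker (K.sc 0).g.hom = ⊤ := by
      rw [show (K.sc 0).g = 0 from K.shape _ _ (by simp)]
      exact LinearMap.ker_zero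
    have hker := (congrArg (Submodule.map (LinearMap.lTensor X
      (LinearMap.range (Q.complex.d 1 0).hom).mkQ)) h).trans ((Submodule.map_top _).trans
        (LinearMap.range_eq_top.2 (LinearMap.lTensor_surjective X (Submodule.mkQ_surjective _))))
    rw [← P.finite_torObj_congr Q.syzygyZeroEquiv]
    exact (Module.Finite.equiv_iff ((LinearEquiv.ofEq _ _ hker).trans Submodule.topEquiv)).trans
      (Module.Finite.equiv_iff
        (LinearEquiv.ofBijective (P.torAug (Q.syzygy 0)).hom (P.torAug_bijective _))).symm
  | succ n =>
    rw [← P.finite_torObj_congr Q.syzygyZeroEquiv, finite_torObj_syzygy, Nat.zero_add,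
      finite_torObj_one_syzygy]
    have hd : LinearMap.ker (K.d (n + 1) n).hom =
        (LinearMap.ker (LinearMap.lTensor X (Q.syzygyι n))).comap
          (LinearMap.lTensor X (LinearMap.range (Q.complex.d (n + 2) (n + 1)).hom).mkQ) := by
      have h : Q.syzygyι n ∘ₗ (LinearMap.range (Q.complex.d (n + 2) (n + 1)).hom).mkQ =
        (Q.complex.d (n + 1) n).hom := Submodule.liftQ_mkQ _ _ _
      have h' : (K.d (n + 1) n).hom = LinearMap.lTensor X (Q.syzygyι n) ∘ₗ
          LinearMap.lTensor X (LinearMap.range (Q.complex.d (n + 2) (n + 1)).hom).mkQ :=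
        (congrArg (LinearMap.lTensor X) h.symm).trans (LinearMap.lTensor_comp _ _ _)
      rw [h']
      exact LinearMap.ker_comp _ _
    have hg : ∀ m, n = m → LinearMap.ker (K.d (n + 1) m).hom =
        (LinearMap.ker (LinearMap.lTensor X (Q.syzygyι n))).comap
          (LinearMap.lTensor X (LinearMap.range (Q.complex.d (n + 2) (n + 1)).hom).mkQ) := by
      rintro _ rfl; exact hd
    have hker := (congrArg (Submodule.map (LinearMap.lTensor X
      (LinearMap.range (Q.complex.d (n + 2) (n + 1)).hom).mkQ))
        (hg _ (ChainComplex.next_nat_succ n).symm)).trans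
      (Submodule.map_comap_eq_of_surjective
        (LinearMap.lTensor_surjective X (Submodule.mkQ_surjective _)) _)
    exact Module.Finite.equiv_iff (LinearEquiv.ofEq _ _ hker)

end CategoryTheory.ProjectiveResolution

/-- For an `R`-module `M` with `Supp M ⊆ V(a)`, `M` is `a`-cofinite (i.e. `Supp M ⊆ V(a)` and
`Ext^i(R/a, M)` is finitely generated for every `i ≥ 0`) if and only if `Tor_i(R/a, M)` is a
finitely generated `R`-module for every `i ≥ 0`. -/
theorem cofinite_iff_tor_finite
    {R : Type u} [CommRing R] [IsNoetherianRing R] (a : Ideal R)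
    (M : Type u) [AddCommGroup M] [Module R M]
    (hsupp : Module.support R M ⊆ PrimeSpectrum.zeroLocus (a : Set R)) :
    (Module.support R M ⊆ PrimeSpectrum.zeroLocus (a : Set R) ∧
      ∀ i : ℕ, Module.Finite R
        (((Ext R (ModuleCat.{u} R) i).obj
          (Opposite.op (ModuleCat.of R (R ⧸ a)))).obj (ModuleCat.of R M))) ↔
      (∀ i : ℕ, Module.Finite R
        (((Tor (ModuleCat.{u} R) i).obj (ModuleCat.of R (R ⧸ a))).obj (ModuleCat.of R M))) := by
  let P := projectiveResolution (ModuleCat.of R (R ⧸ a))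
  refine (and_iff_right hsupp).trans ((forall_congr' fun i =>
    ProjectiveResolution.finite_ext_iff i).trans ?_)
  refine (forall_iff_of_isExtLike_of_isTorLike (isExtLike_finite_ext a)
    (P.isTorLike_finite_torObj a) M).trans ?_
  exact forall_congr' fun i => (P.finite_tor_iff i).symm
end

section
/- Let R be a commutative noetherian ring with unity, let a be an ideal of R, let M be an R-module with Supp_R(M) ⊆ V(a), and let c = cd(a,R) = sup{ i ≥ 0 : H^i_a(R) ≠ 0 } be the cohomological dimension of R with respect to a. Then M is a-cofinite if and only if Tor^R_i(R/a, M) is a finitely generated R-module for every 0 ≤ i ≤ c. -/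
open CategoryTheory

/-- The submodule of families `I → M` whose members lie in a common finitely generated submodule. -/
def Submodule.fgFamilies (R : Type u) [CommRing R] [IsNoetherianRing R] (I : Type u)
    (M : Type u) [AddCommGroup M] [Module R M] : Submodule R (I → M) where
  carrier := {f | ∃ L : Submodule R M, L.FG ∧ ∀ i, f i ∈ L}
  zero_mem' := ⟨⊥, Submodule.fg_bot, fun i => by simp⟩
  add_mem' := by
    rintro f g ⟨L, hL, hf⟩ ⟨L', hL', hg⟩
    exact ⟨L ⊔ L', hL.sup hL', fun i => add_mem (Submodule.mem_sup_left (hf i))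
        (Submodule.mem_sup_right (hg i))⟩
  smul_mem' := by
    rintro r f ⟨L, hL, hf⟩
    exact ⟨L, hL, fun i => L.smul_mem r (hf i)⟩

section
variable (R : Type u) [CommRing R] [IsNoetherianRing R] (I : Type u)
variable {M N P : Type u} [AddCommGroup M] [Module R M] [AddCommGroup N] [Module R N]
    [AddCommGroup P] [Module R P]

variable (M) in
/-- The module of families `I → M` modulo those spanning a finitely generated submodule. -/
abbrev FamilyQuotient : Type u := (I → M) ⧸ Submodule.fgFamilies R I M

namespace FamilyQuotient
variable {R}

lemma comp_mem (f : M →ₗ[R] N) {x : I → M} (hx : x ∈ Submodule.fgFamilies R I M) :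
    (fun i => f (x i)) ∈ Submodule.fgFamilies R I N := by
  obtain ⟨L, hL, h⟩ := hx
  exact ⟨L.map f, hL.map f, fun i => Submodule.mem_map_of_mem (h i)⟩

def map (f : M →ₗ[R] N) : FamilyQuotient R I M →ₗ[R] FamilyQuotient R I N :=
  Submodule.mapQ _ _ (f.compLeft I) (fun _ hx => comp_mem I f hx)

variable {I}

lemma map_mk (f : M →ₗ[R] N) (x : I → M) :
    map I f ((Submodule.fgFamilies R I M).mkQ x) = (Submodule.fgFamilies R I N).mkQ
        (fun i => f (x i)) := rfl

lemma mkQ_eq_zero {x : I → M} :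
    (Submodule.fgFamilies R I M).mkQ x = 0 ↔ ∃ L : Submodule R M, L.FG ∧ ∀ i, x i ∈ L := by
  rw [Submodule.mkQ_apply, Submodule.Quotient.mk_eq_zero]; rfl

lemma map_comp (g : N →ₗ[R] P) (f : M →ₗ[R] N) : map I (g ∘ₗ f) = map I g ∘ₗ map I f := by
  ext x : 2
  rfl
lemma map_add (g f : M →ₗ[R] N) : map I (g + f) = map I g + map I f := by
  ext x : 2
  rfl
lemma map_id : map I (LinearMap.id : M →ₗ[R] M) = LinearMap.id := by
  ext x : 2
  rfl


lemma exists_fg_lift (g : N →ₗ[R] P) {L : Submodule R P} (hL : L.FG) :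
    ∃ L₁ : Submodule R N, L₁.FG ∧ ∀ y, g y ∈ L → ∃ l ∈ L₁, g l = g y := by
  classical
  have hL' : ((L.comap g).map g).FG := by
    have := isNoetherian_of_fg_of_noetherian L hL
    exact Submodule.FG.of_le hL (Submodule.map_comap_le g L)
  obtain ⟨s, hs⟩ := hL'
  have hsub : (s : Set P) ⊆ g '' (L.comap g) := by
    rw [← Submodule.map_coe, ← hs]; exact Submodule.subset_span
  obtain ⟨t, -, ht⟩ := Finset.subset_set_image_iff.1 hsub
  refine ⟨Submodule.span R t, ⟨t, rfl⟩, fun y hy => ?_⟩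
  have : g y ∈ (Submodule.span R (t : Set N)).map g := by
    rw [Submodule.map_span, ← Finset.coe_image, ht, hs]
    exact ⟨y, hy, rfl⟩
  exact this

variable (I) in
lemma map_exact_of_fg {f : M →ₗ[R] N} {g : N →ₗ[R] P} (h0 : g ∘ₗ f = 0) {L₂ : Submodule R N}
    (hL₂ : L₂.FG) (h : LinearMap.ker g ≤ LinearMap.range f ⊔ L₂) :
    Function.Exact (map I f) (map I g) := by
  rw [LinearMap.exact_iff]
  apply le_antisymm
  · intro y hy
    obtain ⟨y, rfl⟩ := Submodule.mkQ_surjective _ y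
    rw [LinearMap.mem_ker, map_mk, mkQ_eq_zero] at hy
    obtain ⟨L, hL, hy⟩ := hy
    obtain ⟨L₁, hL₁, h₁⟩ := exists_fg_lift g hL
    have key : ∀ i, ∃ x : M, y i - f x ∈ L₁ ⊔ L₂ := by
      intro i
      obtain ⟨l, hl, hl'⟩ := h₁ (y i) (hy i)
      have hk : y i - l ∈ LinearMap.ker g := by simp [hl']
      obtain ⟨_, ⟨x, rfl⟩, l₂, hl₂, hx⟩ := Submodule.mem_sup.1 (h hk)
      refine ⟨x, Submodule.mem_sup.2 ⟨l, hl, l₂, hl₂, ?_⟩⟩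
      rw [eq_sub_iff_add_eq] at hx ⊢
      rw [← hx]; abel
    choose x hx using key
    refine ⟨(Submodule.fgFamilies R I M).mkQ x, ?_⟩
    rw [eq_comm, ← sub_eq_zero, map_mk, ← map_sub, mkQ_eq_zero]
    exact ⟨L₁ ⊔ L₂, hL₁.sup hL₂, hx⟩
  · rintro _ ⟨x, rfl⟩
    rw [LinearMap.mem_ker, ← LinearMap.comp_apply, ← map_comp, h0]
    obtain ⟨x, rfl⟩ := Submodule.mkQ_surjective _ x
    rw [map_mk, mkQ_eq_zero]
    exact ⟨⊥, Submodule.fg_bot, fun i => by simp⟩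

lemma map_exact {f : M →ₗ[R] N} {g : N →ₗ[R] P} (h : Function.Exact f g) :
    Function.Exact (map I f) (map I g) :=
  map_exact_of_fg I h.linearMap_comp_eq_zero Submodule.fg_bot
    (by rw [LinearMap.exact_iff.1 h]; exact le_sup_left)

lemma exists_fg_of_map_exact {f : M →ₗ[R] N} {g : N →ₗ[R] P}
    (h : ∀ I : Type u, Function.Exact (map I f) (map I g)) :
    ∃ L₂ : Submodule R N, L₂.FG ∧ LinearMap.ker g ≤ LinearMap.range f ⊔ L₂ := by
  have h1 : map (LinearMap.ker g) g ((Submodule.fgFamilies R (LinearMap.ker g) N).mkQ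
      (fun y => (y : N))) = 0 := by
    rw [map_mk, mkQ_eq_zero]
    exact ⟨⊥, Submodule.fg_bot, fun i => by simp⟩
  obtain ⟨x, hx⟩ := (h _ _).1 h1
  obtain ⟨x, rfl⟩ := Submodule.mkQ_surjective _ x
  rw [map_mk, eq_comm, ← sub_eq_zero, ← map_sub, mkQ_eq_zero] at hx
  obtain ⟨L, hL, hx⟩ := hx
  refine ⟨L, hL, fun y hy => ?_⟩
  rw [Submodule.mem_sup]
  exact ⟨_, ⟨x ⟨y, hy⟩, rfl⟩, _, hx ⟨y, hy⟩, by simp⟩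

lemma map_surjective {f : M →ₗ[R] N} (h : Function.Surjective f) :
    Function.Surjective (map I f) := by
  intro y
  obtain ⟨y, rfl⟩ := Submodule.mkQ_surjective _ y
  choose x hx using fun i => h (y i)
  exact ⟨(Submodule.fgFamilies R I M).mkQ x, by rw [map_mk]; simp [hx]⟩

lemma map_injective {f : M →ₗ[R] N} (h : Function.Injective f) :
    Function.Injective (map I f) := by
  rw [injective_iff_map_eq_zero]
  intro x hx
  obtain ⟨x, rfl⟩ := Submodule.mkQ_surjective _ x
  rw [map_mk, mkQ_eq_zero] at hx
  obtain ⟨L, hL, hx⟩ := hx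
  obtain ⟨L₁, hL₁, h₁⟩ := exists_fg_lift f hL
  rw [mkQ_eq_zero]
  refine ⟨L₁, hL₁, fun i => ?_⟩
  obtain ⟨l, hl, hl'⟩ := h₁ _ (hx i)
  rwa [← h hl']

lemma subsingleton_of_finite [Module.Finite R M] : Subsingleton (FamilyQuotient R I M) := by
  refine subsingleton_of_forall_eq 0 fun x => ?_
  obtain ⟨x, rfl⟩ := Submodule.mkQ_surjective _ x
  rw [mkQ_eq_zero]
  exact ⟨⊤, Module.Finite.fg_top, fun i => trivial⟩

lemma finite_of_subsingleton (h : ∀ I : Type u, Subsingleton (FamilyQuotient R I M)) :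
    Module.Finite R M := by
  have h0 := mkQ_eq_zero.1 (Subsingleton.elim
    ((Submodule.fgFamilies R M M).mkQ (fun m => m)) 0)
  obtain ⟨L, hL, hx⟩ := h0
  exact ⟨by rwa [(eq_top_iff.2 fun m _ => hx m : L = ⊤)] at hL⟩

variable (R I M N) in
/-- The comparison between the family quotient of `Hom(N, M)` and maps from `N` to the family
quotient of `M`. -/
def homComparison : FamilyQuotient R I (N →ₗ[R] M) →ₗ[R] (N →ₗ[R] FamilyQuotient R I M) :=
  Submodule.liftQ _
    { toFun := fun φ => (Submodule.fgFamilies R I M).mkQ ∘ₗ LinearMap.pi φ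
      map_add' := fun φ φ' => by
        ext n
        rfl
      map_smul' := fun r φ => by
        ext n
        rfl }
    (by
      rintro φ ⟨L, hL, hφ⟩
      rw [LinearMap.mem_ker]
      ext n
      refine mkQ_eq_zero.2 ⟨L.map (LinearMap.applyₗ n), hL.map _, fun i => ?_⟩
      exact ⟨φ i, hφ i, rfl⟩)

lemma homComparison_mk (φ : I → N →ₗ[R] M) (n : N) :
    homComparison R I M N ((Submodule.fgFamilies R I (N →ₗ[R] M)).mkQ φ) n =
      (Submodule.fgFamilies R I M).mkQ (fun i => φ i n) := rfl

lemma homComparison_naturality (f : N →ₗ[R] P) (x : FamilyQuotient R I (P →ₗ[R] M)) :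
    homComparison R I M N (map I (LinearMap.lcomp R M f) x) = homComparison R I M P x ∘ₗ f := by
  obtain ⟨x, rfl⟩ := Submodule.mkQ_surjective _ x
  ext n
  rfl

lemma homComparison_injective [Module.Finite R N] : Function.Injective (homComparison R I M N) := by
  rw [injective_iff_map_eq_zero]
  intro x hx
  obtain ⟨φ, rfl⟩ := Submodule.mkQ_surjective _ x
  obtain ⟨s, hs⟩ := (Module.Finite.fg_top : (⊤ : Submodule R N).FG)
  have h1 : ∀ n : N, ∃ L : Submodule R M, L.FG ∧ ∀ i, φ i n ∈ L := fun n =>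
    mkQ_eq_zero.1 (by rw [← homComparison_mk, hx]; rfl)
  choose L hL hφ using h1
  let L' : Submodule R M := s.sup L
  have hL' : L'.FG := Submodule.fg_finset_sup s L (fun i _ => hL i)
  have hφ' : ∀ i n, φ i n ∈ L' := by
    intro i n
    have : (⊤ : Submodule R N) ≤ L'.comap (φ i) := by
      rw [← hs, Submodule.span_le]
      intro n hn
      exact (Finset.le_sup (f := L) hn) (hφ n i)
    exact this trivial
  have := Module.Finite.iff_fg.2 hL'
  have : Module.Finite R (N →ₗ[R] L') := inferInstance
  rw [mkQ_eq_zero]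
  refine ⟨LinearMap.range (LinearMap.compRight R L'.subtype : (N →ₗ[R] L') →ₗ[R] (N →ₗ[R] M)),
    Module.Finite.iff_fg.1 inferInstance, fun i => ⟨(φ i).codRestrict L' (hφ' i), rfl⟩⟩

lemma homComparison_surjective_pi (n : ℕ) :
    Function.Surjective (homComparison R I M (Fin n → R)) := by
  intro f
  choose x hx using fun k : Fin n => Submodule.mkQ_surjective _ (f (Pi.single k 1))
  refine ⟨(Submodule.fgFamilies R I ((Fin n → R) →ₗ[R] M)).mkQ
    (fun i => (Pi.basisFun R (Fin n)).constr R (fun k => x k i)), ?_⟩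
  refine (Pi.basisFun R (Fin n)).ext fun k => ?_
  rw [homComparison_mk, Pi.basisFun_apply, ← hx k]
  congr 1
  ext i
  have := (Pi.basisFun R (Fin n)).constr_basis R (fun k => x k i) k
  rwa [Pi.basisFun_apply] at this

lemma homComparison_bijective [Module.Finite R N] :
    Function.Bijective (homComparison R I M N) := by
  refine ⟨homComparison_injective, fun f => ?_⟩
  obtain ⟨n, p, hp⟩ := Module.Finite.exists_fin' R N
  let K := LinearMap.ker p
  obtain ⟨y, hy⟩ := homComparison_surjective_pi n (f ∘ₗ p)
  have hex : Function.Exact (LinearMap.lcomp R M p) (LinearMap.lcomp R M K.subtype) := by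
    intro φ
    constructor
    · intro h
      have hk : LinearMap.ker p ≤ LinearMap.ker φ := fun x hx => LinearMap.congr_fun h ⟨x, hx⟩
      let e := p.quotKerEquivOfSurjective hp
      refine ⟨(LinearMap.ker p).liftQ φ hk ∘ₗ e.symm.toLinearMap, ?_⟩
      refine LinearMap.ext fun x => ?_
      have : e.symm (p x) = Submodule.Quotient.mk x := by
        rw [LinearEquiv.symm_apply_eq]; rfl
      simp [this]
    · rintro ⟨φ, rfl⟩
      refine LinearMap.ext fun x => ?_
      rw [LinearMap.lcomp_apply, LinearMap.lcomp_apply, K.subtype_apply, LinearMap.mem_ker.1 x.2,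
        map_zero, LinearMap.zero_apply]
  have h2 : map I (LinearMap.lcomp R M K.subtype) y = 0 := by
    apply homComparison_injective
    rw [homComparison_naturality, hy, map_zero]
    refine LinearMap.ext fun x => ?_
    rw [LinearMap.comp_apply, LinearMap.comp_apply, K.subtype_apply, LinearMap.mem_ker.1 x.2,
      map_zero, LinearMap.zero_apply]
  obtain ⟨z, rfl⟩ := (map_exact hex y).1 h2
  refine ⟨z, ?_⟩
  rw [homComparison_naturality] at hy
  ext x
  obtain ⟨x, rfl⟩ := hp x
  exact LinearMap.congr_fun hy x

open TensorProduct

variable (R I M N) in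
/-- The comparison between tensoring the family quotient with `N` and the family quotient of the
tensor product. -/
def tensorComparison : N ⊗[R] FamilyQuotient R I M →ₗ[R] FamilyQuotient R I (N ⊗[R] M) :=
  TensorProduct.lift
    { toFun := fun n => map I (TensorProduct.mk R N M n)
      map_add' := fun n n' => by rw [_root_.map_add, FamilyQuotient.map_add]
      map_smul' := fun r n => by
        ext x : 2
        simp only [map_smul]
        rfl }

lemma tensorComparison_tmul (n : N) (x : FamilyQuotient R I M) :
    tensorComparison R I M N (n ⊗ₜ x) = map I (TensorProduct.mk R N M n) x := rfl

lemma tensorComparison_rTensor (f : N →ₗ[R] P) :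
    tensorComparison R I M P ∘ₗ f.rTensor (FamilyQuotient R I M) =
      map I (f.rTensor M) ∘ₗ tensorComparison R I M N := by
  apply TensorProduct.ext'
  intro n x
  obtain ⟨x, rfl⟩ := Submodule.mkQ_surjective _ x
  rfl

lemma tensorComparison_lTensor (f : M →ₗ[R] P) :
    tensorComparison R I P N ∘ₗ (map I f).lTensor N =
      map I (f.lTensor N) ∘ₗ tensorComparison R I M N := by
  apply TensorProduct.ext'
  intro n x
  obtain ⟨x, rfl⟩ := Submodule.mkQ_surjective _ x
  rfl

lemma tensorComparison_surjective_pi (n : ℕ) :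
    Function.Surjective (tensorComparison R I M (Fin n → R)) := by
  intro y
  obtain ⟨y, rfl⟩ := Submodule.mkQ_surjective _ y
  let b := Pi.basisFun R (Fin n)
  have key : ∀ t : (Fin n → R) ⊗[R] M, ∃ m : Fin n → M, t = ∑ k, b k ⊗ₜ m k := by
    intro t
    induction t with
    | zero => exact ⟨0, by simp⟩
    | tmul r m =>
      refine ⟨fun k => r k • m, ?_⟩
      conv_lhs => rw [← b.sum_repr r]
      simp [b, TensorProduct.sum_tmul, TensorProduct.smul_tmul]
    | add t t' h h' =>
      obtain ⟨m, rfl⟩ := h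
      obtain ⟨m', rfl⟩ := h'
      exact ⟨m + m', by simp [TensorProduct.tmul_add, Finset.sum_add_distrib]⟩
  choose m hm using fun i => key (y i)
  refine ⟨∑ k, b k ⊗ₜ (Submodule.fgFamilies R I M).mkQ (fun i => m i k), ?_⟩
  simp only [map_sum, tensorComparison_tmul, map_mk]
  rw [← map_sum]
  congr 1
  ext i
  simp [hm i]

lemma tensorComparison_surjective [Module.Finite R N] :
    Function.Surjective (tensorComparison R I M N) := by
  obtain ⟨n, p, hp⟩ := Module.Finite.exists_fin' R N
  intro y
  obtain ⟨z, rfl⟩ := map_surjective (I := I) (LinearMap.rTensor_surjective M hp) y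
  obtain ⟨w, rfl⟩ := tensorComparison_surjective_pi n z
  exact ⟨_, LinearMap.congr_fun (tensorComparison_rTensor p) w⟩

lemma tensorComparison_injective_pi (n : ℕ) :
    Function.Injective (tensorComparison R I M (Fin n → R)) := by
  rw [injective_iff_map_eq_zero]
  intro t ht
  let b := Pi.basisFun R (Fin n)
  have key : ∃ m : Fin n → FamilyQuotient R I M, t = ∑ k, b k ⊗ₜ m k := by
    clear ht
    induction t with
    | zero => exact ⟨0, by simp⟩
    | tmul r m =>
      refine ⟨fun k => r k • m, ?_⟩
      conv_lhs => rw [← b.sum_repr r]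
      simp [b, TensorProduct.sum_tmul, TensorProduct.smul_tmul]
    | add t t' h h' =>
      obtain ⟨m, rfl⟩ := h
      obtain ⟨m', rfl⟩ := h'
      exact ⟨m + m', by simp [TensorProduct.tmul_add, Finset.sum_add_distrib]⟩
  obtain ⟨m, rfl⟩ := key
  refine Finset.sum_eq_zero fun j _ => ?_
  have : m j = 0 := by
    have h2 := congrArg (map I ((TensorProduct.lid R M).toLinearMap ∘ₗ
      (LinearMap.proj (R := R) (φ := fun _ : Fin n => R) j).rTensor M)) ht
    simp only [map_sum, tensorComparison_tmul, map_zero] at h2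
    rw [Finset.sum_eq_single j] at h2
    · rw [← LinearMap.comp_apply, ← map_comp] at h2
      rw [← h2]
      conv_lhs => rw [← LinearMap.id_apply (R := R) (m j), ← map_id]
      congr 2
      ext x
      simp [b]
    · intro k _ hk
      rw [← LinearMap.comp_apply, ← map_comp]
      obtain ⟨x, hx⟩ := Submodule.mkQ_surjective _ (m k)
      rw [← hx, map_mk, mkQ_eq_zero]
      exact ⟨⊥, Submodule.fg_bot, fun i => by simp [b, hk.symm]⟩
    · simp
  rw [this, TensorProduct.tmul_zero]

lemma tensorComparison_bijective [Module.Finite R N] :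
    Function.Bijective (tensorComparison R I M N) := by
  refine ⟨?_, tensorComparison_surjective⟩
  obtain ⟨n, p, hp⟩ := Module.Finite.exists_fin' R N
  let K := LinearMap.ker p
  rw [injective_iff_map_eq_zero]
  intro t ht
  obtain ⟨t, rfl⟩ := LinearMap.rTensor_surjective _ hp t
  have hKp : Function.Exact K.subtype p := LinearMap.exact_subtype_ker_map p
  have h1 : map I (p.rTensor M) (tensorComparison R I M _ t) = 0 := by
    rw [← ht]; exact (LinearMap.congr_fun (tensorComparison_rTensor p) t).symm
  obtain ⟨z, hz⟩ := (map_exact (I := I) (rTensor_exact M hKp hp) _).1 h1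
  obtain ⟨w, rfl⟩ := tensorComparison_surjective z
  have h2 : K.subtype.rTensor _ w = t := by
    apply tensorComparison_injective_pi n
    rw [← hz]
    exact LinearMap.congr_fun (tensorComparison_rTensor K.subtype) w
  rw [← h2]
  exact ((rTensor_exact _ hKp hp) _).2 ⟨w, rfl⟩

instance flat [Module.Flat R M] : Module.Flat R (FamilyQuotient R I M) := by
  rw [Module.Flat.iff_rTensor_injective]
  intro J _
  have h1 : Function.Injective (tensorComparison R I M R ∘ₗ
      J.subtype.rTensor (FamilyQuotient R I M)) := by
    rw [tensorComparison_rTensor]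
    refine Function.Injective.comp (g := map I (J.subtype.rTensor M)) ?_
      tensorComparison_bijective.1
    exact map_injective (Module.Flat.rTensor_preserves_injective_linearMap _ J.injective_subtype)
  exact Function.Injective.of_comp (f := tensorComparison R I M R) h1

/-- Tensoring commutes with the formation of family quotients, so exactness can be tested
after either. -/
lemma lTensor_exact_iff [Module.Finite R N] {M₁ M₂ M₃ : Type u} [AddCommGroup M₁] [Module R M₁]
    [AddCommGroup M₂] [Module R M₂] [AddCommGroup M₃] [Module R M₃]
    (f : M₁ →ₗ[R] M₂) (g : M₂ →ₗ[R] M₃) :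
    Function.Exact ((map I f).lTensor N) ((map I g).lTensor N) ↔
      Function.Exact (map I (f.lTensor N)) (map I (g.lTensor N)) :=
  Function.Exact.iff_of_ladder_linearEquiv
    (e₁ := LinearEquiv.ofBijective _ (tensorComparison_bijective (I := I) (M := M₁) (N := N)))
    (e₂ := LinearEquiv.ofBijective _ (tensorComparison_bijective (I := I) (M := M₂) (N := N)))
    (e₃ := LinearEquiv.ofBijective _ (tensorComparison_bijective (I := I) (M := M₃) (N := N)))
    (tensorComparison_lTensor f).symm (tensorComparison_lTensor g).symm |>.symm

lemma lTensor_surjective_iff [Module.Finite R N] {M₁ M₂ : Type u} [AddCommGroup M₁] [Module R M₁]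
    [AddCommGroup M₂] [Module R M₂] (f : M₁ →ₗ[R] M₂) :
    Function.Surjective ((map I f).lTensor N) ↔
      Function.Surjective (map I (f.lTensor N)) := by
  have h := tensorComparison_lTensor (I := I) (N := N) f
  have h' : ∀ x, _ := LinearMap.congr_fun h
  constructor
  · intro hs y
    obtain ⟨z, rfl⟩ := tensorComparison_surjective y
    obtain ⟨w, rfl⟩ := hs z
    exact ⟨_, (h' w).symm⟩
  · intro hs y
    obtain ⟨z, hz⟩ := hs (tensorComparison R I _ _ y)
    obtain ⟨w, rfl⟩ := tensorComparison_surjective z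
    refine ⟨w, tensorComparison_bijective.1 ?_⟩
    rw [← hz]
    exact h' w

end FamilyQuotient
end

section
open CategoryTheory.Abelian
namespace CategoryTheory.ShortComplex.ShortExact
variable {C : Type v} [Category.{u} C] [Abelian C] [HasExt.{w} C] {S : ShortComplex C}
lemma subsingleton_ext_shift_contravariant (hS : S.ShortExact) (Y : C) (i : ℕ)
    (h₁ : Subsingleton (Abelian.Ext S.X₂ Y (i + 1)))
    (h₂ : Subsingleton (Abelian.Ext S.X₂ Y (i + 2))) :
    Subsingleton (Abelian.Ext S.X₃ Y (i + 2)) ↔ Subsingleton (Abelian.Ext S.X₁ Y (i + 1)) := by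
  constructor
  · intro h
    refine subsingleton_of_forall_eq 0 fun x => ?_
    obtain ⟨y, rfl⟩ := Ext.contravariant_sequence_exact₁ hS Y x (show 1 + (i + 1) = i + 2 by omega)
      (Subsingleton.elim _ _)
    rw [Subsingleton.elim y 0, Ext.comp_zero]
  · intro h
    refine subsingleton_of_forall_eq 0 fun x => ?_
    obtain ⟨y, rfl⟩ := Ext.contravariant_sequence_exact₃ hS Y x (Subsingleton.elim _ _)
      (show 1 + (i + 1) = i + 2 by omega)
    rw [Subsingleton.elim y 0, Ext.comp_zero]

lemma subsingleton_ext_one_contravariant (hS : S.ShortExact) (Y : C)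
    (h₁ : Subsingleton (Abelian.Ext S.X₂ Y 1)) :
    Subsingleton (Abelian.Ext S.X₃ Y 1) ↔ ∀ φ : S.X₁ ⟶ Y, ∃ ψ, S.f ≫ ψ = φ := by
  constructor
  · intro h φ
    obtain ⟨y, hy⟩ := Ext.contravariant_sequence_exact₁ hS Y (Ext.mk₀ φ) (add_zero 1)
      (Subsingleton.elim _ _)
    obtain ⟨ψ, rfl⟩ := (Ext.mk₀_bijective _ _).2 y
    rw [Ext.mk₀_comp_mk₀] at hy
    exact ⟨ψ, (Ext.mk₀_bijective _ _).1 hy⟩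
  · intro h
    refine subsingleton_of_forall_eq 0 fun x => ?_
    obtain ⟨y, rfl⟩ := Ext.contravariant_sequence_exact₃ hS Y x (Subsingleton.elim _ _)
      (add_zero 1)
    obtain ⟨φ, rfl⟩ := (Ext.mk₀_bijective _ _).2 y
    obtain ⟨ψ, rfl⟩ := h φ
    rw [← Ext.mk₀_comp_mk₀, hS.extClass_comp_assoc]

lemma subsingleton_ext_shift_covariant (hS : S.ShortExact) (Y : C) (i : ℕ)
    (h₁ : Subsingleton (Abelian.Ext Y S.X₂ (i + 1)))
    (h₂ : Subsingleton (Abelian.Ext Y S.X₂ (i + 2))) :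
    Subsingleton (Abelian.Ext Y S.X₁ (i + 2)) ↔ Subsingleton (Abelian.Ext Y S.X₃ (i + 1)) := by
  constructor
  · intro h
    refine subsingleton_of_forall_eq 0 fun x => ?_
    obtain ⟨y, rfl⟩ := Ext.covariant_sequence_exact₃ Y hS x (show (i + 1) + 1 = i + 2 by omega)
      (Subsingleton.elim _ _)
    rw [Subsingleton.elim y 0, Ext.zero_comp]
  · intro h
    refine subsingleton_of_forall_eq 0 fun x => ?_
    obtain ⟨y, rfl⟩ := Ext.covariant_sequence_exact₁ Y hS x (Subsingleton.elim _ _)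
      (show (i + 1) + 1 = i + 2 by omega)
    rw [Subsingleton.elim y 0, Ext.zero_comp]

lemma subsingleton_ext_one_covariant (hS : S.ShortExact) (Y : C)
    (h₁ : Subsingleton (Abelian.Ext Y S.X₂ 1)) :
    Subsingleton (Abelian.Ext Y S.X₁ 1) ↔ ∀ φ : Y ⟶ S.X₃, ∃ ψ, ψ ≫ S.g = φ := by
  constructor
  · intro h φ
    obtain ⟨y, hy⟩ := Ext.covariant_sequence_exact₃ Y hS (Ext.mk₀ φ) (zero_add 1)
      (Subsingleton.elim _ _)
    obtain ⟨ψ, rfl⟩ := (Ext.mk₀_bijective _ _).2 y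
    rw [Ext.mk₀_comp_mk₀] at hy
    exact ⟨ψ, (Ext.mk₀_bijective _ _).1 hy⟩
  · intro h
    refine subsingleton_of_forall_eq 0 fun x => ?_
    obtain ⟨y, rfl⟩ := Ext.covariant_sequence_exact₁ Y hS x (Subsingleton.elim _ _)
      (zero_add 1)
    obtain ⟨φ, rfl⟩ := (Ext.mk₀_bijective _ _).2 y
    obtain ⟨ψ, rfl⟩ := h φ
    rw [← Ext.mk₀_comp_mk₀, Ext.comp_assoc (h₁₂ := zero_add 0) (h₂₃ := zero_add 1) (h := by simp),
      hS.comp_extClass, Ext.comp_zero]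

end CategoryTheory.ShortComplex.ShortExact

end

section
open CategoryTheory.Abelian TensorProduct
variable {R : Type u} [CommRing R] {N X Y Z : Type u} [AddCommGroup N] [Module R N]
  [AddCommGroup X] [Module R X] [AddCommGroup Y] [Module R Y] [AddCommGroup Z] [Module R Z]

namespace CharacterModule

lemma dual_exact {f : X →ₗ[R] Y} {g : Y →ₗ[R] Z} (h : Function.Exact f g)
    (hg : Function.Surjective g) : Function.Exact (dual g) (dual f) := by
  intro c
  constructor
  · intro hc
    have hk : g.toAddMonoidHom.ker ≤ AddMonoidHom.ker (c : Y →+ AddCircle (1 : ℚ)) := by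
      intro y hy
      obtain ⟨x, rfl⟩ := (h y).1 hy
      exact DFunLike.congr_fun hc x
    refine ⟨AddMonoidHom.liftOfSurjective g.toAddMonoidHom hg ⟨c, hk⟩, ?_⟩
    refine DFunLike.ext _ _ fun y => ?_
    exact AddMonoidHom.liftOfRightInverse_comp_apply _ _ (Function.rightInverse_surjInv hg)
        ⟨c, hk⟩ y
  · rintro ⟨c, rfl⟩
    refine DFunLike.ext _ _ fun y => ?_
    change c (g (f y)) = 0
    rw [h.apply_apply_eq_zero, map_zero]

lemma shortExact_dual {f : X →ₗ[R] Y} {g : Y →ₗ[R] Z} (h : Function.Exact f g)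
    (hf : Function.Injective f) (hg : Function.Surjective g) :
    (ModuleCat.shortComplexOfCompEqZero (dual g) (dual f)
      (dual_exact h hg).linearMap_comp_eq_zero).ShortExact :=
  ModuleCat.shortComplex_shortExact _ (dual_exact h hg) (dual_injective_of_surjective g hg)
    (dual_surjective_of_injective f hf)

lemma homEquiv_dual_comp (f : X →ₗ[R] Y) (φ : N →ₗ[R] CharacterModule Y) :
    homEquiv (dual f ∘ₗ φ) = dual (f.lTensor N) (homEquiv φ) := by
  refine DFunLike.ext _ _ fun t => ?_
  induction t with
  | zero => rw [map_zero, map_zero]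
  | tmul n x => rfl
  | add t t' h h' => rw [map_add, map_add, h, h']

lemma forall_exists_lift_iff (f : X →ₗ[R] Y) :
    (∀ φ : N →ₗ[R] CharacterModule X, ∃ ψ : N →ₗ[R] CharacterModule Y, dual f ∘ₗ ψ = φ) ↔
      Function.Injective (f.lTensor N) := by
  rw [← dual_surjective_iff_injective]
  constructor
  · intro h c
    obtain ⟨ψ, hψ⟩ := h (homEquiv.symm c)
    exact ⟨homEquiv ψ, by rw [← homEquiv_dual_comp, hψ, LinearEquiv.apply_symm_apply]⟩
  · intro h φ
    obtain ⟨c, hc⟩ := h (homEquiv φ)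
    refine ⟨homEquiv.symm c, homEquiv.injective ?_⟩
    rw [homEquiv_dual_comp, LinearEquiv.apply_symm_apply, hc]

lemma subsingleton_iff : Subsingleton (CharacterModule X) ↔ Subsingleton X := by
  constructor
  · intro h
    exact subsingleton_of_forall_eq 0 fun x =>
      eq_zero_of_character_apply fun c => by rw [Subsingleton.elim c 0]; rfl
  · intro h
    refine subsingleton_of_forall_eq 0 fun c => DFunLike.ext _ _ fun x => ?_
    rw [Subsingleton.elim x 0, map_zero, map_zero]

lemma subsingleton_hom_iff :
    Subsingleton (N →ₗ[R] CharacterModule X) ↔ Subsingleton (N ⊗[R] X) := by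
  rw [← subsingleton_iff (X := N ⊗[R] X)]
  exact (homEquiv (R := R) (A := N) (B := X)).toEquiv.subsingleton_congr

instance injective_of_flat [Module.Flat R X] :
    Injective (ModuleCat.of R (CharacterModule X)) := by
  have := (Module.Flat.iff_characterModule_injective (R := R) (M := X)).1 inferInstance
  exact Module.injective_object_of_injective_module R (CharacterModule X)

end CharacterModule

lemma ModuleCat.subsingleton_ext_zero_iff :
    Subsingleton (Abelian.Ext (ModuleCat.of R N) (ModuleCat.of R X) 0) ↔
      Subsingleton (N →ₗ[R] X) :=
  ((Ext.linearEquiv₀ (R := R)).trans ModuleCat.homLinearEquiv).toEquiv.subsingleton_congr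

lemma ModuleCat.forall_hom_iff {P : (ModuleCat.of R N ⟶ ModuleCat.of R X) → Prop} :
    (∀ f, P f) ↔ ∀ g : N →ₗ[R] X, P (ModuleCat.ofHom g) :=
  ⟨fun h _ => h _, fun h φ => h φ.hom⟩

lemma ModuleCat.exists_hom_iff {P : (ModuleCat.of R N ⟶ ModuleCat.of R X) → Prop} :
    (∃ f, P f) ↔ ∃ g : N →ₗ[R] X, P (ModuleCat.ofHom g) :=
  ⟨fun ⟨φ, h⟩ => ⟨φ.hom, h⟩, fun ⟨_, h⟩ => ⟨_, h⟩⟩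

namespace CharacterModule

lemma subsingleton_ext_one_iff [Module.Flat R Y] {f : X →ₗ[R] Y} {g : Y →ₗ[R] Z}
    (h : Function.Exact f g) (hf : Function.Injective f) (hg : Function.Surjective g) :
    Subsingleton (Abelian.Ext (ModuleCat.of R N) (ModuleCat.of R (CharacterModule Z)) 1) ↔
      Function.Injective (f.lTensor N) := by
  rw [← forall_exists_lift_iff]
  refine ((shortExact_dual h hf hg).subsingleton_ext_one_covariant (ModuleCat.of R N)
    (Ext.subsingleton_of_injective _ _ 0)).trans ?_
  refine ModuleCat.forall_hom_iff.trans (forall_congr' fun φ => ?_)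
  refine ModuleCat.exists_hom_iff.trans (exists_congr fun ψ => ?_)
  exact ⟨fun h => congrArg ModuleCat.Hom.hom h, fun h => congrArg ModuleCat.ofHom h⟩

lemma subsingleton_ext_shift_iff [Module.Flat R Y] {f : X →ₗ[R] Y} {g : Y →ₗ[R] Z}
    (h : Function.Exact f g) (hf : Function.Injective f) (hg : Function.Surjective g) (i : ℕ) :
    Subsingleton (Abelian.Ext (ModuleCat.of R N) (ModuleCat.of R (CharacterModule Z)) (i + 2)) ↔
      Subsingleton
        (Abelian.Ext (ModuleCat.of R N) (ModuleCat.of R (CharacterModule X)) (i + 1)) :=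
  (shortExact_dual h hf hg).subsingleton_ext_shift_covariant (ModuleCat.of R N) i
    (Ext.subsingleton_of_injective _ _ i) (Ext.subsingleton_of_injective _ _ (i + 1))

lemma subsingleton_ext_zero_iff :
    Subsingleton (Abelian.Ext (ModuleCat.of R N) (ModuleCat.of R (CharacterModule X)) 0) ↔
      Subsingleton (N ⊗[R] X) :=
  ModuleCat.subsingleton_ext_zero_iff.trans subsingleton_hom_iff

variable (R X) in
lemma _root_.Module.exists_free_cover : ∃ (F : Type u) (_ : AddCommGroup F) (_ : Module R F)
    (_ : Module.Free R F) (p : F →ₗ[R] X), Function.Surjective p :=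
  ⟨X →₀ R, inferInstance, inferInstance, inferInstance, Finsupp.linearCombination R id,
    Finsupp.linearCombination_id_surjective R X⟩

variable (X N) in
/-- The vanishing of `Ext^i(X, N⋆)` is symmetric in `X` and `N`. -/
lemma subsingleton_ext_symm (i : ℕ) :
    Subsingleton (Abelian.Ext (ModuleCat.of R X) (ModuleCat.of R (CharacterModule N)) i) ↔
      Subsingleton (Abelian.Ext (ModuleCat.of R N) (ModuleCat.of R (CharacterModule X)) i) := by
  induction i using Nat.strong_induction_on generalizing X with
  | _ i ih =>
    obtain ⟨F, _, _, _, p, hp⟩ := Module.exists_free_cover R X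
    have hS := LinearMap.shortExact_shortComplexKer hp
    have hex : Function.Exact (LinearMap.ker p).subtype p := LinearMap.exact_subtype_ker_map p
    have hproj : Projective (ModuleCat.of R F) := inferInstance
    match i with
    | 0 =>
      rw [subsingleton_ext_zero_iff, subsingleton_ext_zero_iff]
      exact (TensorProduct.comm R X N).toEquiv.subsingleton_congr
    | 1 =>
      rw [subsingleton_ext_one_iff hex (LinearMap.ker p).injective_subtype hp,
        LinearMap.lTensor_inj_iff_rTensor_inj, rTensor_injective_iff_lcomp_surjective]
      refine (hS.subsingleton_ext_one_contravariant _
          (Ext.subsingleton_of_projective _ _ 0)).trans ?_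
      refine ModuleCat.forall_hom_iff.trans (forall_congr' fun φ => ?_)
      refine ModuleCat.exists_hom_iff.trans (exists_congr fun ψ => ?_)
      exact ⟨fun h => congrArg ModuleCat.Hom.hom h, fun h => congrArg ModuleCat.ofHom h⟩
    | i + 2 =>
      rw [subsingleton_ext_shift_iff hex (LinearMap.ker p).injective_subtype hp,
        ← ih (i + 1) (by omega)]
      exact hS.subsingleton_ext_shift_contravariant _ i (Ext.subsingleton_of_projective _ _ i)
        (Ext.subsingleton_of_projective _ _ (i + 1))

/-- Exactness of `N ⊗ C` at degree `i`, where `C` is a flat resolution of `X`, is the vanishing of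
`Ext^i(N, X⋆)`. -/
lemma subsingleton_ext_zero_iff_surjective {C₀ C₁ : Type u} [AddCommGroup C₀] [Module R C₀]
    [AddCommGroup C₁] [Module R C₁] {d : C₁ →ₗ[R] C₀} {π : C₀ →ₗ[R] X} (h : Function.Exact d π)
    (hπ : Function.Surjective π) :
    Subsingleton (Abelian.Ext (ModuleCat.of R N) (ModuleCat.of R (CharacterModule X)) 0) ↔
      Function.Surjective (d.lTensor N) := by
  rw [subsingleton_ext_zero_iff]
  have hex := lTensor_exact N h hπ
  have hs := LinearMap.lTensor_surjective N hπ
  constructor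
  · intro _ x
    exact (hex x).1 (Subsingleton.elim _ _)
  · intro hd
    refine subsingleton_of_forall_eq 0 fun y => ?_
    obtain ⟨x, rfl⟩ := hs y
    exact (hex x).2 (hd x)

lemma subsingleton_ext_succ_iff_exact (i : ℕ) (C : ℕ → Type u) [∀ i, AddCommGroup (C i)]
    [∀ i, Module R (C i)] [∀ i, Module.Flat R (C i)] (d : ∀ i, C (i + 1) →ₗ[R] C i)
    (hd : ∀ i, Function.Exact (d (i + 1)) (d i))
    {π : C 0 →ₗ[R] X} (h : Function.Exact (d 0) π) (hπ : Function.Surjective π) :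
    Subsingleton (Abelian.Ext (ModuleCat.of R N) (ModuleCat.of R (CharacterModule X)) (i + 1)) ↔
      Function.Exact ((d (i + 1)).lTensor N) ((d i).lTensor N) := by
  induction i generalizing C X with
  | zero =>
    have hex : Function.Exact (LinearMap.ker π).subtype π := LinearMap.exact_subtype_ker_map π
    rw [subsingleton_ext_one_iff hex (LinearMap.ker π).injective_subtype hπ]
    let π' : C 1 →ₗ[R] LinearMap.ker π := (d 0).codRestrict _ h.apply_apply_eq_zero
    have hπ' : Function.Surjective π' := by
      rintro ⟨x, hx⟩
      obtain ⟨y, rfl⟩ := (h x).1 hx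
      exact ⟨y, rfl⟩
    have h' : Function.Exact (d 1) π' := by
      intro y
      rw [← hd 0 y, Subtype.ext_iff]
      rfl
    have hex' := lTensor_exact N h' hπ'
    have hs := LinearMap.lTensor_surjective N hπ'
    have hc : (d 0).lTensor N = (LinearMap.ker π).subtype.lTensor N ∘ₗ π'.lTensor N := by
      rw [← LinearMap.lTensor_comp]; rfl
    constructor
    · intro hi y
      rw [← hex' y, hc, LinearMap.comp_apply, map_eq_zero_iff _ hi]
    · intro he
      rw [injective_iff_map_eq_zero]
      intro y hy
      obtain ⟨x, rfl⟩ := hs y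
      rw [hex' x, ← he x, hc]
      exact hy
  | succ i ih =>
    have hex : Function.Exact (LinearMap.ker π).subtype π := LinearMap.exact_subtype_ker_map π
    rw [subsingleton_ext_shift_iff hex (LinearMap.ker π).injective_subtype hπ]
    let π' : C 1 →ₗ[R] LinearMap.ker π := (d 0).codRestrict _ h.apply_apply_eq_zero
    have hπ' : Function.Surjective π' := by
      rintro ⟨x, hx⟩
      obtain ⟨y, rfl⟩ := (h x).1 hx
      exact ⟨y, rfl⟩
    have h' : Function.Exact (d 1) π' := by
      intro y
      rw [← hd 0 y, Subtype.ext_iff]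
      rfl
    exact ih (fun i => C (i + 1)) (fun i => d (i + 1)) (fun i => hd (i + 1)) h' hπ'

end CharacterModule
end

section
open CategoryTheory.Abelian TensorProduct
variable {R : Type u} [CommRing R]

lemma FamilyQuotient.map_zero [IsNoetherianRing R] (I : Type u) {M N : Type u} [AddCommGroup M]
    [Module R M] [AddCommGroup N] [Module R N] : map I (0 : M →ₗ[R] N) = 0 := by
  simpa using map_add (I := I) (0 : M →ₗ[R] N) 0

lemma ModuleCat.finite_iff_of_iso {X Y : ModuleCat.{u} R} (e : X ≅ Y) :
    Module.Finite R X ↔ Module.Finite R Y :=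
  Module.Finite.equiv_iff e.toLinearEquiv

lemma ModuleCat.finite_homology_iff [IsNoetherianRing R] (S : ShortComplex (ModuleCat.{u} R)) :
    Module.Finite R S.homology ↔ ∃ L : Submodule R S.X₂, L.FG ∧
      LinearMap.ker S.g.hom ≤ LinearMap.range S.f.hom ⊔ L := by
  rw [finite_iff_of_iso S.moduleCatHomologyIso]
  change Module.Finite R (LinearMap.ker S.g.hom ⧸ LinearMap.range S.moduleCatToCycles) ↔ _
  constructor
  · intro h
    obtain ⟨L, hL, hl⟩ := FamilyQuotient.exists_fg_lift
      (LinearMap.range S.moduleCatToCycles).mkQ h.1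
    refine ⟨L.map (LinearMap.ker S.g.hom).subtype, hL.map _, fun y hy => ?_⟩
    obtain ⟨l, hlL, hly⟩ := hl ⟨y, hy⟩ trivial
    rw [Submodule.mkQ_apply, Submodule.mkQ_apply, Submodule.Quotient.eq] at hly
    obtain ⟨x, hx⟩ := hly
    refine Submodule.mem_sup.2 ⟨S.f.hom (-x), ⟨_, rfl⟩, l, ⟨l, hlL, rfl⟩, ?_⟩
    have := congrArg Subtype.val hx
    change S.f.hom x = l - y at this
    rw [map_neg, this]
    abel
  · rintro ⟨L, hL, hle⟩
    have := Module.Finite.iff_fg.2 hL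
    let A := LinearMap.ker S.g.hom
    have hr : LinearMap.range S.f.hom ≤ A := by
      rintro _ ⟨x, rfl⟩
      exact S.moduleCat_zero_apply x
    let φ : ↥(A ⊓ L) →ₗ[R] (A ⧸ LinearMap.range S.moduleCatToCycles) :=
      (LinearMap.range S.moduleCatToCycles).mkQ ∘ₗ Submodule.inclusion inf_le_left
    have hfin : Module.Finite R ↥(A ⊓ L) :=
      Module.Finite.of_injective (Submodule.inclusion (inf_le_right : A ⊓ L ≤ L))
        (Submodule.inclusion_injective _)
    refine Module.Finite.of_surjective φ fun y => ?_
    obtain ⟨⟨y, hy⟩, rfl⟩ := Submodule.mkQ_surjective _ y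
    obtain ⟨_, ⟨x, rfl⟩, l, hl, hxl⟩ := Submodule.mem_sup.1 (hle hy)
    have hlA : l ∈ A := by
      have : l = y - S.f.hom x := by rw [← hxl]; abel
      rw [this]
      exact A.sub_mem hy (hr ⟨x, rfl⟩)
    refine ⟨⟨l, hlA, hl⟩, ?_⟩
    refine (Submodule.Quotient.eq _).2 ⟨-x, Subtype.ext ?_⟩
    change S.f.hom (-x) = l - y
    rw [← hxl, map_neg]
    abel

lemma ModuleCat.finite_homology_iff_forall_exact [IsNoetherianRing R]
    (S : ShortComplex (ModuleCat.{u} R)) :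
    Module.Finite R S.homology ↔ ∀ I : Type u, Function.Exact (FamilyQuotient.map I S.f.hom)
      (FamilyQuotient.map I S.g.hom) := by
  rw [finite_homology_iff]
  constructor
  · rintro ⟨L, hL, h⟩ I
    exact FamilyQuotient.map_exact_of_fg I (by
      rw [← ModuleCat.hom_comp, S.zero]; rfl) hL h
  · intro h
    exact FamilyQuotient.exists_fg_of_map_exact h

lemma ModuleCat.finite_tor_iff [IsNoetherianRing R] (N M : Type u) [AddCommGroup N] [Module R N]
    [Module.Finite R N] [AddCommGroup M] [Module R M] (i : ℕ) :
    Module.Finite R (((Tor (ModuleCat.{u} R) i).obj (of R N)).obj (of R M)) ↔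
      ∀ I : Type u, Subsingleton (Abelian.Ext (of R N)
        (of R (CharacterModule (FamilyQuotient R I M))) i) := by
  let P := CategoryTheory.projectiveResolution (of R M)
  let F := (MonoidalCategory.tensoringLeft (ModuleCat.{u} R)).obj (of R N)
  have hP (j) : Module.Projective R (P.complex.X j) :=
    (IsProjective.iff_projective _).2 (P.projective j)
  let C (I : Type u) (j : ℕ) : Type u := FamilyQuotient R I (P.complex.X j)
  let d (I : Type u) (j : ℕ) : C I (j + 1) →ₗ[R] C I j := FamilyQuotient.map I
      (P.complex.d (j + 1) j).hom
  let π : P.complex.X 0 →ₗ[R] M := (P.π.f 0).hom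
  have hd (I j) : Function.Exact (d I (j + 1)) (d I j) :=
    FamilyQuotient.map_exact (((ShortComplex.ShortExact.moduleCat_exact_iff_function_exact _).1
        (P.exact_succ j)))
  have hdπ (I) : Function.Exact (d I 0) (FamilyQuotient.map I π) :=
    FamilyQuotient.map_exact (((ShortComplex.ShortExact.moduleCat_exact_iff_function_exact _).1
        P.exact₀))
  have hπ (I) : Function.Surjective (FamilyQuotient.map I π) :=
    FamilyQuotient.map_surjective ((ModuleCat.epi_iff_surjective _).1 inferInstance)
  have e : ((Tor (ModuleCat.{u} R) i).obj (of R N)).obj (of R M) ≅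
    ((F.mapHomologicalComplex _).obj P.complex).homology i := P.isoLeftDerivedObj F i
  rw [finite_iff_of_iso e]
  match i with
  | 0 =>
    rw [finite_iff_of_iso (HomologicalComplex.homologyIsoSc' _ 1 0 0 (by simp) (by simp)),
      finite_homology_iff_forall_exact]
    refine forall_congr' fun I => ?_
    rw [CharacterModule.subsingleton_ext_zero_iff_surjective (hdπ I) (hπ I),
      FamilyQuotient.lTensor_surjective_iff]
    have h0 : (((F.mapHomologicalComplex _).obj P.complex).sc' 1 0 0).g = 0 :=
      ((F.mapHomologicalComplex _).obj P.complex).shape 0 0 (by simp)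
    have h1 : FamilyQuotient.map I (((F.mapHomologicalComplex _).obj P.complex).sc' 1 0 0).g.hom =
        0 := by
      rw [h0, hom_zero, FamilyQuotient.map_zero]
    rw [h1, LinearMap.exact_zero_iff_surjective]
    rfl
  | i + 1 =>
    rw [finite_iff_of_iso (HomologicalComplex.homologyIsoSc' _ (i + 2) (i + 1) i (by simp)
        (by simp)),
      finite_homology_iff_forall_exact]
    refine forall_congr' fun I => ?_
    rw [CharacterModule.subsingleton_ext_succ_iff_exact i (C I) (d I) (hd I) (hdπ I) (hπ I),
      FamilyQuotient.lTensor_exact_iff]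
    rfl
end

section
open CategoryTheory.Abelian

namespace CategoryTheory.ProjectiveResolution
variable {C : Type u} [Category.{v} C] [Abelian C] [HasExt.{w} C]
  {X Y : C} (P : ProjectiveResolution X)

lemma extMk_eq_zero_iff_of_zero (f : P.complex.X 0 ⟶ Y) (hf : P.complex.d 1 0 ≫ f = 0) :
    P.extMk f 1 rfl hf = 0 ↔ f = 0 := by
  constructor
  · intro h
    rw [← P.extEquivCohomologyClass.apply_eq_iff_eq, extEquivCohomologyClass_extMk,
      extEquivCohomologyClass_zero, CochainComplex.HomComplex.CohomologyClass.mk_eq_zero_iff,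
      CochainComplex.HomComplex.Cocycle.toSingleMk_mem_coboundaries_iff _ _ _ _ _ 1 (by simp)] at h
    obtain ⟨g, hg⟩ := h
    have h0 : Limits.IsZero (P.cochainComplex.X 1) :=
      P.cochainComplex.isZero_of_isStrictlyLE 0 1 (by simp)
    rw [h0.eq_of_src g 0, Limits.comp_zero, eq_comm, Preadditive.IsIso.comp_left_eq_zero] at hg
    exact hg
  · rintro rfl
    exact P.extMk_zero 1 rfl

variable (R : Type*) [CommRing R] [Linear R C]

lemma smul_extMk (r : R) {n : ℕ} (f : P.complex.X n ⟶ Y) (m : ℕ) (hm : n + 1 = m)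
    (hf : P.complex.d m n ≫ f = 0) :
    r • P.extMk f m hm hf = P.extMk (r • f) m hm (by rw [Linear.comp_smul, hf, smul_zero]) := by
  rw [Ext.smul_eq_comp_mk₀, extMk_comp_mk₀]
  congr 1
  rw [Linear.comp_smul, Category.comp_id]

/-- The linear map sending a cocycle to its class. -/
noncomputable def extMkLinear (Y : C) (n : ℕ) :
    LinearMap.ker (Linear.leftComp R Y (P.complex.d (n + 1) n)) →ₗ[R] Abelian.Ext X Y n where
  toFun f := P.extMk f.1 (n + 1) rfl f.2
  map_add' _ _ := (P.add_extMk _ _ _ _ _ _).symm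
  map_smul' _ _ := (P.smul_extMk R _ _ _ _ _).symm

lemma extMkLinear_surjective (n : ℕ) : Function.Surjective (P.extMkLinear R Y n) := fun α => by
  obtain ⟨f, hf, rfl⟩ := P.extMk_surjective α (n + 1) rfl
  exact ⟨⟨f, hf⟩, rfl⟩

end CategoryTheory.ProjectiveResolution

variable {R : Type u} [CommRing R]

lemma ModuleCat.finite_homology_iff_of_surjective (S : ShortComplex (ModuleCat.{u} R))
    {E : Type u} [AddCommGroup E] [Module R E] (φ : LinearMap.ker S.g.hom →ₗ[R] E)
    (hφ : Function.Surjective φ) (h : ∀ x, φ x = 0 ↔ ∃ y, S.f y = x.1) :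
    Module.Finite R S.homology ↔ Module.Finite R E := by
  rw [finite_iff_of_iso S.moduleCatHomologyIso]
  refine Module.Finite.equiv_iff ((Submodule.quotEquivOfEq _ _ ?_).trans
    (φ.quotKerEquivOfSurjective hφ))
  ext x
  refine Iff.trans ?_ (h x).symm
  exact ⟨fun ⟨y, hy⟩ => ⟨y, congrArg Subtype.val hy⟩, fun ⟨y, hy⟩ => ⟨y, Subtype.ext hy⟩⟩

lemma ModuleCat.finite_ext_iff_finite_abelianExt (X Y : ModuleCat.{u} R) (i : ℕ) :
    Module.Finite R (((Ext R (ModuleCat.{u} R) i).obj (Opposite.op X)).obj Y) ↔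
      Module.Finite R (Abelian.Ext X Y i) := by
  let P := CategoryTheory.projectiveResolution X
  rw [finite_iff_of_iso (P.isoExt i Y)]
  match i with
  | 0 =>
    rw [finite_iff_of_iso (HomologicalComplex.homologyIsoSc' _ 0 0 1 (by simp) (by simp))]
    refine finite_homology_iff_of_surjective _ (P.extMkLinear R Y 0)
      (P.extMkLinear_surjective R 0) fun x => ?_
    refine (P.extMk_eq_zero_iff_of_zero x.1 x.2).trans ?_
    have h0 : ((P.complex.linearYonedaObj R Y).sc' 0 0 1).f = 0 :=
      (P.complex.linearYonedaObj R Y).shape 0 0 (by simp)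
    rw [h0]
    exact ⟨fun h => ⟨0, h.symm⟩, fun ⟨y, hy⟩ => hy.symm⟩
  | i + 1 =>
    rw [finite_iff_of_iso (HomologicalComplex.homologyIsoSc' _ i (i + 1) (i + 2) (by simp)
      (by simp))]
    refine finite_homology_iff_of_surjective _ (P.extMkLinear R Y (i + 1))
      (P.extMkLinear_surjective R (i + 1)) fun x => ?_
    exact P.extMk_eq_zero_iff x.1 _ rfl x.2 i rfl
end

section
open Opposite
variable {R : Type u} [CommRing R]

/-- A class in the homology of a complex in `(ModuleCat R)ᵒᵖ` is represented by a cocycle. -/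
def HomologicalComplex.Represents (K : ChainComplex (ModuleCat.{u} R)ᵒᵖ ℕ) (n : ℕ)
    (s : (K.homology n).unop) (z : (K.X n).unop) : Prop :=
  ∃ u : (K.opcycles n).unop, (K.homologyι n).unop u = s ∧ (K.pOpcycles n).unop u = z

namespace HomologicalComplex
variable (K : ChainComplex (ModuleCat.{u} R)ᵒᵖ ℕ)

lemma exists_represents {n : ℕ} (s : (K.homology n).unop) : ∃ z, K.Represents n s z := by
  obtain ⟨u, hu⟩ := (ModuleCat.epi_iff_surjective (K.homologyι n).unop).1 inferInstance s
  exact ⟨_, u, hu, rfl⟩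

lemma Represents.d_eq_zero {n : ℕ} {s : (K.homology n).unop} {z : (K.X n).unop}
    (h : K.Represents n s z) : (K.d (n + 1) n).unop z = 0 := by
  obtain ⟨u, -, rfl⟩ := h
  rw [← ModuleCat.comp_apply, ← unop_comp, K.d_pOpcycles]
  rfl

lemma exists_of_d_eq_zero {n : ℕ} (z : (K.X n).unop) (hz : (K.d (n + 1) n).unop z = 0) :
    ∃ s, K.Represents n s z := by
  have hS := ShortComplex.exact_of_g_is_cokernel (ShortComplex.mk _ _ (K.d_pOpcycles (n + 1) n))
    (K.opcyclesIsCokernel (n + 1) n (by simp))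
  obtain ⟨u, hu⟩ := ((ShortComplex.ShortExact.moduleCat_exact_iff_function_exact _).1 hS.unop z).1
      hz
  exact ⟨_, u, rfl, hu⟩

lemma Represents.map {K K' : ChainComplex (ModuleCat.{u} R)ᵒᵖ ℕ} (ψ : K' ⟶ K) {n : ℕ}
    {s : (K.homology n).unop} {z : (K.X n).unop} (h : K.Represents n s z) :
    K'.Represents n ((homologyMap ψ n).unop s) ((ψ.f n).unop z) := by
  obtain ⟨u, rfl, rfl⟩ := h
  refine ⟨(opcyclesMap ψ n).unop u, ?_, ?_⟩
  · rw [← ModuleCat.comp_apply, ← ModuleCat.comp_apply, ← unop_comp, ← unop_comp,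
      homologyι_naturality]
  · rw [← ModuleCat.comp_apply, ← ModuleCat.comp_apply, ← unop_comp, ← unop_comp,
      p_opcyclesMap]

lemma Represents.eq_zero_iff {n : ℕ} {s : (K.homology (n + 1)).unop} {z : (K.X (n + 1)).unop}
    (h : K.Represents (n + 1) s z) : s = 0 ↔ ∃ w, (K.d (n + 1) n).unop w = z := by
  obtain ⟨u, rfl, rfl⟩ := h
  have hS := ShortComplex.exact_of_f_is_kernel
    (ShortComplex.mk _ _ (K.homologyι_comp_fromOpcycles (n + 1) n))
    (K.homologyIsKernel (n + 1) n (by simp))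
  refine ((ShortComplex.ShortExact.moduleCat_exact_iff_function_exact _).1 hS.unop u).trans
    (exists_congr fun w => ?_)
  have hinj := (ModuleCat.mono_iff_injective (K.pOpcycles (n + 1)).unop).1 inferInstance
  rw [← K.p_fromOpcycles (n + 1) n]
  exact (hinj.eq_iff (a := (K.fromOpcycles (n + 1) n).unop w) (b := u)).symm

end HomologicalComplex

namespace CategoryTheory
variable {X : ModuleCat.{u} R} (P : ProjectiveResolution X) (Y : ModuleCat.{u} R)

/-- A class in the derived functor `Ext` is represented by a cocycle on a projective resolution. -/
def ProjectiveResolution.ExtRepresents (n : ℕ)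
    (t : ((Ext R (ModuleCat.{u} R) n).obj (op X)).obj Y) (z : P.complex.X n ⟶ Y) : Prop :=
  HomologicalComplex.Represents
    (((((linearYoneda R (ModuleCat.{u} R)).obj Y).rightOp).mapHomologicalComplex _).obj P.complex) n
    ((P.isoLeftDerivedObj ((linearYoneda R (ModuleCat.{u} R)).obj Y).rightOp n).inv.unop t) z

namespace ProjectiveResolution
variable {P Y}

lemma exists_extRepresents {n : ℕ} (t : ((Ext R (ModuleCat.{u} R) n).obj (op X)).obj Y) :
    ∃ z, P.complex.d (n + 1) n ≫ z = 0 ∧ P.ExtRepresents Y n t z := by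
  obtain ⟨z, hz⟩ := HomologicalComplex.exists_represents
    (((((linearYoneda R (ModuleCat.{u} R)).obj Y).rightOp).mapHomologicalComplex _).obj P.complex)
    ((P.isoLeftDerivedObj ((linearYoneda R (ModuleCat.{u} R)).obj Y).rightOp n).inv.unop t)
  exact ⟨z, hz.d_eq_zero, hz⟩

lemma exists_of_comp_eq_zero {n : ℕ} (z : P.complex.X n ⟶ Y) (hz : P.complex.d (n + 1) n ≫ z = 0) :
    ∃ t, P.ExtRepresents Y n t z := by
  obtain ⟨s, hs⟩ := HomologicalComplex.exists_of_d_eq_zero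
    (((((linearYoneda R (ModuleCat.{u} R)).obj Y).rightOp).mapHomologicalComplex _).obj P.complex)
    z hz
  refine ⟨(P.isoLeftDerivedObj ((linearYoneda R (ModuleCat.{u} R)).obj Y).rightOp n).hom.unop s, ?_⟩
  have e := congrArg Quiver.Hom.unop
    (P.isoLeftDerivedObj ((linearYoneda R (ModuleCat.{u} R)).obj Y).rightOp n).inv_hom_id
  have e' : _ = s := congrArg (fun g => ModuleCat.Hom.hom g s) e
  exact (congrArg (fun s => HomologicalComplex.Represents _ n s z) e').mpr hs

lemma ExtRepresents.map {X' : ModuleCat.{u} R} (P' : ProjectiveResolution X') (f : X' ⟶ X)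
    (φ : Hom P' P f) {n : ℕ}
    {t : ((Ext R (ModuleCat.{u} R) n).obj (op X)).obj Y} {z : P.complex.X n ⟶ Y}
    (h : P.ExtRepresents Y n t z) :
    P'.ExtRepresents Y n (((Ext R (ModuleCat.{u} R) n).map f.op).app Y t) (φ.hom.f n ≫ z) := by
  let F := ((linearYoneda R (ModuleCat.{u} R)).obj Y).rightOp
  have := HomologicalComplex.Represents.map ((F.mapHomologicalComplex _).map φ.hom) h
  have e := isoLeftDerivedObj_hom_naturality f P' P φ.hom
      (by simpa using φ.hom_f_zero_comp_π_f_zero) F n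
  have e' := (Iso.inv_comp_eq _).2 ((Iso.eq_comp_inv _).2 e |>.trans (Category.assoc _ _ _))
  have e'' := congrArg (fun g => ModuleCat.Hom.hom (Quiver.Hom.unop g) t) e'
  exact (congrArg (fun s => HomologicalComplex.Represents
    ((F.mapHomologicalComplex _).obj P'.complex) n s (φ.hom.f n ≫ z : P'.complex.X n ⟶ Y))
        e'').mpr this

lemma ExtRepresents.eq_zero_iff {n : ℕ}
    {t : ((Ext R (ModuleCat.{u} R) (n + 1)).obj (op X)).obj Y} {z : P.complex.X (n + 1) ⟶ Y}
    (h : P.ExtRepresents Y (n + 1) t z) : t = 0 ↔ ∃ w, P.complex.d (n + 1) n ≫ w = z := by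
  refine Iff.trans ?_ (HomologicalComplex.Represents.eq_zero_iff _ h)
  have hinj := (ModuleCat.mono_iff_injective (P.isoLeftDerivedObj
    ((linearYoneda R (ModuleCat.{u} R)).obj Y).rightOp (n + 1)).inv.unop).1 inferInstance
  exact (map_eq_zero_iff (ModuleCat.Hom.hom _) hinj).symm

lemma ExtRepresents.map_eq_zero_iff {n : ℕ} {X' : ModuleCat.{u} R} (f : X' ⟶ X)
    {t : ((Ext R (ModuleCat.{u} R) (n + 1)).obj (op X)).obj Y} {z : P.complex.X (n + 1) ⟶ Y}
    (hz : P.complex.d (n + 2) (n + 1) ≫ z = 0) (h : P.ExtRepresents Y (n + 1) t z) :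
    ((Ext R (ModuleCat.{u} R) (n + 1)).map f.op).app Y t = 0 ↔
      (Abelian.Ext.mk₀ f).comp (P.extMk z (n + 2) rfl hz) (zero_add _) = 0 := by
  let P' := projectiveResolution X'
  let φ : Hom P' P f := ⟨lift f P' P, by simpa using lift_commutes_zero f P' P⟩
  rw [mk₀_comp_extMk z _ rfl hz φ, extMk_eq_zero_iff _ _ _ _ _ n rfl]
  exact (h.map P' f φ).eq_zero_iff

end ProjectiveResolution

lemma exists_abelianExt_of_ext {n : ℕ} (t : ((Ext R (ModuleCat.{u} R) (n + 1)).obj (op X)).obj Y) :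
    ∃ ξ : Abelian.Ext X Y (n + 1), ∀ (X' : ModuleCat.{u} R) (f : X' ⟶ X),
      ((Ext R (ModuleCat.{u} R) (n + 1)).map f.op).app Y t = 0 ↔
        (Abelian.Ext.mk₀ f).comp ξ (zero_add _) = 0 := by
  obtain ⟨z, hz, h⟩ := ProjectiveResolution.exists_extRepresents (P := projectiveResolution X) t
  exact ⟨_, fun X' f => h.map_eq_zero_iff f hz⟩

lemma exists_ext_of_abelianExt {n : ℕ} (ξ : Abelian.Ext X Y (n + 1)) :
    ∃ t : ((Ext R (ModuleCat.{u} R) (n + 1)).obj (op X)).obj Y,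
      ∀ (X' : ModuleCat.{u} R) (f : X' ⟶ X),
      ((Ext R (ModuleCat.{u} R) (n + 1)).map f.op).app Y t = 0 ↔
        (Abelian.Ext.mk₀ f).comp ξ (zero_add _) = 0 := by
  obtain ⟨z, hz, rfl⟩ := (projectiveResolution X).extMk_surjective ξ _ rfl
  obtain ⟨t, h⟩ := ProjectiveResolution.exists_of_comp_eq_zero z hz
  exact ⟨t, fun X' f => h.map_eq_zero_iff f hz⟩

end CategoryTheory
end

section
open CategoryTheory.Abelian
variable {R : Type u} [CommRing R] [IsNoetherianRing R]

lemma Module.finite_iff_forall_subsingleton_familyQuotient (M : Type u) [AddCommGroup M]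
    [Module R M] : Module.Finite R M ↔ ∀ I : Type u, Subsingleton (FamilyQuotient R I M) :=
  ⟨fun _ _ => FamilyQuotient.subsingleton_of_finite, FamilyQuotient.finite_of_subsingleton⟩

namespace FamilyQuotient

lemma finite_iff_map_surjective {X Y Z : Type u} [AddCommGroup X] [Module R X] [AddCommGroup Y]
    [Module R Y] [AddCommGroup Z] [Module R Z] {f : X →ₗ[R] Y} {g : Y →ₗ[R] Z}
    (h : Function.Exact f g) (hg : Function.Surjective g) :
    Module.Finite R Z ↔ ∀ I : Type u, Function.Surjective (map I f) := by
  rw [Module.finite_iff_forall_subsingleton_familyQuotient]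
  refine forall_congr' fun I => ?_
  have hex := map_exact (I := I) h
  have hs := map_surjective (I := I) hg
  constructor
  · intro _ x
    exact (hex x).1 (Subsingleton.elim _ _)
  · intro hd
    refine subsingleton_of_forall_eq 0 fun y => ?_
    obtain ⟨x, rfl⟩ := hs y
    exact (hex x).2 (hd x)

lemma map_lcomp_surjective_iff {N P M : Type u} [AddCommGroup N] [Module R N] [AddCommGroup P]
    [Module R P] [AddCommGroup M] [Module R M] [Module.Finite R N] [Module.Finite R P]
    (f : N →ₗ[R] P) (I : Type u) :
    Function.Surjective (map I (LinearMap.lcomp R M f)) ↔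
      ∀ φ : N →ₗ[R] FamilyQuotient R I M, ∃ ψ : P →ₗ[R] FamilyQuotient R I M, ψ ∘ₗ f = φ := by
  constructor
  · intro h φ
    obtain ⟨x, rfl⟩ := homComparison_bijective.2 φ
    obtain ⟨y, rfl⟩ := h x
    exact ⟨_, (homComparison_naturality f y).symm⟩
  · intro h x
    obtain ⟨ψ, hψ⟩ := h (homComparison R I M N x)
    obtain ⟨y, rfl⟩ := homComparison_bijective.2 ψ
    refine ⟨y, homComparison_bijective.1 ?_⟩
    rw [homComparison_naturality, hψ]

end FamilyQuotient

lemma ModuleCat.finite_abelianExt_iff (N M : Type u) [AddCommGroup N] [Module R N]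
    [Module.Finite R N] [AddCommGroup M] [Module R M] (i : ℕ) :
    Module.Finite R (Abelian.Ext (of R N) (of R M) i) ↔
      ∀ I : Type u, Subsingleton (Abelian.Ext (of R N) (of R (FamilyQuotient R I M)) i) := by
  induction i using Nat.strong_induction_on generalizing N with
  | _ i ih =>
    obtain ⟨n, p, hp⟩ : ∃ (n : ℕ) (p : (ULift.{u} (Fin n) → R) →ₗ[R] N), Function.Surjective p := by
      obtain ⟨n, p, hp⟩ := Module.Finite.exists_fin' R N
      exact ⟨n, p ∘ₗ (LinearEquiv.funCongrLeft R R Equiv.ulift.symm).toLinearMap,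
        hp.comp (LinearEquiv.surjective _)⟩
    have hS := LinearMap.shortExact_shortComplexKer hp
    have hproj : Projective (of R (ULift.{u} (Fin n) → R)) := inferInstance
    match i with
    | 0 =>
      rw [Module.Finite.equiv_iff ((Ext.linearEquiv₀ (R := R)).trans ModuleCat.homLinearEquiv),
        Module.finite_iff_forall_subsingleton_familyQuotient]
      refine forall_congr' fun I => ?_
      rw [ModuleCat.subsingleton_ext_zero_iff]
      exact (Equiv.ofBijective _ FamilyQuotient.homComparison_bijective).subsingleton_congr
    | 1 =>
      let δ : (LinearMap.ker p →ₗ[R] M) →ₗ[R] Abelian.Ext (of R N) (of R M) 1 :=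
        hS.extClass.precompOfLinear R (of R M) (add_comm 1 0) ∘ₗ
          ((Ext.linearEquiv₀ (R := R)).trans ModuleCat.homLinearEquiv).symm.toLinearMap
      have hδ : Function.Surjective δ :=
        (precomp_extClass_surjective_of_projective_X₂ (of R M) hS 0).comp (LinearEquiv.surjective _)
      have hex : Function.Exact (LinearMap.lcomp R M (LinearMap.ker p).subtype) δ := by
        intro φ
        constructor
        · intro h
          obtain ⟨β, hβ⟩ := Ext.contravariant_sequence_exact₁ hS (of R M)
            (Ext.mk₀ (ofHom φ)) (add_comm 1 0) h
          obtain ⟨ψ, rfl⟩ := (Ext.mk₀_bijective _ _).2 β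
          refine ⟨ψ.hom, ?_⟩
          rw [Ext.mk₀_comp_mk₀] at hβ
          exact congrArg Hom.hom ((Ext.mk₀_bijective _ _).1 hβ)
        · rintro ⟨ψ, rfl⟩
          have e : (Ext.mk₀ (ofHom (LinearMap.lcomp R M (LinearMap.ker p).subtype ψ))) =
              (Ext.mk₀ p.shortComplexKer.f).comp (Ext.mk₀ (ofHom ψ)) (zero_add 0) := by
            rw [Ext.mk₀_comp_mk₀]; rfl
          change hS.extClass.comp (Ext.mk₀ (ofHom
              (LinearMap.lcomp R M (LinearMap.ker p).subtype ψ)))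
            (add_comm 1 0) = 0
          rw [e]
          exact hS.extClass_comp_assoc _
      rw [FamilyQuotient.finite_iff_map_surjective hex hδ]
      refine forall_congr' fun I => ?_
      rw [FamilyQuotient.map_lcomp_surjective_iff]
      refine Iff.symm ((hS.subsingleton_ext_one_contravariant _
        (Ext.subsingleton_of_projective _ _ 0)).trans ?_)
      refine ModuleCat.forall_hom_iff.trans (forall_congr' fun φ => ?_)
      refine ModuleCat.exists_hom_iff.trans (exists_congr fun ψ => ?_)
      exact ⟨fun h => congrArg ModuleCat.Hom.hom h, fun h => congrArg ModuleCat.ofHom h⟩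
    | i + 2 =>
      let δ := hS.extClass.precompOfLinear R (of R M) (add_comm 1 (i + 1))
      have hδ : Function.Bijective δ := by
        refine ⟨(injective_iff_map_eq_zero δ).2 fun x hx => ?_,
          precomp_extClass_surjective_of_projective_X₂ (of R M) hS (i + 1)⟩
        obtain ⟨β, rfl⟩ := Ext.contravariant_sequence_exact₁ hS (of R M) x (add_comm 1 (i + 1)) hx
        rw [Ext.eq_zero_of_projective β, Ext.comp_zero]
      rw [← Module.Finite.equiv_iff (LinearEquiv.ofBijective δ hδ)]
      refine (ih (i + 1) (by omega) (LinearMap.ker p)).trans (forall_congr' fun I => ?_)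
      exact (hS.subsingleton_ext_shift_contravariant _ i (Ext.subsingleton_of_projective _ _ i)
        (Ext.subsingleton_of_projective _ _ (i + 1))).symm
end

section
open CategoryTheory.Abelian
variable {R : Type u} [CommRing R]

/-- Finitely generated modules annihilated by a power of the ideal `b`. -/
def ModuleCat.IsFiniteTorsion (b : Ideal R) (N : ModuleCat.{u} R) : Prop :=
  Module.Finite R N ∧ ∃ s : ℕ, ∀ r ∈ b ^ s, ∀ x : N, r • x = 0

/-- Every class of degree `i` on a finitely generated `b`-power torsion module with values in `X`
dies on some finitely generated `b`-power torsion cover. -/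
def ModuleCat.ExtEffaceable (b : Ideal R) (X : ModuleCat.{u} R) (i : ℕ) : Prop :=
  ∀ N : ModuleCat.{u} R, N.IsFiniteTorsion b → ∀ ξ : Abelian.Ext N X i,
    ∃ (N' : ModuleCat.{u} R) (p : N' ⟶ N), N'.IsFiniteTorsion b ∧
      Function.Surjective p.hom ∧ (Ext.mk₀ p).comp ξ (zero_add i) = 0

lemma LinearMap.exists_comp_rangeRestrict_eq {A B C : Type*} [AddCommGroup A] [Module R A]
    [AddCommGroup B] [Module R B] [AddCommGroup C] [Module R C] (f : A →ₗ[R] B) (g : A →ₗ[R] C)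
    (h : LinearMap.ker f ≤ LinearMap.ker g) :
    ∃ k : LinearMap.range f →ₗ[R] C, ∀ x, k (f.rangeRestrict x) = g x := by
  refine ⟨(LinearMap.ker f).liftQ g h ∘ₗ f.quotKerEquivRange.symm.toLinearMap, fun x => ?_⟩
  have : f.quotKerEquivRange.symm (f.rangeRestrict x) = (LinearMap.ker f).mkQ x := by
    rw [LinearEquiv.symm_apply_eq]
    rfl
  simp [this]

namespace ModuleCat

lemma IsFiniteTorsion.of_le {b c : Ideal R} (h : b ≤ c) {N : ModuleCat.{u} R}
    (hN : N.IsFiniteTorsion c) : N.IsFiniteTorsion b :=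
  ⟨hN.1, hN.2.imp fun s hs r hr => hs r (Ideal.pow_right_mono h s hr)⟩

lemma IsFiniteTorsion.of_injective [IsNoetherianRing R] {b : Ideal R} {M N : ModuleCat.{u} R}
    (hN : N.IsFiniteTorsion b) (f : M ⟶ N) (hf : Function.Injective f.hom) :
    M.IsFiniteTorsion b := by
  have := hN.1
  refine ⟨Module.Finite.of_injective f.hom hf, hN.2.imp fun s hs r hr x => hf ?_⟩
  rw [map_smul, hs r hr, map_zero]

lemma IsFiniteTorsion.prod {b : Ideal R} {M N : Type u} [AddCommGroup M] [Module R M]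
    [AddCommGroup N] [Module R N] (hM : (of R M).IsFiniteTorsion b)
    (hN : (of R N).IsFiniteTorsion b) : (of R (M × N)).IsFiniteTorsion b := by
  have : Module.Finite R M := hM.1
  have : Module.Finite R N := hN.1
  obtain ⟨-, s, hs⟩ := hM
  obtain ⟨-, t, ht⟩ := hN
  refine ⟨Module.Finite.prod, max s t, fun r hr x => Prod.ext ?_ ?_⟩
  · exact hs r (Ideal.pow_le_pow_right (le_max_left _ _) hr) x.1
  · exact ht r (Ideal.pow_le_pow_right (le_max_right _ _) hr) x.2

lemma extEffaceable_bot (X : ModuleCat.{u} R) (i : ℕ) : ExtEffaceable (⊥ : Ideal R) X (i + 1) := by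
  intro N hN ξ
  have := hN.1
  obtain ⟨n, p, hp⟩ := Module.Finite.exists_fin' R N
  let F := ULift.{u} (Fin n) → R
  refine ⟨of R F, ofHom (p ∘ₗ (LinearEquiv.funCongrLeft R R Equiv.ulift.symm).toLinearMap),
    ⟨inferInstanceAs (Module.Finite R F), 1, fun r hr x => ?_⟩,
    hp.comp (LinearEquiv.surjective _), ?_⟩
  · rw [pow_one, Ideal.mem_bot] at hr
    rw [hr, zero_smul]
  · have : Projective (of R F) := inferInstance
    exact Ext.eq_zero_of_projective _

/-- The short complex `U ⟶ L ⟶ L / U`. -/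
abbrev quotientComplex {L : Type u} [AddCommGroup L] [Module R L] (U : Submodule R L) :
    ShortComplex (ModuleCat.{u} R) :=
  shortComplexOfCompEqZero U.subtype U.mkQ (LinearMap.ext fun y =>
      (Submodule.Quotient.mk_eq_zero U).2 y.2)

lemma quotientComplex_shortExact {L : Type u} [AddCommGroup L] [Module R L] (U : Submodule R L) :
    (quotientComplex U).ShortExact :=
  shortComplex_shortExact _ (LinearMap.exact_subtype_mkQ U) U.injective_subtype U.mkQ_surjective

lemma ExtEffaceable.sup_span_singleton [IsNoetherianRing R] {b : Ideal R} {i : ℕ}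
    {X : ModuleCat.{u} R} (h : ExtEffaceable b X i) (h' : ExtEffaceable b X (i + 1)) (x : R) :
    ExtEffaceable (b ⊔ Ideal.span {x}) X (i + 1) := by
  intro N hN ξ
  obtain ⟨L, p, hL, hp, hpξ⟩ := h' N (hN.of_le le_sup_left) ξ
  obtain ⟨k, hk⟩ : ∃ k : ℕ, ∀ y : N, x ^ k • y = 0 := by
    obtain ⟨s, hs⟩ := hN.2
    exact ⟨s, hs _ (Ideal.pow_mem_pow (Ideal.mem_sup_right (Ideal.mem_span_singleton_self x)) s)⟩
  let U : Submodule R L := LinearMap.range (LinearMap.lsmul R L (x ^ k))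
  have hSU := quotientComplex_shortExact U
  have hUle : U ≤ LinearMap.ker p.hom := by
    rintro _ ⟨y, rfl⟩
    change p.hom (x ^ k • y) = 0
    rw [map_smul, hk]
  let p' : (quotientComplex U).X₃ ⟶ N := ofHom (U.liftQ p.hom hUle)
  have hp' : (quotientComplex U).g ≫ p' = p := by ext y; rfl
  obtain ⟨ζ, hζ⟩ := Ext.contravariant_sequence_exact₃ hSU X
    ((Ext.mk₀ p').comp ξ (zero_add _)) (by
      rw [Ext.mk₀_comp_mk₀_assoc, hp', hpξ]) (add_comm 1 i)
  have hU : (of R U).IsFiniteTorsion b := hL.of_injective (ofHom U.subtype) U.injective_subtype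
  obtain ⟨V, q, hV, hq, hqζ⟩ := h _ hU ζ
  have hVN : IsNoetherian R V := by
    have := hV.1
    infer_instance
  obtain ⟨k₁, hk₁⟩ : ∃ k₁ : ℕ, ∀ v : V, ∀ n, x ^ n • v = 0 → x ^ k₁ • v = 0 := by
    obtain ⟨k₁, h₁⟩ := monotone_stabilizes_iff_noetherian.2 hVN
      ⟨fun n => LinearMap.ker (LinearMap.lsmul R V (x ^ n)), monotone_nat_of_le_succ fun n v hv =>
          by
        change x ^ (n + 1) • v = 0
        rw [pow_succ', mul_smul, show x ^ n • v = 0 from hv, smul_zero]⟩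
    refine ⟨k₁, fun v n hv => ?_⟩
    rcases le_total n k₁ with hn | hn
    · rw [← Nat.sub_add_cancel hn, pow_add, mul_smul, hv, smul_zero]
    · exact (h₁ n hn).symm.le (show v ∈ LinearMap.ker (LinearMap.lsmul R V (x ^ n)) from hv)
  let W : Submodule R (L × V) := LinearMap.ker
    (LinearMap.lsmul R L (x ^ k) ∘ₗ LinearMap.fst R L V -
      U.subtype ∘ₗ q.hom ∘ₗ LinearMap.snd R L V)
  have hW (w : W) : x ^ k • w.1.1 = (q.hom w.1.2 : U) := by
    have := w.2
    rw [LinearMap.mem_ker, LinearMap.sub_apply, sub_eq_zero] at this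
    exact this
  have hWt : (of R W).IsFiniteTorsion b :=
    IsFiniteTorsion.of_injective (hL.prod hV) (ofHom W.subtype) W.injective_subtype
  let π : W →ₗ[R] L := LinearMap.fst R L V ∘ₗ W.subtype
  let φ : W →ₗ[R] V := LinearMap.snd R L V ∘ₗ W.subtype
  have hπ : Function.Surjective π := by
    intro l
    obtain ⟨v, hv⟩ := hq ⟨x ^ k • l, l, rfl⟩
    refine ⟨⟨(l, v), ?_⟩, rfl⟩
    rw [LinearMap.mem_ker, LinearMap.sub_apply, sub_eq_zero]
    exact (congrArg Subtype.val hv).symm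
  let T : Submodule R W := LinearMap.range (LinearMap.lsmul R W (x ^ (k + k₁)))
  have hST := quotientComplex_shortExact T
  obtain ⟨κ, hκ⟩ := LinearMap.exists_comp_rangeRestrict_eq (LinearMap.lsmul R W (x ^ (k + k₁)))
    (x ^ k₁ • φ) (by
      intro w hw
      refine hk₁ (φ w) (k + k₁) ?_
      rw [← map_smul]
      exact (congrArg φ hw).trans (map_zero φ))
  have hTU : ∀ t : T, π t.1 = (q.hom (κ t) : U) := by
    rintro ⟨_, w, rfl⟩
    have := hκ w
    change κ ⟨_, w, rfl⟩ = _ at this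
    rw [this, LinearMap.smul_apply, map_smul, Submodule.coe_smul]
    erw [← hW w]
    change π (x ^ (k + k₁) • w) = _
    rw [map_smul, add_comm, pow_add, mul_smul]
    rfl
  let f : quotientComplex T ⟶ quotientComplex U :=
    { τ₁ := ofHom (q.hom ∘ₗ κ)
      τ₂ := ofHom π
      τ₃ := ofHom (T.mapQ U π fun t ht => by
        rw [Submodule.mem_comap, hTU ⟨t, ht⟩]
        exact Subtype.property _)
      comm₁₂ := by
        ext t
        exact (hTU t).symm
      comm₂₃ := by
        ext t
        rfl }
  have hf : Function.Surjective f.τ₃.hom := by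
    intro y
    obtain ⟨l, rfl⟩ := U.mkQ_surjective y
    obtain ⟨w, rfl⟩ := hπ l
    exact ⟨T.mkQ w, rfl⟩
  have hp'' : Function.Surjective p'.hom := fun n => by
    obtain ⟨l, rfl⟩ := hp n
    exact ⟨U.mkQ l, rfl⟩
  refine ⟨(quotientComplex T).X₃, f.τ₃ ≫ p', ⟨?_, ?_⟩, hp''.comp hf, ?_⟩
  · have : Module.Finite R W := hWt.1
    exact Module.Finite.of_surjective T.mkQ T.mkQ_surjective
  · obtain ⟨s, hs⟩ := hWt.2
    refine ⟨s + (k + k₁), fun r hr y => ?_⟩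
    obtain ⟨w, rfl⟩ := T.mkQ_surjective y
    rw [← map_smul, Submodule.mkQ_apply, Submodule.Quotient.mk_eq_zero]
    obtain ⟨r₁, h₁, r₂, h₂, rfl⟩ := Submodule.mem_sup.1 (Ideal.sup_pow_add_le_pow_sup_pow hr)
    rw [Ideal.span_singleton_pow, Ideal.mem_span_singleton'] at h₂
    obtain ⟨a, rfl⟩ := h₂
    have := hs r₁ h₁ w
    rw [add_smul]
    erw [this]
    rw [zero_add, mul_comm, mul_smul]
    exact ⟨a • w, rfl⟩
  · have h1 := ShortComplex.ShortExact.extClass_naturality hST hSU f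
    have h2 : (Ext.mk₀ f.τ₁).comp ζ (zero_add i) = 0 := by
      have : f.τ₁ = ofHom κ ≫ q := rfl
      rw [this, ← Ext.mk₀_comp_mk₀_assoc, hqζ, Ext.comp_zero]
    rw [← Ext.mk₀_comp_mk₀_assoc, ← hζ, ← Ext.comp_assoc (a₁₂ := 1) _ _ _ (by omega) (by omega)
        (by omega), ← h1,
      Ext.comp_assoc (a₂₃ := i) _ _ _ (by omega) (by omega) (by omega), h2, Ext.comp_zero]

end ModuleCat
end

section
open CategoryTheory.Abelian CategoryTheory.Limits Opposite
variable {R : Type u} [CommRing R]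

namespace ModuleCat

lemma subsingleton_pt_iff {J : Type} [SmallCategory J] [IsFiltered J]
    {F : J ⥤ ModuleCat.{u} R} {t : Cocone F} (ht : IsColimit t) :
    Subsingleton t.pt ↔ ∀ j (x : F.obj j), ∃ k, ∃ f : j ⟶ k, F.map f x = 0 := by
  have : PreservesFilteredColimitsOfSize.{0, 0} (forget (ModuleCat.{u} R)) :=
    preservesFilteredColimitsOfSize_shrink.{0, u, 0, u} _
  constructor
  · intro h j x
    obtain ⟨k, f, g, hfg⟩ := (Concrete.isColimit_rep_eq_iff_exists F ht x (0 : F.obj j)).1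
      (@Subsingleton.elim _ h _ _)
    exact ⟨k, f, hfg.trans (map_zero _)⟩
  · refine fun h => subsingleton_of_forall_eq 0 fun y => ?_
    obtain ⟨j, x, rfl⟩ := Concrete.isColimit_exists_rep F ht y
    obtain ⟨k, f, hf⟩ := h j x
    rw [← t.w f, ConcreteCategory.comp_apply, hf]
    exact map_zero _

/-- The projection `R / a ^ t' ⟶ R / a ^ t`. -/
abbrev powFactor (a : Ideal R) {t t' : ℕ} (h : t ≤ t') : of R (R ⧸ a ^ t') ⟶ of R (R ⧸ a ^ t) :=
  (localCohomology.ringModIdeals (localCohomology.idealPowersDiagram a)).map (homOfLE h).op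

lemma subsingleton_localCohomology_iff (a : Ideal R) (i : ℕ) (Y : ModuleCat.{u} R) :
    Subsingleton ((localCohomology a (i + 1)).obj Y) ↔
      ∀ (t : ℕ) (ξ : Abelian.Ext (of R (R ⧸ a ^ t)) Y (i + 1)), ∃ (t' : ℕ) (h : t ≤ t'),
        (Ext.mk₀ (powFactor a h)).comp ξ (zero_add _) = 0 := by
  have hc := isColimitOfPreserves ((evaluation (ModuleCat.{u} R) (ModuleCat.{u} R)).obj Y)
    (colimit.isColimit (localCohomology.diagram.{u, 0} (localCohomology.idealPowersDiagram a)
        (i + 1)))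
  refine (subsingleton_pt_iff hc).trans ⟨fun h t ξ => ?_, fun h t x => ?_⟩
  · obtain ⟨x, hx⟩ := exists_ext_of_abelianExt _ ξ
    obtain ⟨t', f, hf⟩ := h (op (op t)) x
    exact ⟨t'.unop.unop, leOfHom f.unop.unop, (hx _ _).1 hf⟩
  · obtain ⟨ξ, hξ⟩ := exists_abelianExt_of_ext Y x
    obtain ⟨t', ht, h0⟩ := h t.unop.unop ξ
    exact ⟨op (op t'), (homOfLE ht).op.op, (hξ _ _).2 h0⟩

end ModuleCat
end

section
open CategoryTheory.Abelian
variable {R : Type u} [CommRing R]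

namespace ModuleCat

lemma exists_forall_extEffaceable [IsNoetherianRing R] (a : Ideal R) :
    ∃ n, ∀ i, n ≤ i → ∀ X : ModuleCat.{u} R, ExtEffaceable a X i := by
  classical
  obtain ⟨s, rfl⟩ := IsNoetherian.noetherian a
  induction s using Finset.induction_on with
  | empty =>
    refine ⟨1, fun i hi X => ?_⟩
    obtain ⟨i, rfl⟩ := Nat.exists_eq_add_of_le' hi
    rw [Finset.coe_empty, Submodule.span_empty]
    exact extEffaceable_bot X i
  | insert x s _ ih =>
    obtain ⟨n, hn⟩ := ih
    refine ⟨n + 1, fun i hi X => ?_⟩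
    obtain ⟨i, rfl⟩ := Nat.exists_eq_add_of_le' (le_trans (Nat.le_add_left 1 n) hi)
    rw [Finset.coe_insert, Submodule.span_insert, sup_comm]
    exact (hn i (by omega) X).sup_span_singleton (hn (i + 1) (by omega) X) x

lemma isFiniteTorsion_quotient_pow (a : Ideal R) (t : ℕ) :
    (of R (R ⧸ a ^ t)).IsFiniteTorsion a := by
  refine ⟨inferInstanceAs (Module.Finite R (R ⧸ a ^ t)), t, fun r hr x => ?_⟩
  obtain ⟨x, rfl⟩ := (a ^ t).mkQ_surjective x
  rw [← map_smul, Submodule.mkQ_apply, Submodule.Quotient.mk_eq_zero]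
  exact Ideal.mul_mem_right _ _ hr

/-- The map `R / a ^ t ⟶ N` sending `1` to `y`. -/
def ofQuotientPow {a : Ideal R} {t : ℕ} {N : ModuleCat.{u} R}
    (h : ∀ r ∈ a ^ t, ∀ x : N, r • x = 0) (y : N) : of R (R ⧸ a ^ t) ⟶ N :=
  ofHom ((a ^ t).liftQ (LinearMap.toSpanSingleton R N y) fun r hr => h r hr y)

lemma extEffaceable_iff [IsNoetherianRing R] (a : Ideal R) (i : ℕ) (Y : ModuleCat.{u} R) :
    ExtEffaceable a Y i ↔
      ∀ (t : ℕ) (ξ : Abelian.Ext (of R (R ⧸ a ^ t)) Y i), ∃ (t' : ℕ) (h : t ≤ t'),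
        (Ext.mk₀ (powFactor a h)).comp ξ (zero_add _) = 0 := by
  classical
  constructor
  · intro h t ξ
    obtain ⟨N, p, hN, hp, hpξ⟩ := h _ (isFiniteTorsion_quotient_pow a t) ξ
    obtain ⟨-, s, hs⟩ := hN
    obtain ⟨y, hy⟩ := hp ((a ^ t).mkQ 1)
    have hs' : ∀ r ∈ a ^ max s t, ∀ x : N, r • x = 0 := fun r hr =>
      hs r (Ideal.pow_le_pow_right (le_max_left _ _) hr)
    refine ⟨max s t, le_max_right _ _, ?_⟩
    have : powFactor a (le_max_right s t) = ofQuotientPow hs' y ≫ p := by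
      refine hom_ext (LinearMap.ext fun x => ?_)
      obtain ⟨r, rfl⟩ := (a ^ max s t).mkQ_surjective x
      change (a ^ t).mkQ r = p.hom (r • y)
      rw [map_smul, hy, ← map_smul, smul_eq_mul, mul_one]
    rw [this, ← Ext.mk₀_comp_mk₀_assoc, hpξ, Ext.comp_zero]
  · intro h N hN ξ
    have := hN.1
    obtain ⟨-, s, hs⟩ := hN
    obtain ⟨m, p, hp⟩ := Module.Finite.exists_fin' R N
    let f (k : Fin m) : of R (R ⧸ a ^ s) ⟶ N := ofQuotientPow hs (p (Pi.single k 1))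
    choose t ht h0 using fun k => h s ((Ext.mk₀ (f k)).comp ξ (zero_add i))
    let π (k : Fin m) : of R ((k : Fin m) → R ⧸ a ^ t k) ⟶ of R (R ⧸ a ^ t k) :=
      ofHom (LinearMap.proj k)
    have hN' : ∀ k, ∀ r ∈ a ^ (Finset.univ.sup t), ∀ x : R ⧸ a ^ t k, r • x = 0 := by
      intro k r hr x
      obtain ⟨x, rfl⟩ := (a ^ t k).mkQ_surjective x
      rw [← map_smul, Submodule.mkQ_apply, Submodule.Quotient.mk_eq_zero]
      exact Ideal.mul_mem_right _ _
        (Ideal.pow_le_pow_right (Finset.le_sup (Finset.mem_univ k)) hr)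
    refine ⟨of R ((k : Fin m) → R ⧸ a ^ t k), ∑ k, π k ≫ powFactor a (ht k) ≫ f k,
      ⟨inferInstanceAs (Module.Finite R ((k : Fin m) → R ⧸ a ^ t k)), Finset.univ.sup t,
        fun r hr x => funext fun k => hN' k r hr (x k)⟩, fun n => ?_, ?_⟩
    · obtain ⟨x, rfl⟩ := hp n
      refine ⟨fun k => (a ^ t k).mkQ (x k), ?_⟩
      rw [hom_sum, LinearMap.sum_apply]
      conv_rhs => rw [LinearMap.pi_apply_eq_sum_univ p x]
      refine Finset.sum_congr rfl fun k _ => ?_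
      change x k • p (Pi.single k 1) = _
      congr 2
      ext j
      simp [Pi.single_apply, eq_comm]
    · rw [Ext.mk₀_sum, Ext.sum_comp]
      refine Finset.sum_eq_zero fun k _ => ?_
      rw [← Ext.mk₀_comp_mk₀_assoc, ← Ext.mk₀_comp_mk₀_assoc, h0, Ext.comp_zero]

end ModuleCat
end

section
open CategoryTheory.Abelian
variable {R : Type u} [CommRing R]

namespace ModuleCat

lemma ExtEffaceable.exists_forall_eq_zero {ι : Type*} {a : Ideal R} {i : ℕ}
    {X : ι → ModuleCat.{u} R}
    (h : ∀ k, ExtEffaceable a (X k) i) (s : Finset ι) {N : ModuleCat.{u} R}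
    (hN : N.IsFiniteTorsion a) (ξ : ∀ k, Abelian.Ext N (X k) i) :
    ∃ (N' : ModuleCat.{u} R) (p : N' ⟶ N), N'.IsFiniteTorsion a ∧ Function.Surjective p.hom ∧
      ∀ k ∈ s, (Ext.mk₀ p).comp (ξ k) (zero_add i) = 0 := by
  classical
  induction s using Finset.induction_on with
  | empty => exact ⟨N, 𝟙 N, hN, Function.surjective_id, by simp⟩
  | insert k s _ ih =>
    obtain ⟨N₁, p, hN₁, hp, h₁⟩ := ih
    obtain ⟨N₂, q, hN₂, hq, h₂⟩ := h k N₁ hN₁ ((Ext.mk₀ p).comp (ξ k) (zero_add i))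
    refine ⟨N₂, q ≫ p, hN₂, hp.comp hq, fun l hl => ?_⟩
    rw [← Ext.mk₀_comp_mk₀_assoc]
    rcases Finset.mem_insert.1 hl with rfl | hl
    · exact h₂
    · rw [h₁ l hl, Ext.comp_zero]

lemma ExtEffaceable.pi {ι : Type u} [Fintype ι] {a : Ideal R} {i : ℕ}
    (h : ExtEffaceable a (of R R) i) : ExtEffaceable a (of R (ι → R)) i := by
  classical
  intro N hN ξ
  let π (k : ι) : of R (ι → R) ⟶ of R R := ofHom (LinearMap.proj k)
  let σ (k : ι) : of R R ⟶ of R (ι → R) := ofHom (LinearMap.single R (fun _ => R) k)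
  have hσ : ∑ k, π k ≫ σ k = 𝟙 _ := by
    refine hom_ext (LinearMap.ext fun x => ?_)
    rw [hom_sum, LinearMap.sum_apply]
    exact LinearMap.sum_single_apply _ x
  obtain ⟨N', p, hN', hp, h0⟩ := ExtEffaceable.exists_forall_eq_zero (fun _ : ι => h) Finset.univ hN
    fun k => ξ.comp (Ext.mk₀ (π k)) (add_zero i)
  refine ⟨N', p, hN', hp, ?_⟩
  rw [← Ext.comp_mk₀_id ((Ext.mk₀ p).comp ξ (zero_add i)), ← hσ, Ext.mk₀_sum, Ext.comp_sum]
  refine Finset.sum_eq_zero fun k hk => ?_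
  have := (Ext.comp_assoc (Ext.mk₀ p) ξ (Ext.mk₀ (π k)) (zero_add i) (add_zero i)
    (by omega)).trans (h0 k hk)
  rw [← Ext.mk₀_comp_mk₀, ← Ext.comp_assoc (a₁₂ := i) _ _ _ (by omega) (by omega) (by omega),
    this, Ext.zero_comp]

lemma exists_comp_mk₀_eq [IsNoetherianRing R] {σ : Type u} (i : ℕ) (N : ModuleCat.{u} R)
    [Module.Finite R N] (ξ : Abelian.Ext N (of R (σ →₀ R)) i) :
    ∃ (s : Finset σ) (j : of R (s → R) ⟶ of R (σ →₀ R)) (ζ : Abelian.Ext N (of R (s → R)) i),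
      ζ.comp (Ext.mk₀ j) (add_zero i) = ξ := by
  classical
  induction i generalizing N with
  | zero =>
    obtain ⟨f, rfl⟩ := (Ext.mk₀_bijective _ _).2 ξ
    obtain ⟨T, hT⟩ := Module.Finite.fg_top (R := R) (M := N)
    let s : Finset σ := T.sup fun n => (f.hom n).support
    let j : (s → R) →ₗ[R] σ →₀ R := ∑ k : s, Finsupp.lsingle k.1 ∘ₗ LinearMap.proj k
    let g : N →ₗ[R] (s → R) := LinearMap.pi fun k => Finsupp.lapply k.1 ∘ₗ f.hom
    refine ⟨s, ofHom j, Ext.mk₀ (ofHom g), ?_⟩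
    rw [Ext.mk₀_comp_mk₀]
    congr 1
    refine hom_ext (LinearMap.ext_on hT fun n hn => ?_)
    change j (g n) = f.hom n
    have hs : (f.hom n).support ⊆ s := Finset.le_sup (f := fun n => (f.hom n).support) hn
    conv_rhs => rw [← Finsupp.sum_single (f.hom n), Finsupp.sum_of_support_subset _ hs _ (by simp)]
    rw [LinearMap.sum_apply]
    exact Finset.sum_coe_sort s fun k => Finsupp.single k (f.hom n k)
  | succ i ih =>
    obtain ⟨n, p, hp⟩ := Module.Finite.exists_fin' R N
    let p' : (ULift.{u} (Fin n) → R) →ₗ[R] N :=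
      p ∘ₗ (LinearEquiv.funCongrLeft R R Equiv.ulift.symm).toLinearMap
    have hp' : Function.Surjective p' := hp.comp (LinearEquiv.surjective _)
    have hS := LinearMap.shortExact_shortComplexKer hp'
    have : Projective (LinearMap.shortComplexKer p').X₂ :=
      inferInstanceAs (Projective (of R (ULift.{u} (Fin n) → R)))
    have : Module.Finite R (LinearMap.shortComplexKer p').X₁ :=
      inferInstanceAs (Module.Finite R (LinearMap.ker p'))
    obtain ⟨ζ, rfl⟩ := Ext.contravariant_sequence_exact₃ hS _ ξ (Ext.eq_zero_of_projective _)
      (add_comm 1 i)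
    obtain ⟨s, j, η, rfl⟩ := ih _ ζ
    exact ⟨s, j, hS.extClass.comp η (add_comm 1 i),
      Ext.comp_assoc _ _ _ (by omega) (by omega) (by omega)⟩

lemma ExtEffaceable.finsupp [IsNoetherianRing R] {σ : Type u} {a : Ideal R} {i : ℕ}
    (h : ExtEffaceable a (of R R) i) : ExtEffaceable a (of R (σ →₀ R)) i := by
  intro N hN ξ
  have := hN.1
  obtain ⟨s, j, ζ, rfl⟩ := exists_comp_mk₀_eq i N ξ
  obtain ⟨N', p, hN', hp, h0⟩ := h.pi N hN ζ
  refine ⟨N', p, hN', hp, ?_⟩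
  rw [← Ext.comp_assoc (a₁₂ := i) _ _ _ (by omega) (by omega) (by omega), h0, Ext.zero_comp]

lemma extEffaceable_of_forall_lt [IsNoetherianRing R] {a : Ideal R} {c : ℕ}
    (h : ∀ i, c < i → ExtEffaceable a (of R R) i) (i : ℕ) (hi : c < i) (X : ModuleCat.{u} R) :
    ExtEffaceable a X i := by
  obtain ⟨n, hn⟩ := exists_forall_extEffaceable a
  obtain ⟨d, hd⟩ : ∃ d, n ≤ i + d := ⟨n, by omega⟩
  induction d generalizing i X with
  | zero => exact hn i hd X
  | succ d ih =>
    intro N hN ξ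
    let π : (X →₀ R) →ₗ[R] X := Finsupp.linearCombination R id
    have hS := LinearMap.shortExact_shortComplexKer (f := π)
      (Finsupp.linearCombination_surjective R Function.surjective_id)
    obtain ⟨N₁, p, hN₁, hp, h₁⟩ := ih (i + 1) (by omega) _ (by omega) N hN
      (ξ.comp hS.extClass rfl)
    obtain ⟨ζ, hζ⟩ := Ext.covariant_sequence_exact₃ N₁ hS ((Ext.mk₀ p).comp ξ (zero_add i)) rfl
      ((Ext.comp_assoc _ _ _ (by omega) (by omega) (by omega)).trans h₁)
    obtain ⟨N₂, q, hN₂, hq, h₂⟩ := (h i hi).finsupp N₁ hN₁ ζ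
    refine ⟨N₂, q ≫ p, hN₂, hp.comp hq, ?_⟩
    rw [← Ext.mk₀_comp_mk₀_assoc, ← hζ,
      ← Ext.comp_assoc (a₁₂ := i) _ _ _ (by omega) (by omega) (by omega)]
    erw [h₂]
    rw [Ext.zero_comp]

end ModuleCat
end

section
open CategoryTheory.Abelian
variable {R : Type u} [CommRing R]

namespace ModuleCat

lemma subsingleton_ext_pi {ι : Type u} [Fintype ι] {A : Type u} [AddCommGroup A] [Module R A]
    {Y : ModuleCat.{u} R} {i : ℕ} (h : Subsingleton (Abelian.Ext (of R A) Y i)) :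
    Subsingleton (Abelian.Ext (of R (ι → A)) Y i) := by
  classical
  refine subsingleton_of_forall_eq 0 fun ξ => ?_
  let π (k : ι) : of R (ι → A) ⟶ of R A := ofHom (LinearMap.proj k)
  let σ (k : ι) : of R A ⟶ of R (ι → A) := ofHom (LinearMap.single R (fun _ => A) k)
  have hσ : ∑ k, π k ≫ σ k = 𝟙 _ := by
    refine hom_ext (LinearMap.ext fun x => ?_)
    rw [hom_sum, LinearMap.sum_apply]
    exact LinearMap.sum_single_apply _ x
  rw [← Ext.mk₀_id_comp ξ, ← hσ, Ext.mk₀_sum, Ext.sum_comp]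
  refine Finset.sum_eq_zero fun k _ => ?_
  rw [← Ext.mk₀_comp_mk₀_assoc, Subsingleton.elim ((Ext.mk₀ (σ k)).comp ξ _) 0, Ext.comp_zero]

lemma subsingleton_ext_of_annihilated [IsNoetherianRing R] {a : Ideal R} {Y : ModuleCat.{u} R}
    {i : ℕ} (h : ∀ j ≤ i, Subsingleton (Abelian.Ext (of R (R ⧸ a)) Y j)) (N : ModuleCat.{u} R)
    [Module.Finite R N] (hN : ∀ r ∈ a, ∀ x : N, r • x = 0) :
    Subsingleton (Abelian.Ext N Y i) := by
  classical
  obtain ⟨n, p, hp⟩ := Module.Finite.exists_fin' R N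
  let ι := ULift.{u} (Fin n)
  let q : (ι → R ⧸ a) →ₗ[R] N := ∑ k : ι,
    a.liftQ (LinearMap.toSpanSingleton R N (p (Pi.single k.down 1)))
      (fun r hr => hN r hr _) ∘ₗ LinearMap.proj k
  have hq : Function.Surjective q := by
    intro y
    obtain ⟨x, rfl⟩ := hp y
    refine ⟨fun k => a.mkQ (x k.down), ?_⟩
    rw [LinearMap.sum_apply]
    conv_rhs => rw [LinearMap.pi_apply_eq_sum_univ p x]
    refine Fintype.sum_equiv Equiv.ulift _ _ fun k => ?_
    change x k.down • p (Pi.single k.down 1) = _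
    congr 2
    ext j
    simp [Pi.single_apply, eq_comm]
  have hS := LinearMap.shortExact_shortComplexKer hq
  have hfin : Module.Finite R (LinearMap.ker q) := inferInstance
  have hpi (j : ℕ) (hj : j ≤ i) := subsingleton_ext_pi (ι := ι) (h j hj)
  refine subsingleton_of_forall_eq 0 fun ξ => ?_
  match i with
  | 0 =>
    obtain ⟨f, rfl⟩ := (Ext.mk₀_bijective _ _).2 ξ
    have : Epi (ofHom q) := (epi_iff_surjective _).2 hq
    have h0 : ofHom q ≫ f = 0 := by
      refine (Ext.mk₀_bijective _ _).1 ?_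
      have := hpi 0 le_rfl
      exact Subsingleton.elim _ _
    rw [show f = 0 from (cancel_epi (ofHom q)).1 (h0.trans Limits.comp_zero.symm), Ext.mk₀_zero]
  | i + 1 =>
    have := hpi (i + 1) le_rfl
    obtain ⟨ζ, rfl⟩ := Ext.contravariant_sequence_exact₃ hS Y ξ
      (@Subsingleton.elim _ this _ _) (add_comm 1 i)
    have := subsingleton_ext_of_annihilated (fun j hj => h j (Nat.le_succ_of_le hj))
      (of R (LinearMap.ker q)) (fun r hr x => Subtype.ext (funext fun k => by
        obtain ⟨y, hy⟩ := a.mkQ_surjective (x.1 k)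
        change r • x.1 k = 0
        rw [← hy, ← map_smul, Submodule.mkQ_apply, Submodule.Quotient.mk_eq_zero]
        exact Ideal.mul_mem_right _ _ hr))
    rw [@Subsingleton.elim _ this ζ 0, Ext.comp_zero]

lemma subsingleton_ext_of_isFiniteTorsion [IsNoetherianRing R] {a : Ideal R} {Y : ModuleCat.{u} R}
    {i : ℕ} (h : ∀ j ≤ i, Subsingleton (Abelian.Ext (of R (R ⧸ a)) Y j)) {N : ModuleCat.{u} R}
    (hN : N.IsFiniteTorsion a) : Subsingleton (Abelian.Ext N Y i) := by
  obtain ⟨hfin, s, hs⟩ := hN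
  induction s generalizing N with
  | zero =>
    exact subsingleton_ext_of_annihilated h N fun r _ => hs r (by simp)
  | succ s ih =>
    let U : Submodule R N := a • ⊤
    have hS := quotientComplex_shortExact U
    have h₁ : Subsingleton (Abelian.Ext (of R U) Y i) := by
      refine ih (inferInstanceAs (Module.Finite R U)) fun r hr x => Subtype.ext ?_
      change r • x.1 = 0
      refine Submodule.smul_induction_on x.2 (fun b hb y _ => ?_) (fun y z hy hz => ?_)
      · rw [← mul_smul]
        exact hs _ (by rw [pow_succ]; exact Ideal.mul_mem_mul hr hb) y
      · rw [smul_add, hy, hz, add_zero]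
    have h₃ : Subsingleton (Abelian.Ext (of R (N ⧸ U)) Y i) := by
      refine subsingleton_ext_of_annihilated h _ fun r hr x => ?_
      obtain ⟨x, rfl⟩ := U.mkQ_surjective x
      rw [← map_smul, Submodule.mkQ_apply, Submodule.Quotient.mk_eq_zero]
      exact Submodule.smul_mem_smul hr trivial
    refine subsingleton_of_forall_eq 0 fun ξ => ?_
    obtain ⟨ζ, rfl⟩ := Ext.contravariant_sequence_exact₂ hS Y ξ (@Subsingleton.elim _ h₁ _ _)
    rw [@Subsingleton.elim _ h₃ ζ 0, Ext.comp_zero]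

/-- If every module has effaceable `Ext` groups above degree `c`, then the vanishing of
`Ext^j(R / a, Y)` for all `j` can be tested in degrees `j ≤ c`. -/
lemma subsingleton_ext_of_forall_le [IsNoetherianRing R] {a : Ideal R} {Y : ModuleCat.{u} R}
    {c : ℕ} (hc : ∀ i, c < i → ExtEffaceable a Y i)
    (h : ∀ j ≤ c, Subsingleton (Abelian.Ext (of R (R ⧸ a)) Y j)) (i : ℕ) :
    Subsingleton (Abelian.Ext (of R (R ⧸ a)) Y i) := by
  induction i using Nat.strong_induction_on with
  | _ i ih =>
    rcases le_or_gt i c with hi | hi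
    · exact h i hi
    · obtain ⟨i, rfl⟩ := Nat.exists_eq_succ_of_ne_zero (Nat.ne_zero_of_lt hi)
      refine subsingleton_of_forall_eq 0 fun ξ => ?_
      have hfin : (of R (R ⧸ a)).IsFiniteTorsion a := by
        refine ⟨inferInstanceAs (Module.Finite R (R ⧸ a)), 1, fun r hr x => ?_⟩
        obtain ⟨x, rfl⟩ := a.mkQ_surjective x
        rw [← map_smul, Submodule.mkQ_apply, Submodule.Quotient.mk_eq_zero]
        exact Ideal.mul_mem_right _ _ (pow_one a ▸ hr)
      obtain ⟨N, p, hN, hp, h0⟩ := hc _ hi _ hfin ξ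
      have hS := LinearMap.shortExact_shortComplexKer hp
      obtain ⟨ζ, rfl⟩ := Ext.contravariant_sequence_exact₃ hS Y ξ h0 (add_comm 1 i)
      have := subsingleton_ext_of_isFiniteTorsion (fun j hj => ih j (Nat.lt_succ_of_le hj))
        (hN.of_injective (ofHom (LinearMap.ker p.hom).subtype) (Submodule.injective_subtype _))
      rw [@Subsingleton.elim _ this ζ 0, Ext.comp_zero]

/-- Vanishing of local cohomology of `R` above degree `c` makes all `Ext` groups effaceable
above degree `c`. -/
lemma extEffaceable_of_subsingleton_localCohomology [IsNoetherianRing R] {a : Ideal R} {c : ℕ}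
    (h : ∀ i, c < i → Subsingleton ((localCohomology a i).obj (of R R))) (i : ℕ) (hi : c < i)
    (X : ModuleCat.{u} R) : ExtEffaceable a X i := by
  refine extEffaceable_of_forall_lt (fun j hj => ?_) i hi X
  obtain ⟨j, rfl⟩ := Nat.exists_eq_succ_of_ne_zero (Nat.ne_zero_of_lt hj)
  exact (extEffaceable_iff a _ _).2 ((subsingleton_localCohomology_iff a j _).1 (h _ hj))

lemma bddAbove_nontrivial_localCohomology [IsNoetherianRing R] (a : Ideal R)
    (Y : ModuleCat.{u} R) : BddAbove {i : ℕ | Nontrivial ((localCohomology a i).obj Y)} := by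
  obtain ⟨n, hn⟩ := exists_forall_extEffaceable a
  refine ⟨n, fun i hi => ?_⟩
  by_contra! hlt
  obtain ⟨i, rfl⟩ := Nat.exists_eq_succ_of_ne_zero (Nat.ne_zero_of_lt hlt)
  exact not_subsingleton_iff_nontrivial.2 hi ((subsingleton_localCohomology_iff a i Y).2
    ((extEffaceable_iff a _ _).1 (hn _ hlt.le Y)))

end ModuleCat
end

section
open CategoryTheory.Limits CategoryTheory.Pretriangulated
variable (R : Type*) [CommRing R] {C : Type*} [Category C] [Preadditive C] [Linear R C]

namespace CategoryTheory

/-- The ideal of elements of `R` acting as zero on an object of an `R`-linear category. -/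
def Linear.annihilator (K : C) : Ideal R where
  carrier := {r | r • 𝟙 K = 0}
  add_mem' {r s} hr hs := by
    change (r + s) • 𝟙 K = 0
    rw [add_smul, show r • 𝟙 K = 0 from hr, show s • 𝟙 K = 0 from hs, add_zero]
  zero_mem' := zero_smul R _
  smul_mem' r s hs := by
    change (r • s) • 𝟙 K = 0
    rw [smul_assoc, show s • 𝟙 K = 0 from hs, smul_zero]

variable {R}

lemma Linear.mem_annihilator {K : C} {r : R} : r ∈ annihilator R K ↔ r • 𝟙 K = 0 := Iff.rfl

lemma Linear.smul_hom_eq_zero_of_src {K L : C} {r : R} (hr : r ∈ annihilator R K) (f : K ⟶ L) :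
    r • f = 0 := by
  rw [← Category.id_comp f, ← Linear.smul_comp, mem_annihilator.1 hr, zero_comp]

lemma Linear.smul_hom_eq_zero_of_tgt {K L : C} {r : R} (hr : r ∈ annihilator R L) (f : K ⟶ L) :
    r • f = 0 := by
  rw [← Category.comp_id f, ← Linear.comp_smul, mem_annihilator.1 hr, comp_zero]

lemma Linear.annihilator_le_map {D : Type*} [Category D] [Preadditive D] [Linear R D] (F : C ⥤ D)
    [F.Additive] [F.Linear R] (K : C) : annihilator R K ≤ annihilator R (F.obj K) := fun r hr => by
  rw [mem_annihilator, ← F.map_id, ← F.map_smul, mem_annihilator.1 hr, F.map_zero]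

lemma Linear.annihilator_map_le {D : Type*} [Category D] [Preadditive D] [Linear R D] (F : C ⥤ D)
    [F.Additive] [F.Linear R] [F.Faithful] (K : C) :
    annihilator R (F.obj K) ≤ annihilator R K := fun r hr => F.map_injective (by
  rw [F.map_smul, F.map_id, mem_annihilator.1 hr, F.map_zero])

lemma Linear.annihilator_le_of_iso {K L : C} (e : K ≅ L) :
    annihilator R K ≤ annihilator R L := fun r hr => by
  rw [mem_annihilator, ← e.inv_hom_id, ← Linear.comp_smul, smul_hom_eq_zero_of_src hr, comp_zero]

variable [HasZeroObject C] [HasShift C ℤ] [∀ n : ℤ, (shiftFunctor C n).Additive]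
  [Pretriangulated C]

lemma Pretriangulated.mul_mem_annihilator_obj₃ {T : Triangle C} (hT : T ∈ distTriang C) {r s : R}
    (hr : r • T.mor₂ = 0) (hs : s • T.mor₃ = 0) : s * r ∈ Linear.annihilator R T.obj₃ := by
  have h : T.mor₂ ≫ (r • 𝟙 T.obj₃) = 0 := by rw [Linear.comp_smul, Category.comp_id, hr]
  obtain ⟨u, hu⟩ := Triangle.yoneda_exact₃ T hT _ h
  rw [Linear.mem_annihilator, mul_smul, hu, ← Linear.smul_comp, hs, zero_comp]

variable [∀ n : ℤ, (shiftFunctor C n).Linear R]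

lemma Pretriangulated.mul_mem_annihilator {T : Triangle C} (hT : T ∈ distTriang C) {r s : R}
    (hr : r ∈ Linear.annihilator R T.obj₁) (hs : s ∈ Linear.annihilator R T.obj₂) :
    r * s ∈ Linear.annihilator R T.obj₃ :=
  mul_mem_annihilator_obj₃ hT (Linear.smul_hom_eq_zero_of_src hs _)
    (Linear.smul_hom_eq_zero_of_tgt (Linear.annihilator_le_map (shiftFunctor C (1 : ℤ)) _ hr) _)

/-- The cone of multiplication by `x` on `K`: it is killed by `x ^ 2`, nilpotent scalars on `K`
stay nilpotent, and orthogonality to a shift-stable class of objects killed by `x` is not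
affected. -/
lemma exists_cone_smul (x : R) (K : C) :
    ∃ Y : C, x * x ∈ Linear.annihilator R Y ∧
      (∀ r ∈ Linear.annihilator R K, r * r ∈ Linear.annihilator R Y) ∧
      (∀ (P : ObjectProperty C) [P.IsTriangulated] [P.IsClosedUnderIsomorphisms], P K → P Y) ∧
      ∀ (P : ObjectProperty C) [P.IsStableUnderShift ℤ],
        (∀ X, P X → x ∈ Linear.annihilator R X) →
        (P.rightOrthogonal K ↔ P.rightOrthogonal Y) ∧
          (P.leftOrthogonal K ↔ P.leftOrthogonal Y) := by
  obtain ⟨Y, g, h, hT⟩ := distinguished_cocone_triangle (x • 𝟙 K)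
  have hg : x • g = 0 := by
    have := comp_distTriang_mor_zero₁₂ _ hT
    change (x • 𝟙 K) ≫ g = 0 at this
    rwa [Linear.smul_comp, Category.id_comp] at this
  have hmap : (x • 𝟙 K)⟦(1 : ℤ)⟧' = x • 𝟙 (K⟦(1 : ℤ)⟧) := by
    rw [Functor.map_smul, Functor.map_id]
  have hh : x • h = 0 := by
    have := comp_distTriang_mor_zero₃₁ _ hT
    change h ≫ (x • 𝟙 K)⟦(1 : ℤ)⟧' = 0 at this
    rwa [hmap, Linear.comp_smul, Category.comp_id] at this
  refine ⟨Y, mul_mem_annihilator_obj₃ hT hg hh, fun r hr => mul_mem_annihilator hT hr hr,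
    fun P _ _ hK => P.ext_of_isTriangulatedClosed₃ _ hT hK hK, fun P _ hP => ⟨⟨fun hK => ?_,
      fun hY => ?_⟩, ⟨fun hK => ?_, fun hY => ?_⟩⟩⟩
  · exact P.rightOrthogonal.ext_of_isTriangulatedClosed₃ _ hT hK hK
  · have : P.rightOrthogonal (K⟦(1 : ℤ)⟧) := fun X f hX => by
      obtain ⟨u, rfl⟩ := Triangle.coyoneda_exact₁ _ hT f (by
        change f ≫ (x • 𝟙 K)⟦(1 : ℤ)⟧' = 0
        rw [hmap, Linear.comp_smul, Category.comp_id, Linear.smul_hom_eq_zero_of_src (hP X hX)])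
      exact (congrArg (· ≫ h) (hY u hX)).trans zero_comp
    have := P.rightOrthogonal.le_shift (-1 : ℤ) _ this
    exact P.rightOrthogonal.prop_of_iso ((shiftEquiv C (1 : ℤ)).unitIso.symm.app K) this
  · exact P.leftOrthogonal.ext_of_isTriangulatedClosed₃ _ hT hK hK
  · intro Z f hZ
    obtain ⟨u, rfl⟩ := Triangle.yoneda_exact₂ _ hT f (by
      change (x • 𝟙 K) ≫ f = 0
      rw [Linear.smul_comp, Category.id_comp, Linear.smul_hom_eq_zero_of_tgt (hP Z hZ)])
    exact (congrArg (g ≫ ·) (hY u hZ)).trans comp_zero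

/-- Iterating cones of multiplication by generators of a finitely generated ideal. -/
lemma exists_annihilator_radical_of_fg {a : Ideal R} (ha : a.FG) (K : C) :
    ∃ Y : C, a ≤ (Linear.annihilator R Y).radical ∧
      (∀ (P : ObjectProperty C) [P.IsTriangulated] [P.IsClosedUnderIsomorphisms], P K → P Y) ∧
      ∀ (P : ObjectProperty C) [P.IsStableUnderShift ℤ],
        (∀ X, P X → a ≤ Linear.annihilator R X) →
        (P.rightOrthogonal K ↔ P.rightOrthogonal Y) ∧
          (P.leftOrthogonal K ↔ P.leftOrthogonal Y) := by
  classical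
  obtain ⟨s, rfl⟩ := ha
  induction s using Finset.induction_on with
  | empty => exact ⟨K, by simp, fun P _ _ => id, fun P _ _ => ⟨Iff.rfl, Iff.rfl⟩⟩
  | insert x s _ ih =>
    obtain ⟨Y, h₁, h₂, h₃⟩ := ih
    obtain ⟨Z, hx, hr, hP, hP'⟩ := exists_cone_smul x Y
    have hle : Submodule.span R (s : Set R) ≤ Submodule.span R (insert x s : Finset R) :=
      Submodule.span_mono (by simp)
    have hmem : x ∈ Submodule.span R ((insert x s : Finset R) : Set R) :=
      Submodule.subset_span (by simp)
    refine ⟨Z, Submodule.span_le.2 fun y hy => ?_, fun P _ _ hK => hP P (h₂ P hK),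
      fun P _ h => ?_⟩
    · rcases Finset.mem_insert.1 hy with rfl | hy
      · exact ⟨2, by rwa [pow_two]⟩
      · obtain ⟨n, hn⟩ := h₁ (Submodule.subset_span hy)
        exact ⟨n + n, by rw [pow_add]; exact hr _ hn⟩
    · have := h₃ P fun X hX => hle.trans (h X hX)
      have h' := hP' P fun X hX => h X hX hmem
      exact ⟨this.1.trans h'.1, this.2.trans h'.2⟩

end CategoryTheory
end

section
open CategoryTheory.Limits CategoryTheory.Pretriangulated CategoryTheory.Triangulated
universe w v u
variable {C : Type u} [Category.{v} C] [Abelian C] [HasDerivedCategory.{w} C]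

namespace DerivedCategory
open TStructure

/-- The lowest cohomology object of an object that is `≥ n`. -/
lemma exists_singleFunctor_hom_of_isGE (K : DerivedCategory C) (n : ℤ) [K.IsGE n] :
    ∃ (A : C) (ι : (singleFunctor C n).obj A ⟶ K),
      (∀ (W : DerivedCategory C) [W.IsLE n] (f : W ⟶ (singleFunctor C n).obj A),
        f ≫ ι = 0 → f = 0) ∧ (IsZero A → K.IsGE (n + 1)) := by
  obtain ⟨X, Z, hX, hZ, f, g, h, hT⟩ := t.exists_triangle K n (n + 1) rfl
  have hX' : X.IsLE n := ⟨hX⟩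
  have hZge : Z.IsGE (n + 1) := ⟨hZ⟩
  have hs : (Z⟦(-1 : ℤ)⟧).IsGE (n + 2) := t.isGE_shift Z (n + 1) (-1) (n + 2) (by lia)
  have hs' : (Z⟦(-1 : ℤ)⟧).IsGE n := t.isGE_of_ge _ n (n + 2)
  have hXn : X.IsGE n := t.isGE₂ _ (inv_rot_of_distTriang _ hT) n hs' ‹_›
  obtain ⟨A, ⟨e⟩⟩ := X.exists_iso_singleFunctor_obj_of_isGE_of_isLE n
  refine ⟨A, e.inv ≫ f, fun W _ u hu => ?_, fun hA => ?_⟩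
  · have hz : (u ≫ e.inv) ≫ f = 0 := by rw [Category.assoc, hu]
    obtain ⟨v, hv⟩ := Triangle.coyoneda_exact₂ _ (inv_rot_of_distTriang _ hT) (u ≫ e.inv) hz
    have hv0 : v = 0 := t.zero (Y := Z⟦(-1 : ℤ)⟧) v n (n + 2)
    rw [hv0] at hv
    rw [← cancel_mono e.inv, zero_comp]
    exact hv.trans zero_comp
  · have hX0 : IsZero X := (Functor.map_isZero (singleFunctor C n) hA).of_iso e
    have : X.IsGE (n + 1) := t.isGE_of_isZero hX0 _
    exact t.isGE₂ _ hT _ this hZge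

/-- The highest cohomology object of an object that is `≤ n`. -/
lemma exists_hom_singleFunctor_of_isLE (K : DerivedCategory C) (n : ℤ) [K.IsLE n] :
    ∃ (A : C) (π : K ⟶ (singleFunctor C n).obj A),
      (∀ (W : DerivedCategory C) [W.IsGE n] (f : (singleFunctor C n).obj A ⟶ W),
        π ≫ f = 0 → f = 0) ∧ (IsZero A → K.IsLE (n - 1)) := by
  obtain ⟨X, Z, hX, hZ, f, g, h, hT⟩ := t.exists_triangle K (n - 1) n (by lia)
  have hX' : X.IsLE (n - 1) := ⟨hX⟩
  have hZ' : Z.IsGE n := ⟨hZ⟩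
  have hs : (X⟦(1 : ℤ)⟧).IsLE (n - 2) := t.isLE_shift X (n - 1) 1 (n - 2) (by lia)
  have hs' : (X⟦(1 : ℤ)⟧).IsLE n := t.isLE_of_le _ (n - 2) n
  have hZn : Z.IsLE n := t.isLE₂ _ (rot_of_distTriang _ hT) n ‹_› hs'
  obtain ⟨A, ⟨e⟩⟩ := Z.exists_iso_singleFunctor_obj_of_isGE_of_isLE n
  refine ⟨A, g ≫ e.hom, fun W _ u hu => ?_, fun hA => ?_⟩
  · have hz : g ≫ (e.hom ≫ u) = 0 := by rw [← Category.assoc, hu]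
    obtain ⟨v, hv⟩ := Triangle.yoneda_exact₃ _ hT (e.hom ≫ u) hz
    have hv0 : v = 0 := t.zero (X := X⟦(1 : ℤ)⟧) v (n - 2) n
    rw [hv0] at hv
    rw [← cancel_epi e.hom, comp_zero]
    exact hv.trans comp_zero
  · have hX0 : IsZero Z := (Functor.map_isZero (singleFunctor C n) hA).of_iso e
    have : Z.IsLE (n - 1) := t.isLE_of_isZero hX0 _
    exact t.isLE₂ _ hT _ hX' this

variable (N : C)

/-- The shifts of an object of an abelian category, as objects of its derived category. -/
def isSingle : ObjectProperty (DerivedCategory C) := fun X =>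
  ∃ n : ℤ, Nonempty (X ≅ (singleFunctor C n).obj N)

instance : (isSingle N).IsStableUnderShift ℤ where
  isStableUnderShiftBy a := ⟨fun X ⟨n, ⟨e⟩⟩ => ⟨n - a, ⟨(shiftFunctor _ a).mapIso e ≪≫
    ((singleFunctors C).shiftIso a (n - a) n (by lia)).app N⟩⟩⟩

variable {N}

lemma isSingle_singleFunctor (n : ℤ) : isSingle N ((singleFunctor C n).obj N) :=
  ⟨n, ⟨Iso.refl _⟩⟩

section
variable {R : Type*} [CommRing R] [Linear R C]

/-- A bounded object right orthogonal to the shifts of `N` is zero as soon as `N` detects zero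
objects among those killed by the same scalars. -/
lemma isZero_of_rightOrthogonal (d : ℕ) (n : ℤ) (K : DerivedCategory C) [K.IsGE n]
    [K.IsLE (n + d - 1)]
    (hN : ∀ A : C, Linear.annihilator R K ≤ Linear.annihilator R A → (∀ f : N ⟶ A, f = 0) →
      IsZero A) (hK : (isSingle N).rightOrthogonal K) : IsZero K := by
  induction d generalizing n with
  | zero => exact t.isZero K (n + (0 : ℕ) - 1) n (by simp)
  | succ d ih =>
    obtain ⟨A, ι, h₁, h₂⟩ := exists_singleFunctor_hom_of_isGE K n
    have hA : IsZero A := hN A (fun r hr => Linear.annihilator_map_le (singleFunctor C n) A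
        (h₁ _ _ (by rw [Linear.smul_comp, Linear.smul_hom_eq_zero_of_tgt hr])))
      fun f => (singleFunctor C n).map_injective (by
        rw [Functor.map_zero]
        exact h₁ _ _ (hK _ (isSingle_singleFunctor n)))
    have := h₂ hA
    have : K.IsLE (n + 1 + d - 1) := by
      convert ‹K.IsLE _› using 1
      push_cast
      ring
    exact ih (n + 1)

/-- A bounded object left orthogonal to the shifts of `N` is zero as soon as `N` detects zero
objects among those killed by the same scalars. -/
lemma isZero_of_leftOrthogonal (d : ℕ) (n : ℤ) (K : DerivedCategory C) [K.IsLE n]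
    [K.IsGE (n - d + 1)]
    (hN : ∀ A : C, Linear.annihilator R K ≤ Linear.annihilator R A → (∀ f : A ⟶ N, f = 0) →
      IsZero A) (hK : (isSingle N).leftOrthogonal K) : IsZero K := by
  induction d generalizing n with
  | zero => exact t.isZero K n (n - (0 : ℕ) + 1) (by simp)
  | succ d ih =>
    obtain ⟨A, π, h₁, h₂⟩ := exists_hom_singleFunctor_of_isLE K n
    have hA : IsZero A := hN A (fun r hr => Linear.annihilator_map_le (singleFunctor C n) A
        (h₁ _ _ (by rw [Linear.comp_smul, Linear.smul_hom_eq_zero_of_src hr])))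
      fun f => (singleFunctor C n).map_injective (by
        rw [Functor.map_zero]
        exact h₁ _ _ (hK _ (isSingle_singleFunctor n)))
    have := h₂ hA
    have : K.IsGE (n - 1 - d + 1) := by
      convert ‹K.IsGE _› using 1
      push_cast
      ring
    exact ih (n - 1)

lemma annihilator_le_of_isSingle {X : DerivedCategory C} (hX : isSingle N X) :
    Linear.annihilator R N ≤ Linear.annihilator R X := by
  obtain ⟨n, ⟨e⟩⟩ := hX
  exact (Linear.annihilator_le_map _ _).trans (Linear.annihilator_le_of_iso e.symm)

end

/-- If `N` and `W` detect zero objects among those on which `a` acts nilpotently, then they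
detect the same bounded complexes. -/
lemma rightOrthogonal_iff_leftOrthogonal {R : Type*} [CommRing R] [Linear R C] {a : Ideal R}
    (ha : a.FG) {N W : C} (hNa : a ≤ Linear.annihilator R N) (hWa : a ≤ Linear.annihilator R W)
    (hN : ∀ A : C, a ≤ (Linear.annihilator R A).radical → (∀ f : N ⟶ A, f = 0) → IsZero A)
    (hW : ∀ A : C, a ≤ (Linear.annihilator R A).radical → (∀ f : A ⟶ W, f = 0) → IsZero A)
    (K : DerivedCategory C) (hK : t.bounded K) :
    (isSingle N).rightOrthogonal K ↔ (isSingle W).leftOrthogonal K := by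
  obtain ⟨Y, hYa, hP, hY⟩ := exists_annihilator_radical_of_fg ha K
  obtain ⟨⟨n, hn⟩, ⟨m, hm⟩⟩ := hP t.bounded hK
  have hm' : Y.IsLE m := hm
  have hn' : Y.IsGE n := hn
  rw [(hY (isSingle N) fun X hX => hNa.trans (annihilator_le_of_isSingle hX)).1,
    (hY (isSingle W) fun X hX => hWa.trans (annihilator_le_of_isSingle hX)).2]
  constructor
  · intro h
    have : Y.IsLE (n + (m - n + 1).toNat - 1) := t.isLE_of_le _ m _
    have h0 := isZero_of_rightOrthogonal (R := R) (m - n + 1).toNat n Y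
      (fun A hA => hN A (hYa.trans (Ideal.radical_mono hA))) h
    exact fun Z f _ => h0.eq_of_src _ _
  · intro h
    have : Y.IsGE (m - (m - n + 1).toNat + 1) := t.isGE_of_ge _ _ n
    have h0 := isZero_of_leftOrthogonal (R := R) (m - n + 1).toNat m Y
      (fun A hA => hW A (hYa.trans (Ideal.radical_mono hA))) h
    exact fun Z f _ => h0.eq_of_tgt _ _

end DerivedCategory
end

section
open CategoryTheory.Limits CategoryTheory.Pretriangulated CategoryTheory.Triangulated
universe w w' v u
variable {C : Type u} [Category.{v} C] [Abelian C] [HasDerivedCategory.{w} C] [HasExt.{w'} C]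

namespace DerivedCategory
open TStructure

lemma subsingleton_ext_iff (X Y : C) (i : ℕ) : Subsingleton (Abelian.Ext X Y i) ↔
    ∀ f : (singleFunctor C 0).obj X ⟶ ((singleFunctor C 0).obj Y)⟦(i : ℤ)⟧, f = 0 := by
  rw [Abelian.Ext.homEquiv.subsingleton_congr]
  exact ⟨fun h f => h.elim f 0, fun h => ⟨fun f g => (h f).trans (h g).symm⟩⟩

lemma rightOrthogonal_singleFunctor_iff (N Q : C) :
    (isSingle N).rightOrthogonal ((singleFunctor C 0).obj Q) ↔
      ∀ i, Subsingleton (Abelian.Ext N Q i) := by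
  simp only [subsingleton_ext_iff]
  refine ⟨fun h i f => (isSingle N).rightOrthogonal.le_shift (i : ℤ) _ h f
    (isSingle_singleFunctor 0), fun h X f ⟨n, ⟨e⟩⟩ => ?_⟩
  rw [← cancel_epi e.inv, comp_zero]
  rcases lt_or_ge n 0 with hn | hn
  · exact t.zero _ n 0
  · obtain ⟨i, rfl⟩ := Int.eq_ofNat_of_zero_le hn
    apply (shiftFunctor (DerivedCategory C) (i : ℤ)).map_injective
    rw [Functor.map_zero, ← cancel_epi (((singleFunctors C).shiftIso (i : ℤ) 0 i
      (by simp)).inv.app N), comp_zero]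
    exact h i _

lemma leftOrthogonal_singleFunctor_iff (Q W : C) :
    (isSingle W).leftOrthogonal ((singleFunctor C 0).obj Q) ↔
      ∀ i, Subsingleton (Abelian.Ext Q W i) := by
  simp only [subsingleton_ext_iff]
  refine ⟨fun h i f => h f ((isSingle W).le_shift (i : ℤ) _ (isSingle_singleFunctor 0)),
    fun h X f ⟨n, ⟨e⟩⟩ => ?_⟩
  rw [← cancel_mono e.hom, zero_comp]
  rcases lt_or_ge 0 n with hn | hn
  · exact t.zero _ 0 n
  · obtain ⟨i, hi⟩ := Int.eq_ofNat_of_zero_le (neg_nonneg.2 hn)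
    obtain rfl : n = -i := by lia
    rw [← cancel_mono (((singleFunctors C).shiftIso (i : ℤ) (-i) 0 (by simp)).inv.app W),
      zero_comp]
    exact h i _

end DerivedCategory

/-- If `N` and `W` are killed by `a` and detect zero objects among those on which `a` acts
nilpotently, then `Ext`-orthogonality to `N` and to `W` are equivalent. -/
lemma CategoryTheory.Abelian.forall_subsingleton_ext_iff {C : Type u} [Category.{v} C] [Abelian C]
    [HasExt.{w'} C] {R : Type*} [CommRing R] [Linear R C] {a : Ideal R}
    (ha : a.FG) {N W : C} (hNa : a ≤ Linear.annihilator R N) (hWa : a ≤ Linear.annihilator R W)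
    (hN : ∀ A : C, a ≤ (Linear.annihilator R A).radical → (∀ f : N ⟶ A, f = 0) → IsZero A)
    (hW : ∀ A : C, a ≤ (Linear.annihilator R A).radical → (∀ f : A ⟶ W, f = 0) → IsZero A)
    (Q : C) : (∀ i, Subsingleton (Ext N Q i)) ↔ ∀ i, Subsingleton (Ext Q W i) := by
  let := HasDerivedCategory.standard C
  rw [← DerivedCategory.rightOrthogonal_singleFunctor_iff,
    ← DerivedCategory.leftOrthogonal_singleFunctor_iff]
  exact DerivedCategory.rightOrthogonal_iff_leftOrthogonal ha hNa hWa hN hW _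
    ⟨⟨0, inferInstance⟩, ⟨0, inferInstance⟩⟩
end

section
variable {R : Type u} [CommRing R]

namespace ModuleCat

lemma mem_annihilator_iff {A : ModuleCat.{u} R} {r : R} :
    r ∈ Linear.annihilator R A ↔ ∀ x : A, r • x = 0 := by
  rw [Linear.mem_annihilator, ModuleCat.hom_ext_iff, LinearMap.ext_iff]
  exact Iff.rfl

lemma isZero_of_hom_quotient_eq_zero {a : Ideal R} (ha : a.FG) (A : ModuleCat.{u} R)
    (hA : a ≤ (Linear.annihilator R A).radical) (h : ∀ f : of R (R ⧸ a) ⟶ A, f = 0) :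
    Limits.IsZero A := by
  obtain ⟨k, hk⟩ := Ideal.exists_pow_le_of_le_radical_of_fg hA ha
  have key : ∀ (k : ℕ) (x : A), (∀ r ∈ a ^ k, r • x = 0) → x = 0 := fun k => by
    induction k with
    | zero => exact fun x hx => by simpa using hx 1 (by simp)
    | succ k ih =>
      refine fun x hx => ih x fun s hs => ?_
      let f : (R ⧸ a) →ₗ[R] A := Submodule.liftQ a (LinearMap.toSpanSingleton R A (s • x))
        fun r hr => by
          rw [LinearMap.mem_ker, LinearMap.toSpanSingleton_apply, smul_smul]
          exact hx _ (by rw [pow_succ']; exact Ideal.mul_mem_mul hr hs)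
      have hf : f (Submodule.Quotient.mk 1) = 0 := by
        have : f = 0 := congrArg ModuleCat.Hom.hom (h (ofHom f))
        rw [this, LinearMap.zero_apply]
      rwa [Submodule.liftQ_apply, LinearMap.toSpanSingleton_apply, one_smul] at hf
  have : Subsingleton A := subsingleton_of_forall_eq 0 fun x =>
    key k x fun r hr => mem_annihilator_iff.1 (hk hr) x
  exact isZero_of_subsingleton A

lemma isZero_of_hom_characterModule_eq_zero {a : Ideal R} (ha : a.FG) (A : ModuleCat.{u} R)
    (hA : a ≤ (Linear.annihilator R A).radical)
    (h : ∀ f : A ⟶ of R (CharacterModule (R ⧸ a)), f = 0) : Limits.IsZero A := by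
  obtain ⟨k, hk⟩ := Ideal.exists_pow_le_of_le_radical_of_fg hA ha
  have h₁ : Subsingleton (A →ₗ[R] CharacterModule (R ⧸ a)) :=
    subsingleton_of_forall_eq 0 fun f => congrArg ModuleCat.Hom.hom (h (ofHom f))
  have h₂ := CharacterModule.subsingleton_hom_iff.1 h₁
  have h₃ : (a • ⊤ : Submodule R A) = ⊤ := Submodule.Quotient.subsingleton_iff.1
    ((TensorProduct.comm R A (R ⧸ a)).trans
      (TensorProduct.quotTensorEquivQuotSMul A a)).symm.toEquiv.subsingleton
  have h₄ : (a ^ k • ⊤ : Submodule R A) = ⊤ := by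
    clear hk
    induction k with
    | zero => simp
    | succ k ih => rw [pow_succ, Submodule.mul_smul, h₃, ih]
  have h₅ : (⊤ : Submodule R A) = ⊥ := by
    rw [← h₄, eq_bot_iff, Submodule.smul_le]
    exact fun r hr x _ => mem_annihilator_iff.1 (hk hr) x
  have : Subsingleton A := (Submodule.subsingleton_iff R).1 (subsingleton_of_bot_eq_top h₅.symm)
  exact isZero_of_subsingleton A

/-- Orthogonality to `R ⧸ a` on the left and to its character module on the right agree. -/
lemma forall_subsingleton_ext_quotient_iff {a : Ideal R} (ha : a.FG) (Q : ModuleCat.{u} R) :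
    (∀ i, Subsingleton (Abelian.Ext (of R (R ⧸ a)) Q i)) ↔
      ∀ i, Subsingleton (Abelian.Ext Q (of R (CharacterModule (R ⧸ a))) i) := by
  have hq : ∀ r ∈ a, ∀ x : R ⧸ a, r • x = 0 := fun r hr x => by
    rw [Algebra.smul_def, Ideal.Quotient.algebraMap_eq, Ideal.Quotient.eq_zero_iff_mem.2 hr,
      zero_mul]
  exact Abelian.forall_subsingleton_ext_iff ha
    (fun r hr => mem_annihilator_iff.2 (hq r hr))
    (fun r hr => mem_annihilator_iff.2 fun c => DFunLike.ext (F := CharacterModule (R ⧸ a)) _ _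
      fun x => (congrArg c (hq r hr x)).trans (map_zero (show CharacterModule (R ⧸ a) from c)))
    (isZero_of_hom_quotient_eq_zero ha) (isZero_of_hom_characterModule_eq_zero ha) Q

end ModuleCat
end

/-- For an `R`-module `M` with `Supp M ⊆ V(a)` and `c = cd(a, R)` the cohomological dimension
of `R` with respect to `a`, `M` is `a`-cofinite (i.e. `Supp M ⊆ V(a)` and `Ext^i(R/a, M)` is
finitely generated for every `i ≥ 0`) if and only if `Tor_i(R/a, M)` is a finitely generated
`R`-module for every `0 ≤ i ≤ c`. -/
theorem cofinite_iff_tor_finite_up_to_cd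
    {R : Type u} [CommRing R] [IsNoetherianRing R] (a : Ideal R)
    (M : Type u) [AddCommGroup M] [Module R M]
    (hsupp : Module.support R M ⊆ PrimeSpectrum.zeroLocus (a : Set R))
    (c : ℕ)
    (hc : c = sSup {i : ℕ | Nontrivial ((localCohomology a i).obj (ModuleCat.of R R))}) :
    (Module.support R M ⊆ PrimeSpectrum.zeroLocus (a : Set R) ∧
      ∀ i : ℕ, Module.Finite R
        (((Ext R (ModuleCat.{u} R) i).obj
          (Opposite.op (ModuleCat.of R (R ⧸ a)))).obj (ModuleCat.of R M))) ↔
      (∀ i : ℕ, i ≤ c → Module.Finite R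
        (((Tor (ModuleCat.{u} R) i).obj (ModuleCat.of R (R ⧸ a))).obj (ModuleCat.of R M))) := by
  have ha : a.FG := IsNoetherian.noetherian a
  have hdual (I : Type u) :
      (∀ i, Subsingleton (Abelian.Ext (ModuleCat.of R (R ⧸ a))
        (ModuleCat.of R (FamilyQuotient R I M)) i)) ↔
      ∀ i, Subsingleton (Abelian.Ext (ModuleCat.of R (R ⧸ a))
        (ModuleCat.of R (CharacterModule (FamilyQuotient R I M))) i) :=
    (ModuleCat.forall_subsingleton_ext_quotient_iff ha _).trans
      (forall_congr' fun i => CharacterModule.subsingleton_ext_symm _ _ i)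
  have hcd (i : ℕ) (hi : c < i) :
      Subsingleton ((localCohomology a i).obj (ModuleCat.of R R)) := by
    by_contra h
    rw [not_subsingleton_iff_nontrivial] at h
    exact hi.not_ge (hc ▸ le_csSup (ModuleCat.bddAbove_nontrivial_localCohomology a _) h)
  simp only [ModuleCat.finite_ext_iff_finite_abelianExt, ModuleCat.finite_abelianExt_iff,
    ModuleCat.finite_tor_iff]
  constructor
  · exact fun h i _ I => (hdual I).1 (fun j => h.2 j I) i
  · exact fun h => ⟨hsupp, fun i I => (hdual I).2 (ModuleCat.subsingleton_ext_of_forall_le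
      (fun j hj => ModuleCat.extEffaceable_of_subsingleton_localCohomology hcd j hj _)
      fun j hj => h j hj I) i⟩
end
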